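/- Let k be a field, V a finite-dimensional k-vector space, and U ⊆ ℙ(V) an open subset whose closed complement Z = ℙ(V) ∖ U has codimension at least three. Then for every affine scheme S over k, restriction of line bundles along the open immersion U × S ↪ ℙ(V) × S is an equivalence of groupoids: every line bundle on U × S extends to a line bundle on ℙ(V) × S, the extension is unique up to isomorphism, and every isomorphism of line bundles over U × S extends uniquely to an isomorphism of the extensions over ℙ(V) × S. -/

import Mathlib

/-!
STATEMENT 2: Let `k` be a field, `V` a finite-dimensional `k`-vector space, and
`U ⊆ ℙ(V)` an open subset whose closed complement has codimension at least three.
Then for every affine scheme `S` over `k`, restriction of line bundles along the open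
immersion `U × S ↪ ℙ(V) × S` is an equivalence of groupoids: every line bundle on
`U × S` extends to a line bundle on `ℙ(V) × S` (uniquely up to isomorphism), and every
isomorphism of line bundles over `U × S` extends uniquely to an isomorphism of the
extensions over `ℙ(V) × S`.

Here `ℙ(V)` is modelled as `Proj` of the symmetric algebra of `V` (the polynomial ring
on a basis of `V` with its standard grading), `ℙ(V) × S` is the fiber product
`ℙ(V) ×_{Spec k} S`, and `U × S` is the open subscheme `pr₁⁻¹(U)` of `ℙ(V) × S`.
A line bundle on a scheme `X` is a sheaf of `O_X`-modules which is Zariski-locally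
isomorphic to the structure sheaf.
-/

open AlgebraicGeometry CategoryTheory TopologicalSpace Opposite Limits

attribute [local instance] MvPolynomial.gradedAlgebra

noncomputable section

/-- Restriction of sheaves of modules along the inclusion of an open subscheme
`W ⊆ X`: the sections of the restriction over an open `V ⊆ W` are the sections
of the original sheaf over `V` viewed inside `X`. -/
def AlgebraicGeometry.Scheme.restrictModules {X : Scheme} (W : X.Opens) :
    X.Modules ⥤ (W : Scheme).Modules :=
  haveI : (W.ι.opensFunctor).IsContinuous
      (Opens.grothendieckTopology (W : Scheme))
      (Opens.grothendieckTopology X) :=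
    (Scheme.Hom.isOpenEmbedding W.ι).functor_isContinuous
  SheafOfModules.pushforward (F := W.ι.opensFunctor) (Sheaf.Hom.mk (𝟙 _))

/-- A sheaf of modules on a scheme `X` is a line bundle (an invertible sheaf) if it is
Zariski-locally isomorphic to the structure sheaf `O_X` (the free module of rank one). -/
def AlgebraicGeometry.Scheme.Modules.IsLineBundle {X : Scheme} (M : X.Modules) : Prop :=
  ∀ x : X, ∃ W : X.Opens, x ∈ W ∧
    Nonempty ((Scheme.restrictModules W).obj M ≅ SheafOfModules.unit _)

variable (k : Type) [Field k] (V : Type) [AddCommGroup V] [Module k V] [FiniteDimensional k V]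

/-- The index type of a chosen basis of `V`. -/
abbrev PCoord := Module.Free.ChooseBasisIndex k V

/-- The symmetric algebra of `V`, modelled as the polynomial ring on a basis of `V`,
with its standard grading by (total) degree. -/
abbrev symAlgGrading := MvPolynomial.homogeneousSubmodule (PCoord k V) k

/-- The projective space `ℙ(V)`, as `Proj` of the symmetric algebra of `V`. -/
def ProjSpace : Scheme := Proj (symAlgGrading k V)

/-- The structure morphism `ℙ(V) ⟶ Spec k`. -/
def ProjSpace.toSpec : ProjSpace k V ⟶ Spec (CommRingCat.of k) :=
  Proj.toSpecZero (symAlgGrading k V) ≫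
    Spec.map (CommRingCat.ofHom (algebraMap k (symAlgGrading k V 0)))

section LocalMonicGenerator

open Polynomial IsLocalRing

/-- Nakayama's lemma for `C`-submodules of `C[X]` containing the multiples of a monic polynomial. -/
lemma le_of_le_sup_maximalIdeal_smul_of_monic {C : Type*} [CommRing C] [IsLocalRing C] {G : C[X]}
    (hG : G.Monic) (J : Ideal C[X]) (hJ : J.FG) (N' : Submodule C C[X])
    (hGN : ∀ a, G * a ∈ N')
    (h : J.restrictScalars C ≤ N' ⊔ maximalIdeal C • J.restrictScalars C) :
    J.restrictScalars C ≤ N' := by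
  have := hG.finite_quotient
  let π : C[X] →ₗ[C] C[X] ⧸ Ideal.span {G} := (Ideal.Quotient.mkₐ C (Ideal.span {G})).toLinearMap
  have hfg : ((J.restrictScalars C).map π).FG := by
    have h1 : (J.map (Ideal.Quotient.mk (Ideal.span {G}))).FG := hJ.map _
    have h2 : Module.Finite (C[X] ⧸ Ideal.span {G}) (J.map (Ideal.Quotient.mk (Ideal.span {G}))) :=
      Module.Finite.iff_fg.mpr h1
    have h3 : Module.Finite C (J.map (Ideal.Quotient.mk (Ideal.span {G}))) :=
      Module.Finite.trans (C[X] ⧸ Ideal.span {G}) _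
    have h4 : ((J.map (Ideal.Quotient.mk (Ideal.span {G}))).restrictScalars C).FG :=
      Module.Finite.iff_fg.mp h3
    have h5 : (J.restrictScalars C).map π =
        (J.map (Ideal.Quotient.mk (Ideal.span {G}))).restrictScalars C := by
      ext y
      exact (Ideal.mem_map_iff_of_surjective _ Ideal.Quotient.mk_surjective).symm
    rw [h5]
    exact h4
  have h5 : (J.restrictScalars C).map π ≤ N'.map π := by
    refine Submodule.le_of_le_smul_of_le_jacobson_bot (I := maximalIdeal C) hfg
      (maximalIdeal_le_jacobson _) ?_
    have := Submodule.map_mono (f := π) h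
    rwa [Submodule.map_sup, Submodule.map_smul''] at this
  intro r hr
  obtain ⟨s, hs, hsr⟩ := h5 (Submodule.mem_map_of_mem hr)
  have : r - s ∈ Ideal.span {G} := Ideal.Quotient.eq.mp hsr.symm
  obtain ⟨a, ha⟩ := Ideal.mem_span_singleton.mp this
  have : r = s + G * a := by rw [← ha]; ring
  rw [this]
  exact N'.add_mem hs (hGN a)

open scoped Pointwise in
/-- A factor of a principal ideal generated by a regular element is finitely generated. -/
lemma fg_of_mul_eq_span_singleton {R : Type*} [CommRing R] {G : R} (hG : IsRegular G)
    {J J' : Ideal R} (h : J * J' = Ideal.span {G}) : J.FG := by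
  have hG1 : G ∈ J * J' := by rw [h]; exact Ideal.mem_span_singleton_self G
  obtain ⟨T, T', hT, hT', hmem⟩ := Submodule.mem_span_mul_finite_of_mem_mul hG1
  refine ⟨T, le_antisymm (Ideal.span_le.mpr hT) fun j hj => ?_⟩
  have key : ∀ y ∈ Ideal.span ((T : Set R) * (T' : Set R)), ∃ z ∈ Ideal.span (T : Set R), j * y = G * z := by
    intro y hy
    induction hy using Submodule.span_induction with
    | mem y hy =>
      obtain ⟨a, ha, b, hb, rfl⟩ := hy
      have : j * b ∈ Ideal.span {G} := by rw [← h]; exact Ideal.mul_mem_mul hj (hT' hb)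
      obtain ⟨c, hc⟩ := Ideal.mem_span_singleton.mp this
      refine ⟨c * a, Ideal.mul_mem_left _ _ (Ideal.subset_span ha), ?_⟩
      linear_combination a * hc
    | zero => exact ⟨0, zero_mem _, by simp⟩
    | add y y' _ _ h1 h2 =>
      obtain ⟨z, hz, e⟩ := h1
      obtain ⟨z', hz', e'⟩ := h2
      exact ⟨z + z', add_mem hz hz', by rw [mul_add, e, e', mul_add]⟩
    | smul a y _ h1 =>
      obtain ⟨z, hz, e⟩ := h1
      exact ⟨a * z, Ideal.mul_mem_left _ _ hz, by
        rw [smul_eq_mul]; linear_combination a * e⟩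
  obtain ⟨z, hz, e⟩ := key G hmem
  have : j = z := hG.left (by simpa [mul_comm] using e)
  exact this ▸ hz

/-- Over a local ring, an ideal of `C[X]` dividing a monic polynomial is generated by a
monic polynomial. -/
lemma exists_monic_span_eq_of_mul_eq {C : Type*} [CommRing C] [IsLocalRing C] {G : C[X]}
    (hG : G.Monic) {J J' : Ideal C[X]} (h : J * J' = Ideal.span {G}) :
    ∃ χ : C[X], χ.Monic ∧ J = Ideal.span {χ} := by
  have hGJ : G ∈ J := by
    have : G ∈ J * J' := by rw [h]; exact Ideal.mem_span_singleton_self G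
    exact Ideal.mul_le_left this
  have hGr : IsRegular G := hG.isRegular
  have hJfg : J.FG := fg_of_mul_eq_span_singleton hGr h
  let m := maximalIdeal C
  let κ := ResidueField C
  let ρ : C[X] →+* κ[X] := mapRingHom (residue C)
  have hρ : Function.Surjective ρ := map_surjective _ (residue_surjective)
  have hker : ∀ r : C[X], ρ r = 0 → r ∈ m • (⊤ : Submodule C C[X]) := by
    intro r hr
    rw [r.as_sum_range_C_mul_X_pow]
    refine Submodule.sum_mem _ fun i _ => ?_
    rw [← smul_eq_C_mul]
    refine Submodule.smul_mem_smul ?_ trivial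
    rw [← residue_eq_zero_iff, ← coeff_map]
    change (ρ r).coeff i = 0
    rw [hr, coeff_zero]
  -- elements of `J` vanishing modulo `m` lie in `m J`
  have hmJ : ∀ j ∈ J, ρ j = 0 → j ∈ m • J.restrictScalars C := by
    intro j hj hj0
    have hG1 : G ∈ J * J' := by rw [h]; exact Ideal.mem_span_singleton_self G
    have key : ∀ y ∈ J * J', ∃ z ∈ m • J.restrictScalars C, j * y = G * z := by
      intro y hy
      induction hy using Submodule.mul_induction_on' with
      | mem_mul_mem a ha b hb =>
        have : j * b ∈ Ideal.span {G} := by rw [← h]; exact Ideal.mul_mem_mul hj hb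
        obtain ⟨c, hc⟩ := Ideal.mem_span_singleton.mp this
        have hc0 : ρ c = 0 := by
          have := congrArg ρ hc
          rw [map_mul, map_mul, hj0, zero_mul] at this
          exact (mul_eq_zero.mp this.symm).resolve_left (hG.map (residue C)).ne_zero
        refine ⟨c * a, ?_, by linear_combination a * hc⟩
        have hcm := hker c hc0
        clear hc hc0
        induction hcm using Submodule.smul_induction_on' with
        | smul r hr n _ =>
          rw [smul_mul_assoc]
          exact Submodule.smul_mem_smul hr (J.mul_mem_left _ ha)
        | add x _ y _ h1 h2 => rw [add_mul]; exact add_mem h1 h2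
      | add a _ b _ h1 h2 =>
        obtain ⟨z, hz, e⟩ := h1
        obtain ⟨z', hz', e'⟩ := h2
        exact ⟨z + z', add_mem hz hz', by rw [mul_add, e, e', mul_add]⟩
    obtain ⟨z, hz, e⟩ := key G hG1
    have : j = z := hG.isRegular.left (by simpa [mul_comm] using e)
    exact this ▸ hz
  -- the reduction of `J`
  let Jb : Ideal κ[X] := J.map ρ
  have hJb0 : Jb ≠ ⊥ := by
    intro h0
    have : ρ G ∈ Jb := Ideal.mem_map_of_mem _ hGJ
    rw [h0] at this
    exact (hG.map (residue C)).ne_zero this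
  obtain ⟨f, hfm, hf⟩ : ∃ f : κ[X], f.Monic ∧ Jb = Ideal.span {f} := by
    obtain ⟨f, hf⟩ := (IsPrincipalIdealRing.principal Jb).principal
    have hf0 : f ≠ 0 := by
      rintro rfl
      exact hJb0 (by rw [hf]; simp)
    refine ⟨f * Polynomial.C f.leadingCoeff⁻¹, monic_mul_leadingCoeff_inv hf0, ?_⟩
    rw [hf, Ideal.submodule_span_eq]
    refine (Ideal.span_singleton_mul_right_unit ?_ f).symm
    exact isUnit_C.mpr (IsUnit.mk0 _ (inv_ne_zero (leadingCoeff_ne_zero.mpr hf0)))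
  let d := f.natDegree
  have hmemJb : ∀ r : κ[X], r ∈ Jb → ∃ j ∈ J, ρ j = r := by
    intro r hr
    exact (Ideal.mem_map_iff_of_surjective _ hρ).mp hr
  -- a monic polynomial of degree `d` in `J`
  have htop : (⊤ : Submodule C C[X]) ≤ J.restrictScalars C ⊔ degreeLT C d := by
    have := le_of_le_sup_maximalIdeal_smul_of_monic hG ⊤ ⟨{1}, by simp⟩
      (J.restrictScalars C ⊔ degreeLT C d)
      (fun a => Submodule.mem_sup_left (J.mul_mem_right _ hGJ)) ?_
    · simpa using this
    intro r _
    have hdiv : ρ r %ₘ f + f * (ρ r /ₘ f) = ρ r := modByMonic_add_div _ f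
    obtain ⟨j, hj, hjr⟩ := hmemJb (f * (ρ r /ₘ f)) (by
      rw [hf]; exact Ideal.mul_mem_right _ _ (Ideal.mem_span_singleton_self f))
    have hdeg : (ρ r %ₘ f) ∈ degreeLT κ d := by
      rw [mem_degreeLT]
      exact (degree_modByMonic_lt _ hfm).trans_eq (degree_eq_natDegree hfm.ne_zero)
    obtain ⟨s, hs, hsr⟩ : ∃ s ∈ degreeLT C d, ρ s = ρ r %ₘ f := by
      have hl : ρ r %ₘ f ∈ lifts (residue C) := by
        obtain ⟨s, hs⟩ := hρ (ρ r %ₘ f)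
        exact ⟨s, hs⟩
      obtain ⟨s, hs, hsd⟩ := exists_degree_eq_of_mem_lifts hl
      exact ⟨s, by rw [mem_degreeLT, hsd]; exact mem_degreeLT.mp hdeg, hs⟩
    have hr0 : ρ (r - (j + s)) = 0 := by
      rw [map_sub, map_add, hjr, hsr, sub_eq_zero, add_comm, hdiv]
    have : r = (j + s) + (r - (j + s)) := by ring
    rw [this]
    refine Submodule.add_mem_sup (Submodule.add_mem_sup hj hs) ?_
    simpa using hker _ hr0
  obtain ⟨χ, hχJ, hχm, hχd⟩ : ∃ χ ∈ J, χ.Monic ∧ χ.natDegree = d := by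
    obtain ⟨j, hj, s, hs, hjs⟩ := Submodule.mem_sup.mp (htop (x := (X ^ d : C[X])) trivial)
    have hj' : j = X ^ d + (-s) := by rw [← hjs]; ring
    have hs' : (-s).degree < d := by rw [degree_neg]; exact mem_degreeLT.mp hs
    exact ⟨j, hj, hj' ▸ monic_X_pow_add hs', by
      refine natDegree_eq_of_degree_eq_some ?_
      rw [hj', degree_add_eq_left_of_degree_lt (by rwa [degree_X_pow]), degree_X_pow]⟩
  refine ⟨χ, hχm, le_antisymm ?_ ((Ideal.span_singleton_le_iff_mem _).mpr hχJ)⟩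
  refine le_of_le_sup_maximalIdeal_smul_of_monic hχm J hJfg
    ((Ideal.span {χ}).restrictScalars C)
    (fun a => Ideal.mul_mem_right _ _ (Ideal.mem_span_singleton_self χ)) ?_
  intro j hj
  have hdiv : j %ₘ χ + χ * (j /ₘ χ) = j := modByMonic_add_div _ χ
  rw [← hdiv, add_comm]
  refine Submodule.add_mem_sup (Ideal.mul_mem_right _ _ (Ideal.mem_span_singleton_self χ))
    (hmJ _ ?_ ?_)
  · have : j %ₘ χ = j - χ * (j /ₘ χ) := by rw [eq_sub_iff_add_eq, hdiv]
    rw [this]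
    exact J.sub_mem hj (J.mul_mem_right _ hχJ)
  · have h1 : ρ (j %ₘ χ) ∈ Jb := by
      refine Ideal.mem_map_of_mem _ ?_
      have : j %ₘ χ = j - χ * (j /ₘ χ) := by rw [eq_sub_iff_add_eq, hdiv]
      rw [this]
      exact J.sub_mem hj (J.mul_mem_right _ hχJ)
    rw [hf, Ideal.mem_span_singleton] at h1
    by_contra hne
    refine hfm.not_dvd_of_degree_lt hne ?_ h1
    calc (ρ (j %ₘ χ)).degree ≤ (j %ₘ χ).degree := degree_map_le
      _ < χ.degree := degree_modByMonic_lt _ hχm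
      _ = f.degree := by rw [degree_eq_natDegree hχm.ne_zero, hχd, degree_eq_natDegree hfm.ne_zero]

end LocalMonicGenerator

section GlobalMonicGenerator

open Polynomial

attribute [local instance] Polynomial.algebra Polynomial.isLocalization

/-- The localization of `J` at the prime `τ` of the coefficient ring is generated by a monic
polynomial of degree `d`. -/
def Polynomial.HasMonicGeneratorAt {C : Type*} [CommRing C] (J : Ideal C[X]) (τ : Ideal C)
    [τ.IsPrime] (d : ℕ) : Prop :=
  ∃ χ : (Localization.AtPrime τ)[X], χ.Monic ∧ χ.natDegree = d ∧
    J.map (mapRingHom (algebraMap C (Localization.AtPrime τ))) = Ideal.span {χ}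

namespace Polynomial.HasMonicGeneratorAt

variable {C : Type*} [CommRing C] {J : Ideal C[X]} {τ : Ideal C} [τ.IsPrime] {d : ℕ}

lemma of_le {s : Ideal C} [s.IsPrime] (hs : s ≤ τ) (h : HasMonicGeneratorAt J τ d) :
    HasMonicGeneratorAt J s d := by
  obtain ⟨χ, hm, hd, hJ⟩ := h
  let φ : Localization.AtPrime τ →+* Localization.AtPrime s :=
    IsLocalization.lift (M := τ.primeCompl) (g := algebraMap C (Localization.AtPrime s))
      fun y => IsLocalization.map_units (M := s.primeCompl) _ ⟨y.1, fun h => y.2 (hs h)⟩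
  have hφ : φ.comp (algebraMap C (Localization.AtPrime τ)) =
      algebraMap C (Localization.AtPrime s) := IsLocalization.lift_comp _
  refine ⟨χ.map φ, hm.map φ, by rw [hm.natDegree_map, hd], ?_⟩
  rw [← hφ, ← mapRingHom_comp, ← Ideal.map_map, hJ, Ideal.map_span, Set.image_singleton]
  rfl

lemma unique {d' : ℕ} (h : HasMonicGeneratorAt J τ d) (h' : HasMonicGeneratorAt J τ d') :
    d = d' := by
  obtain ⟨χ, hm, hd, hJ⟩ := h
  obtain ⟨χ', hm', hd', hJ'⟩ := h'
  have e : Ideal.span {χ} = Ideal.span {χ'} := hJ.symm.trans hJ'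
  have h1 : χ ∣ χ' := Ideal.span_singleton_le_span_singleton.mp e.ge
  have h2 : χ' ∣ χ := Ideal.span_singleton_le_span_singleton.mp e.le
  by_contra hne
  rcases lt_or_gt_of_ne hne with hlt | hlt
  · exact hm'.not_dvd_of_natDegree_lt hm.ne_zero (by omega) h2
  · exact hm.not_dvd_of_natDegree_lt hm'.ne_zero (by omega) h1

lemma exists_mem_coeff_notMem (h : HasMonicGeneratorAt J τ d) :
    ∃ r ∈ J, r.natDegree ≤ d ∧ r.coeff d ∉ τ := by
  obtain ⟨χ, hm, hd, hJ⟩ := h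
  have hχ : χ ∈ J.map (algebraMap C[X] (Localization.AtPrime τ)[X]) :=
    hJ.ge (Ideal.mem_span_singleton_self χ)
  obtain ⟨⟨⟨r, hr⟩, ⟨_, s, hs, rfl⟩⟩, e⟩ := (IsLocalization.mem_map_algebraMap_iff
    (τ.primeCompl.map (Polynomial.C : C →+* C[X])) (Localization.AtPrime τ)[X]).mp hχ
  have e : r.map (algebraMap C (Localization.AtPrime τ)) =
      χ * Polynomial.C (algebraMap C (Localization.AtPrime τ) s) := by
    have := e.symm
    simpa [Polynomial.algebraMap_def] using this
  let r' : C[X] := ∑ i ∈ Finset.range (d + 1), Polynomial.C (r.coeff i) * X ^ i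
  have hr' : r.map (algebraMap C (Localization.AtPrime τ)) =
      r'.map (algebraMap C (Localization.AtPrime τ)) := by
    ext n
    simp only [r', coeff_map, finsetSum_coeff, coeff_C_mul, coeff_X_pow]
    by_cases hn : n < d + 1
    · simp [hn]
    · simp only [mul_ite, mul_one, mul_zero, Finset.sum_ite_eq, Finset.mem_range, hn, if_false,
        map_zero]
      rw [← coeff_map, e, coeff_mul_C, coeff_eq_zero_of_natDegree_lt (by omega), zero_mul]
  have hr'd : r'.natDegree ≤ d := by
    refine natDegree_sum_le_of_forall_le _ _ fun i hi => (natDegree_C_mul_X_pow_le _ _).trans ?_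
    have := Finset.mem_range.mp hi
    omega
  obtain ⟨⟨_, t, ht, rfl⟩, e'⟩ := (IsLocalization.eq_iff_exists
    (τ.primeCompl.map (Polynomial.C : C →+* C[X])) (Localization.AtPrime τ)[X]).mp hr'
  refine ⟨Polynomial.C t * r, J.mul_mem_left _ hr, ?_, ?_⟩
  · have e'' : Polynomial.C t * r = Polynomial.C t * r' := e'
    rw [e'']
    exact (natDegree_C_mul_le _ _).trans hr'd
  · rw [coeff_C_mul]
    have : r.coeff d ∉ τ := by
      intro hmem
      have h1 : algebraMap C (Localization.AtPrime τ) (r.coeff d) =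
          algebraMap C (Localization.AtPrime τ) s := by
        rw [← coeff_map, e, coeff_mul_C, ← hd, hm.coeff_natDegree, one_mul]
      have h2 : IsUnit (algebraMap C (Localization.AtPrime τ) (r.coeff d)) := by
        rw [h1]; exact IsLocalization.map_units (M := τ.primeCompl) _ ⟨s, hs⟩
      exact (IsLocalization.AtPrime.isUnit_to_map_iff _ τ _).mp h2 hmem
    exact (τ.primeCompl).mul_mem ht this

lemma exists_mul_coeff_eq_zero (h : HasMonicGeneratorAt J τ d) {r : C[X]} (hr : r ∈ J)
    (hrd : r.degree < d) (n : ℕ) : ∃ s ∉ τ, s * r.coeff n = 0 := by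
  obtain ⟨χ, hm, hd, hJ⟩ := h
  have h0 : r.map (algebraMap C (Localization.AtPrime τ)) = 0 := by
    by_contra hne
    have h1 : r.map (algebraMap C (Localization.AtPrime τ)) ∈ Ideal.span {χ} :=
      hJ.le (Ideal.mem_map_of_mem _ hr)
    refine hm.not_dvd_of_degree_lt hne ?_ (Ideal.mem_span_singleton.mp h1)
    rw [degree_eq_natDegree hm.ne_zero, hd]
    exact degree_map_le.trans_lt hrd
  have h1 : algebraMap C (Localization.AtPrime τ) (r.coeff n) = 0 := by
    rw [← coeff_map, h0, coeff_zero]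
  obtain ⟨⟨s, hs⟩, e⟩ := (IsLocalization.map_eq_zero_iff τ.primeCompl _ _).mp h1
  exact ⟨s, hs, e⟩

end Polynomial.HasMonicGeneratorAt

lemma Polynomial.hasMonicGeneratorAt_of_notMem {C : Type*} [CommRing C] {G : C[X]} (hG : G.Monic)
    {J J' : Ideal C[X]} (hJ : J * J' ≤ Ideal.span {G}) {g : C} {p : ℕ}
    (hg : Polynomial.C g ^ p * G ∈ J * J') (τ : Ideal C) [τ.IsPrime] (hτ : g ∉ τ) :
    ∃ d, HasMonicGeneratorAt J τ d := by
  let ψ := mapRingHom (algebraMap C (Localization.AtPrime τ))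
  have h : J.map ψ * J'.map ψ = Ideal.span {ψ G} := by
    rw [← Ideal.map_mul]
    refine le_antisymm ?_ ?_
    · refine (Ideal.map_mono hJ).trans ?_
      rw [Ideal.map_span, Set.image_singleton]
    · rw [Ideal.span_singleton_le_iff_mem]
      have h1 := Ideal.mem_map_of_mem ψ hg
      rw [map_mul] at h1
      refine (Ideal.unit_mul_mem_iff_mem _ ?_).mp h1
      rw [map_pow]
      refine IsUnit.pow _ ?_
      simp only [ψ, coe_mapRingHom, map_C]
      exact isUnit_C.mpr ((IsLocalization.AtPrime.isUnit_to_map_iff _ τ _).mpr hτ)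
  obtain ⟨χ, hm, hχ⟩ := exists_monic_span_eq_of_mul_eq (hG.map _) h
  exact ⟨_, χ, hm, rfl, hχ⟩

/-- An element of a ring lies in the radical of an ideal if the ideal is contained in no
prime avoiding the element. -/
lemma mem_radical_of_forall_not_le {C : Type*} [CommRing C] {K : Ideal C} {g : C}
    (h : ∀ τ : Ideal C, τ.IsPrime → g ∉ τ → ¬ K ≤ τ) : g ∈ K.radical := by
  rw [Ideal.radical_eq_sInf, Ideal.mem_sInf]
  rintro τ ⟨hK, hτ⟩
  by_contra hg
  exact h τ hτ hg hK

/-- An ideal `J` of `C[X]` that divides a monic polynomial away from the vanishing locus of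
`(g₁, g₂)` and is saturated with respect to this regular pair is generated by a monic polynomial,
if the complement of the vanishing locus is connected in a strong sense. -/
lemma exists_monic_span_eq_of_regular_pair {C : Type*} [CommRing C] {G : C[X]} (hG : G.Monic)
    {J J' : Ideal C[X]} (hJ : J * J' ≤ Ideal.span {G}) {g₁ g₂ : C}
    (hg₁ : IsRegular g₁) (hg : ∀ m c₁ c₂, g₂ ^ m * c₁ = g₁ ^ m * c₂ → g₁ ^ m ∣ c₁) {p : ℕ}
    (h₁ : Polynomial.C g₁ ^ p * G ∈ J * J') (h₂ : Polynomial.C g₂ ^ p * G ∈ J * J')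
    (hsat : ∀ m r, Polynomial.C g₁ ^ m * r ∈ J → Polynomial.C g₂ ^ m * r ∈ J → r ∈ J)
    (ξ : Ideal C) [ξ.IsPrime] (hξ : g₁ ∉ ξ)
    (hconn : ∀ τ : Ideal C, τ.IsPrime → g₁ ∉ τ ∨ g₂ ∉ τ →
      ∃ s : Ideal C, s.IsPrime ∧ s ≤ τ ∧ s ≤ ξ ∧ g₁ ∉ s) :
    ∃ χ : C[X], χ.Monic ∧ J = Ideal.span {χ} := by
  obtain ⟨d, hd⟩ := hasMonicGeneratorAt_of_notMem hG hJ h₁ ξ hξ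
  have hall : ∀ (τ : Ideal C) [τ.IsPrime], g₁ ∉ τ ∨ g₂ ∉ τ → HasMonicGeneratorAt J τ d := by
    intro τ _ hτ
    obtain ⟨d', hd'⟩ : ∃ d, HasMonicGeneratorAt J τ d := by
      rcases hτ with hτ | hτ
      · exact hasMonicGeneratorAt_of_notMem hG hJ h₁ τ hτ
      · exact hasMonicGeneratorAt_of_notMem hG hJ h₂ τ hτ
    obtain ⟨s, _, hsτ, hsξ, -⟩ := hconn τ inferInstance hτ
    rwa [(hd.of_le hsξ).unique (hd'.of_le hsτ)]
  -- elements of `J` of small degree vanish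
  have hvan : ∀ r ∈ J, r.degree < d → r = 0 := by
    intro r hr hrd
    ext n
    have : g₁ ∈ (Ideal.span {r.coeff n} : Ideal C).annihilator.radical := by
      refine mem_radical_of_forall_not_le fun τ _ hτ hle => ?_
      obtain ⟨s, hs, e⟩ := (hall τ (Or.inl hτ)).exists_mul_coeff_eq_zero hr hrd n
      refine hs (hle ?_)
      rw [Submodule.mem_annihilator_span_singleton]
      exact e
    obtain ⟨m, hm⟩ := this
    rw [Submodule.mem_annihilator_span_singleton] at hm
    exact (hg₁.pow m).left (by simpa using hm)
  -- leading coefficients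
  let K : Ideal C :=
    { carrier := {c | ∃ r ∈ J, r.natDegree ≤ d ∧ r.coeff d = c}
      add_mem' := by
        rintro _ _ ⟨r, hr, hrd, rfl⟩ ⟨r', hr', hrd', rfl⟩
        exact ⟨r + r', J.add_mem hr hr', natDegree_add_le_of_degree_le hrd hrd', coeff_add _ _ _⟩
      zero_mem' := ⟨0, J.zero_mem, by simp, by simp⟩
      smul_mem' := by
        rintro c _ ⟨r, hr, hrd, rfl⟩
        exact ⟨Polynomial.C c * r, J.mul_mem_left _ hr, (natDegree_C_mul_le _ _).trans hrd,
          coeff_C_mul _⟩ }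
  have hK : ∀ g : C, (∀ (τ : Ideal C) [τ.IsPrime], g ∉ τ → HasMonicGeneratorAt J τ d) →
      g ∈ K.radical := by
    intro g hgτ
    refine mem_radical_of_forall_not_le fun τ _ hτ hle => ?_
    obtain ⟨r, hr, hrd, hrτ⟩ := (hgτ τ hτ).exists_mem_coeff_notMem
    exact hrτ (hle ⟨r, hr, hrd, rfl⟩)
  obtain ⟨m₁, hm₁⟩ := hK g₁ fun τ _ h => hall τ (Or.inl h)
  obtain ⟨m₂, hm₂⟩ := hK g₂ fun τ _ h => hall τ (Or.inr h)
  obtain ⟨r₁, hr₁, hrd₁, e₁⟩ : g₁ ^ (m₁ + m₂) ∈ K := by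
    rw [pow_add]; exact K.mul_mem_right _ hm₁
  obtain ⟨r₂, hr₂, hrd₂, e₂⟩ : g₂ ^ (m₁ + m₂) ∈ K := by
    rw [pow_add]; exact K.mul_mem_left _ hm₂
  set m := m₁ + m₂
  have hrel : Polynomial.C g₂ ^ m * r₁ = Polynomial.C g₁ ^ m * r₂ := by
    rw [← sub_eq_zero]
    refine hvan _ (J.sub_mem (J.mul_mem_left _ hr₁) (J.mul_mem_left _ hr₂)) ?_
    rw [degree_lt_iff_coeff_zero]
    intro n hn
    rw [← map_pow, ← map_pow, coeff_sub, coeff_C_mul, coeff_C_mul]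
    rcases hn.eq_or_lt with rfl | hn
    · rw [e₁, e₂]; ring
    · rw [coeff_eq_zero_of_natDegree_lt (hrd₁.trans_lt hn),
        coeff_eq_zero_of_natDegree_lt (hrd₂.trans_lt hn)]
      ring
  obtain ⟨χ, hχ⟩ : Polynomial.C (g₁ ^ m) ∣ r₁ := by
    rw [C_dvd_iff_dvd_coeff]
    intro n
    refine hg m _ (r₂.coeff n) ?_
    have := congrArg (fun r => coeff r n) hrel
    simpa only [← map_pow, coeff_C_mul] using this
  have hreg : IsRegular (Polynomial.C (g₁ ^ m)) := by
    refine (Commute.isRegular_iff (Commute.all _)).mpr fun a b hab => ?_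
    ext n
    have := congrArg (fun r => coeff r n) hab
    simp only [coeff_C_mul] at this
    exact (hg₁.pow m).left this
  have hχ₂ : Polynomial.C g₂ ^ m * χ = r₂ := by
    refine hreg.left ?_
    change Polynomial.C (g₁ ^ m) * _ = Polynomial.C (g₁ ^ m) * _
    rw [map_pow, ← hrel, hχ, map_pow]
    ring
  have hχJ : χ ∈ J := by
    refine hsat m χ ?_ (hχ₂ ▸ hr₂)
    rw [← map_pow, ← hχ]
    exact hr₁
  have hχc : ∀ n, r₁.coeff n = g₁ ^ m * χ.coeff n := fun n => by rw [hχ, coeff_C_mul]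
  have hχd : χ.natDegree ≤ d := by
    rw [natDegree_le_iff_coeff_eq_zero]
    intro n hn
    refine (hg₁.pow m).left ?_
    change g₁ ^ m * _ = g₁ ^ m * _
    rw [← hχc, coeff_eq_zero_of_natDegree_lt (hrd₁.trans_lt hn), mul_zero]
  have hχ1 : χ.coeff d = 1 := by
    refine (hg₁.pow m).left ?_
    change g₁ ^ m * _ = g₁ ^ m * _
    rw [← hχc, e₁, mul_one]
  have hχm : χ.Monic := monic_of_natDegree_le_of_coeff_eq_one d hχd hχ1
  refine ⟨χ, hχm, le_antisymm ?_ ((Ideal.span_singleton_le_iff_mem _).mpr hχJ)⟩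
  intro j hj
  have hdiv : j %ₘ χ + χ * (j /ₘ χ) = j := modByMonic_add_div _ χ
  have h0 : j %ₘ χ = 0 := by
    have : Nontrivial C := nontrivial_of_ne _ _ (ne_of_mem_of_not_mem ξ.zero_mem hξ)
    refine hvan _ ?_ ((degree_modByMonic_lt _ hχm).trans_le ?_)
    · rw [← hdiv] at hj
      exact (J.add_mem_iff_left (J.mul_mem_right _ hχJ)).mp hj
    · exact degree_le_of_natDegree_le hχd
  rw [← hdiv, h0, zero_add]
  exact Ideal.mul_mem_right _ _ (Ideal.mem_span_singleton_self χ)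

end GlobalMonicGenerator

section RegularPair

/-- An ideal of height at least two in a Noetherian factorial domain contains two nonzero
coprime elements. -/
lemma exists_isRelPrime_of_two_le_height {R : Type*} [CommRing R] [IsDomain R]
    [UniqueFactorizationMonoid R] [IsNoetherianRing R] {I : Ideal R}
    (hI : ∀ P : Ideal R, P.IsPrime → I ≤ P → 2 ≤ P.height) :
    ∃ g₁ ∈ I, ∃ g₂ ∈ I, g₁ ≠ 0 ∧ IsRelPrime g₁ g₂ := by
  classical
  have hI0 : I ≠ ⊥ := by
    intro h
    have := hI ⊥ Ideal.isPrime_bot h.le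
    simp at this
  obtain ⟨g₁, hg₁, hg₁0⟩ := I.ne_bot_iff.mp hI0
  let s := (UniqueFactorizationMonoid.factors g₁).toFinset
  have hs : ∀ π ∈ s, Prime π := fun π hπ =>
    UniqueFactorizationMonoid.prime_of_factor π (Multiset.mem_toFinset.mp hπ)
  have hsp : ∀ π ∈ s, (Ideal.span {π}).IsPrime := fun π hπ =>
    (Ideal.span_singleton_prime (hs π hπ).ne_zero).mpr (hs π hπ)
  have : ¬ (I : Set R) ⊆ ⋃ π ∈ (s : Set R), (Ideal.span {π} : Ideal R) := by
    intro hsub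
    obtain ⟨π, hπ, hle⟩ := (Ideal.subset_union_prime (0 : R) 0 fun π hπ _ _ => hsp π hπ).mp hsub
    have h1 := hI _ (hsp π hπ) hle
    have h2 := Ideal.height_span_singleton_le_one (R := R) (hs π hπ).not_isUnit
    exact absurd (h1.trans h2) (by decide)
  obtain ⟨g₂, hg₂, hg₂s⟩ := Set.not_subset.mp this
  refine ⟨g₁, hg₁, g₂, hg₂, hg₁0, fun d hd₁ hd₂ => ?_⟩
  by_contra hd
  have hd0 : d ≠ 0 := by rintro rfl; exact hg₁0 (zero_dvd_iff.mp hd₁)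
  obtain ⟨π, hπ, hπd⟩ := WfDvdMonoid.exists_irreducible_factor hd hd0
  obtain ⟨π', hπ', hass⟩ := UniqueFactorizationMonoid.exists_mem_factors_of_dvd hg₁0 hπ
    (hπd.trans hd₁)
  refine hg₂s (Set.mem_biUnion (Multiset.mem_toFinset.mpr hπ') ?_)
  exact Ideal.mem_span_singleton.mpr (hass.symm.dvd.trans (hπd.trans hd₂))

/-- Base change of a weakly regular pair to a flat algebra. -/
lemma dvd_of_mul_eq_mul_of_flat {R B : Type*} [CommRing R] [CommRing B] [Algebra R B]
    [Module.Flat R B] {a b : R} (h : ∀ c₁ c₂, b * c₁ = a * c₂ → a ∣ c₁) {c₁ c₂ : B}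
    (hc : algebraMap R B b * c₁ = algebraMap R B a * c₂) : algebraMap R B a ∣ c₁ := by
  have h0 : ∑ i, (![b, -a] : Fin 2 → R) i • (![c₁, c₂] : Fin 2 → B) i = 0 := by
    simp only [Fin.sum_univ_two, Matrix.cons_val_zero, Matrix.cons_val_one, Algebra.smul_def,
      map_neg, hc]
    ring
  obtain ⟨l, x, y, hxy, hx⟩ := Module.Flat.isTrivialRelation_of_sum_smul_eq_zero
    (R := R) (M := B) h0
  have h1 := hxy 0
  simp only [Matrix.cons_val_zero] at h1
  rw [h1]
  refine Finset.dvd_sum fun j _ => ?_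
  have h2 := hx j
  simp only [Fin.sum_univ_two, Matrix.cons_val_zero, Matrix.cons_val_one] at h2
  obtain ⟨z, hz⟩ := h (x 0 j) (x 1 j) (by linear_combination h2)
  rw [hz, Algebra.smul_def, map_mul, mul_assoc]
  exact dvd_mul_right _ _

lemma dvd_of_pow_mul_eq_pow_mul_of_isRelPrime {R B : Type*} [CommRing R] [IsDomain R]
    [UniqueFactorizationMonoid R] [CommRing B] [Algebra R B] [Module.Flat R B] {g₁ g₂ : R}
    (h : IsRelPrime g₁ g₂) (m : ℕ) (c₁ c₂ : B)
    (hc : algebraMap R B g₂ ^ m * c₁ = algebraMap R B g₁ ^ m * c₂) :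
    algebraMap R B g₁ ^ m ∣ c₁ := by
  rw [← map_pow, ← map_pow] at hc
  rw [← map_pow]
  refine dvd_of_mul_eq_mul_of_flat (fun d₁ d₂ hd => ?_) hc
  exact (h.pow (m := m) (n := m)).dvd_of_dvd_mul_left ⟨d₂, hd⟩

lemma isRegular_algebraMap_of_flat {R B : Type*} [CommRing R] [IsDomain R] [CommRing B]
    [Algebra R B] [Module.Flat R B] {g : R} (hg : g ≠ 0) : IsRegular (algebraMap R B g) := by
  refine (Commute.isRegular_iff (Commute.all _)).mpr fun a b hab => ?_
  refine Module.Flat.isSMulRegular_of_isRegular (R := R) (M := B) (IsRegular.of_ne_zero hg) ?_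
  simpa [Algebra.smul_def] using hab

attribute [local instance] MvPolynomial.algebraMvPolynomial

instance MvPolynomial.flat_mvPolynomial {k A σ : Type*} [CommRing k] [CommRing A] [Algebra k A]
    [Module.Flat k A] : Module.Flat (MvPolynomial σ k) (MvPolynomial σ A) :=
  Module.Flat.isBaseChange k (MvPolynomial σ k) A (MvPolynomial σ A)
    (Algebra.IsPushout.out (R := k) (S := MvPolynomial σ k) (R' := A) (S' := MvPolynomial σ A))

end RegularPair

section GenericLine

open Polynomial

attribute [local instance] MvPolynomial.algebraMvPolynomial

variable {σ A B : Type*} [CommRing A] [CommRing B]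

/-- The endomorphism `X j ↦ X j + v j * t` of the polynomial ring `B[X j][t]`. -/
def shiftHom (v : σ → B) : (MvPolynomial σ B)[X] →+* (MvPolynomial σ B)[X] :=
  Polynomial.eval₂RingHom (MvPolynomial.eval₂Hom (Polynomial.C.comp MvPolynomial.C)
    fun j => Polynomial.C (MvPolynomial.X j) + Polynomial.C (MvPolynomial.C (v j)) * Polynomial.X)
    Polynomial.X

lemma shiftHom_comp_shiftHom_neg (v : σ → B) :
    (shiftHom v).comp (shiftHom (-v)) = RingHom.id _ := by
  refine Polynomial.ringHom_ext' (MvPolynomial.ringHom_ext ?_ ?_) ?_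
  · intro b; simp [shiftHom]
  · intro j; simp [shiftHom]; ring
  · simp [shiftHom]

lemma shiftHom_bijective (v : σ → B) : Function.Bijective (shiftHom v) := by
  constructor
  · have h := shiftHom_comp_shiftHom_neg (-v)
    rw [neg_neg] at h
    exact Function.LeftInverse.injective (g := shiftHom (-v)) fun x => RingHom.congr_fun h x
  · exact Function.RightInverse.surjective (g := shiftHom (-v)) fun x =>
      RingHom.congr_fun (shiftHom_comp_shiftHom_neg v) x

/-- The homomorphism `A[y] → B[z][t]`, `y j ↦ z j + v j * t`, parametrizing the lines with
direction `v`. -/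
def lineHom (f : A →+* B) (v : σ → B) : MvPolynomial σ A →+* (MvPolynomial σ B)[X] :=
  (shiftHom v).comp (Polynomial.C.comp (MvPolynomial.map f))

lemma lineHom_C (f : A →+* B) (v : σ → B) (a : A) :
    lineHom f v (MvPolynomial.C a) = Polynomial.C (MvPolynomial.C (f a)) := by
  simp [lineHom, shiftHom]

lemma lineHom_X (f : A →+* B) (v : σ → B) (j : σ) :
    lineHom f v (MvPolynomial.X j) =
      Polynomial.C (MvPolynomial.X j) + Polynomial.C (MvPolynomial.C (v j)) * Polynomial.X := by
  simp [lineHom, shiftHom]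

lemma lineHom_flat {f : A →+* B} (hf : f.Flat) (v : σ → B) : (lineHom f v).Flat := by
  refine RingHom.Flat.comp (RingHom.Flat.comp ?_ ?_) (RingHom.Flat.of_bijective
    (shiftHom_bijective v))
  · algebraize [f]
    exact inferInstanceAs (Module.Flat (MvPolynomial σ A) (MvPolynomial σ B))
  · exact RingHom.flat_algebraMap_iff.mpr
      (inferInstance : Module.Flat (MvPolynomial σ B) (MvPolynomial σ B)[X])

lemma lineHom_monomial (f : A →+* B) (v : σ → B) (ν : σ →₀ ℕ) (a : A) :
    (lineHom f v (MvPolynomial.monomial ν a)).natDegree ≤ ν.degree ∧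
      (lineHom f v (MvPolynomial.monomial ν a)).coeff ν.degree =
        MvPolynomial.C (MvPolynomial.eval₂ f v (MvPolynomial.monomial ν a)) := by
  have key : ∀ s : Finset σ,
      (∏ j ∈ s, (lineHom f v (MvPolynomial.X j)) ^ ν j).natDegree ≤ ∑ j ∈ s, ν j ∧
      (∏ j ∈ s, (lineHom f v (MvPolynomial.X j)) ^ ν j).coeff (∑ j ∈ s, ν j) =
        MvPolynomial.C (∏ j ∈ s, v j ^ ν j) := by
    intro s
    classical
    induction s using Finset.induction_on with
    | empty => simp
    | insert j s hj ih =>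
      have h1 : (lineHom f v (MvPolynomial.X j)).natDegree ≤ 1 := by
        rw [lineHom_X]; compute_degree
      have h1' : (lineHom f v (MvPolynomial.X j)).coeff 1 = MvPolynomial.C (v j) := by
        rw [lineHom_X]; simp [coeff_C]
      have h2 : (lineHom f v (MvPolynomial.X j) ^ ν j).natDegree ≤ ν j := by
        simpa using natDegree_pow_le_of_le (ν j) h1
      have h3 : (lineHom f v (MvPolynomial.X j) ^ ν j).coeff (ν j) = MvPolynomial.C (v j) ^ ν j := by
        have := coeff_pow_of_natDegree_le (n := 1) (m := ν j) h1
        rwa [mul_one, h1'] at this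
      rw [Finset.prod_insert hj, Finset.sum_insert hj, Finset.prod_insert hj]
      refine ⟨natDegree_mul_le_of_le h2 ih.1, ?_⟩
      rw [coeff_mul_add_eq_of_natDegree_le h2 ih.1, h3, ih.2, map_mul, map_pow]
  have e : lineHom f v (MvPolynomial.monomial ν a) = Polynomial.C (MvPolynomial.C (f a)) *
      ∏ j ∈ ν.support, (lineHom f v (MvPolynomial.X j)) ^ ν j := by
    rw [MvPolynomial.monomial_eq, map_mul, lineHom_C, Finsupp.prod, map_prod]
    simp only [map_pow]
  rw [e]
  refine ⟨(natDegree_C_mul_le _ _).trans (key _).1, ?_⟩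
  rw [coeff_C_mul, Finsupp.degree_apply, (key _).2, MvPolynomial.eval₂_monomial, map_mul, Finsupp.prod]

lemma lineHom_coeff (f : A →+* B) (v : σ → B) {G : MvPolynomial σ A} {e : ℕ}
    (hG : G.totalDegree ≤ e) :
    (lineHom f v G).natDegree ≤ e ∧ (lineHom f v G).coeff e =
      MvPolynomial.C (MvPolynomial.eval₂ f v (MvPolynomial.homogeneousComponent e G)) := by
  classical
  have hdeg : ∀ ν ∈ G.support, ν.degree ≤ e := fun ν hν =>
    (MvPolynomial.le_totalDegree hν).trans hG
  have eG : lineHom f v G = ∑ ν ∈ G.support, lineHom f v (MvPolynomial.monomial ν (G.coeff ν)) := by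
    conv_lhs => rw [G.as_sum, map_sum]
  rw [eG]
  refine ⟨natDegree_sum_le_of_forall_le _ _ fun ν hν =>
    (lineHom_monomial f v ν _).1.trans (hdeg ν hν), ?_⟩
  rw [finsetSum_coeff, MvPolynomial.homogeneousComponent_apply, MvPolynomial.eval₂_sum, map_sum,
    Finset.sum_filter]
  refine Finset.sum_congr rfl fun ν hν => ?_
  split_ifs with h
  · rw [← h, (lineHom_monomial f v ν _).2]
  · exact coeff_eq_zero_of_natDegree_lt ((lineHom_monomial f v ν _).1.trans_lt
      (lt_of_le_of_ne (hdeg ν hν) h))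

/-- The image of `G` under `lineHom` is a unit times a monic polynomial if the value of the leading
form of `G` at the direction `v` is a unit. -/
lemma exists_monic_lineHom [Nontrivial B] (f : A →+* B) (v : σ → B) {G : MvPolynomial σ A} {e : ℕ}
    (hG : G.totalDegree ≤ e)
    (hu : IsUnit (MvPolynomial.eval₂ f v (MvPolynomial.homogeneousComponent e G))) :
    ∃ G' : (MvPolynomial σ B)[X], G'.Monic ∧ Associated G' (lineHom f v G) := by
  obtain ⟨u, hu⟩ := hu
  obtain ⟨h1, h2⟩ := lineHom_coeff f v hG
  refine ⟨Polynomial.C (MvPolynomial.C (↑u⁻¹ : B)) * lineHom f v G,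
    monic_of_natDegree_le_of_coeff_eq_one e ((natDegree_C_mul_le _ _).trans h1) ?_, ?_⟩
  · rw [coeff_C_mul, h2, ← hu, ← map_mul]
    simp
  · have : IsUnit (Polynomial.C (MvPolynomial.C (↑u⁻¹ : B)) : (MvPolynomial σ B)[X]) :=
      (u⁻¹.isUnit.map MvPolynomial.C).map Polynomial.C
    obtain ⟨w, hw⟩ := this
    rw [← hw, mul_comm]
    exact associated_mul_unit_left _ _ w.isUnit

end GenericLine

section Heights

open Polynomial

lemma height_le_one_of_comap_C_eq_bot {D : Type*} [CommRing D] [IsDomain D] [IsNoetherianRing D]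
    (Q : Ideal D[X]) [Q.IsPrime] (hQ : Q.comap Polynomial.C = ⊥) : Q.height ≤ 1 := by
  let F := FractionRing D
  let := Polynomial.algebra D F
  have : IsLocalization ((nonZeroDivisors D).map (Polynomial.C : D →+* D[X])) F[X] :=
    Polynomial.isLocalization _ _
  have disj : Disjoint (((nonZeroDivisors D).map (Polynomial.C : D →+* D[X]) : Submonoid D[X]) :
      Set D[X]) (Q : Set D[X]) := by
    refine Set.disjoint_left.mpr ?_
    rintro _ ⟨b, hb, rfl⟩ hbQ
    have : b ∈ Q.comap Polynomial.C := hbQ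
    rw [hQ] at this
    exact nonZeroDivisors.ne_zero hb this
  rw [← IsLocalization.height_map_of_disjoint ((nonZeroDivisors D).map (Polynomial.C : D →+* D[X]))
    (S := F[X]) Q disj]
  have hp : (Q.map (algebraMap D[X] F[X])).IsPrime :=
    IsLocalization.isPrime_of_isPrime_disjoint _ _ _ inferInstance disj
  refine Ideal.height_le_one_of_isPrincipal_of_mem_minimalPrimes
    (Q.map (algebraMap D[X] F[X])) _ ?_
  rw [Ideal.minimalPrimes_eq_subsingleton_self]
  rfl

lemma height_le_height_comap_C_add_one {R : Type*} [CommRing R] [IsNoetherianRing R]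
    (Q : Ideal R[X]) [Q.IsPrime] : Q.height ≤ (Q.comap Polynomial.C).height + 1 := by
  let p := Q.comap (Polynomial.C : R →+* R[X])
  have : Q.LiesOver p := ⟨rfl⟩
  refine (Ideal.height_le_height_add_of_liesOver p Q).trans ?_
  refine add_le_add_right ?_ _
  let e : (R[X] ⧸ (p.map (algebraMap R R[X]))) ≃+* (R ⧸ p)[X] :=
    (Ideal.polynomialQuotientEquivQuotientPolynomial p).symm
  have hle : p.map (algebraMap R R[X]) ≤ Q := Ideal.map_comap_le
  have hp : (Q.map (Ideal.Quotient.mk (p.map (algebraMap R R[X])))).IsPrime :=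
    Ideal.map_isPrime_of_surjective Ideal.Quotient.mk_surjective (by rwa [Ideal.mk_ker])
  rw [← e.height_map]
  have hp' : ((Q.map (Ideal.Quotient.mk (p.map (algebraMap R R[X])))).map e).IsPrime :=
    Ideal.map_isPrime_of_equiv e
  refine height_le_one_of_comap_C_eq_bot _ ?_
  rw [eq_bot_iff]
  intro a ha
  obtain ⟨a, rfl⟩ := Ideal.Quotient.mk_surjective a
  rw [Ideal.mem_comap, Ideal.mem_map_of_equiv] at ha
  obtain ⟨y, hy, hya⟩ := ha
  have : y = Ideal.Quotient.mk _ (Polynomial.C a) := by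
    apply e.injective
    rw [hya]
    apply e.symm.injective
    simp [e]
  rw [this, Ideal.mem_quotient_iff_mem hle] at hy
  exact Ideal.Quotient.eq_zero_iff_mem.mpr hy

lemma height_comap_le_of_flat {R S : Type*} [CommRing R] [CommRing S] [IsNoetherianRing R]
    [IsNoetherianRing S]
    {f : R →+* S} (hf : f.Flat) (Q : Ideal S) [Q.IsPrime] : (Q.comap f).height ≤ Q.height := by
  algebraize [f]
  have : Q.LiesOver (Q.comap f) := ⟨rfl⟩
  rw [Ideal.height_eq_height_add_of_liesOver_of_hasGoingDown (Q.comap f) Q]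
  exact le_self_add

end Heights

section GenericLineHeights

open Polynomial

attribute [local instance] MvPolynomial.algebraMvPolynomial

lemma MvPolynomial.homogeneousComponent_totalDegree_ne_zero {σ A : Type*} [CommRing A]
    {F : MvPolynomial σ A} (hF : F ≠ 0) : homogeneousComponent F.totalDegree F ≠ 0 := by
  classical
  obtain ⟨ν, hν, h⟩ := Finset.exists_mem_eq_sup F.support
    (MvPolynomial.support_nonempty.mpr hF) fun s => s.degree
  intro h0
  have := congrArg (coeff ν) h0
  rw [coeff_homogeneousComponent, if_pos, coeff_zero] at this
  · exact (mem_support_iff.mp hν) this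
  · rw [← h]
    rfl

variable {σ k : Type*} [Finite σ] [Field k]

/-- If all primes containing `I` have height at least three, then the union of the lines with
generic direction meeting `V(I)` has codimension at least two. -/
lemma exists_isRelPrime_mem_map_lineHom (K : Type*) [Field K] [Algebra (MvPolynomial σ k) K]
    [IsFractionRing (MvPolynomial σ k) K]
    {I : Ideal (MvPolynomial σ k)} (hI : ∀ P : Ideal (MvPolynomial σ k), P.IsPrime → I ≤ P →
      3 ≤ P.height) :
    ∃ g₁ g₂ : MvPolynomial σ K, g₁ ≠ 0 ∧ IsRelPrime g₁ g₂ ∧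
      Polynomial.C g₁ ∈ I.map (lineHom ((algebraMap (MvPolynomial σ k) K).comp MvPolynomial.C)
        fun j => algebraMap (MvPolynomial σ k) K (MvPolynomial.X j)) ∧
      Polynomial.C g₂ ∈ I.map (lineHom ((algebraMap (MvPolynomial σ k) K).comp MvPolynomial.C)
        fun j => algebraMap (MvPolynomial σ k) K (MvPolynomial.X j)) := by
  set f : k →+* K := (algebraMap (MvPolynomial σ k) K).comp MvPolynomial.C with hf
  set v : σ → K := fun j => algebraMap (MvPolynomial σ k) K (MvPolynomial.X j) with hv
  set φ := lineHom f v with hφ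
  have hflat : φ.Flat := lineHom_flat (RingHom.Flat.of_isField (Field.toIsField k) f) v
  have heval : ∀ H, MvPolynomial.eval₂ f v H = algebraMap _ K H := by
    intro H
    have : MvPolynomial.eval₂Hom f v = algebraMap (MvPolynomial σ k) K :=
      MvPolynomial.ringHom_ext (by simp [hf]) (by simp [hv])
    exact RingHom.congr_fun this H
  obtain ⟨F, hFI, hF0⟩ : ∃ F ∈ I, F ≠ 0 := by
    refine Submodule.exists_mem_ne_zero_of_ne_bot fun h => ?_
    have := hI ⊥ Ideal.isPrime_bot h.le
    simp at this
  obtain ⟨F', hF', hFF'⟩ := exists_monic_lineHom f v (G := F) le_rfl (by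
    rw [heval, isUnit_iff_ne_zero, Ne, FaithfulSMul.algebraMap_eq_zero_iff]
    exact MvPolynomial.homogeneousComponent_totalDegree_ne_zero hF0)
  have hF'I : F' ∈ I.map φ := by
    obtain ⟨c, hc⟩ := hFF'.symm.dvd
    exact hc ▸ Ideal.mul_mem_right _ _ (Ideal.mem_map_of_mem φ hFI)
  have key : ∀ P : Ideal (MvPolynomial σ K), P.IsPrime → (I.map φ).comap Polynomial.C ≤ P →
      2 ≤ P.height := by
    intro P hP hle
    let S := (MvPolynomial σ K)[X] ⧸ Ideal.span {F'}
    have : Module.Finite (MvPolynomial σ K) S := hF'.finite_quotient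
    obtain ⟨Q, hQI, hQ, hQP⟩ := Ideal.exists_ideal_over_prime_of_isIntegral (S := S) P
      ((I.map φ).map (Ideal.Quotient.mk (Ideal.span {F'}))) (by
        intro b hb
        refine hle ?_
        have hb' : Ideal.Quotient.mk (Ideal.span {F'}) (Polynomial.C b) ∈
          (I.map φ).map (Ideal.Quotient.mk (Ideal.span {F'})) := hb
        rwa [Ideal.mem_quotient_iff_mem] at hb'
        rwa [Ideal.span_singleton_le_iff_mem])
    let Q' := Q.comap (Ideal.Quotient.mk (Ideal.span {F'}))
    have hQ' : Q'.IsPrime := inferInstance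
    have hcomap : Q'.comap Polynomial.C = P := by
      rw [← hQP]; rfl
    have h3 : 3 ≤ (Q'.comap φ).height := by
      refine hI _ inferInstance ?_
      rw [← Ideal.map_le_iff_le_comap]
      exact Ideal.map_le_iff_le_comap.mp hQI
    have h4 : (3 : ℕ∞) ≤ P.height + 1 := by
      rw [← hcomap]
      exact h3.trans ((height_comap_le_of_flat hflat Q').trans
        (height_le_height_comap_C_add_one Q'))
    have : (2 : ℕ∞) + 1 ≤ P.height + 1 := by
      norm_num; exact h4
    exact (ENat.add_le_add_iff_right (by simp)).mp this
  obtain ⟨g₁, h₁, g₂, h₂, h0, hrel⟩ := exists_isRelPrime_of_two_le_height key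
  exact ⟨g₁, g₂, h0, hrel, h₁, h₂⟩

end GenericLineHeights

section GenericLineGenerator

open Polynomial

attribute [local instance] MvPolynomial.algebraMvPolynomial

instance MvPolynomial.isPrime_map_C {σ A : Type*} [CommRing A] (s : Ideal A) [s.IsPrime] :
    (s.map (MvPolynomial.C : A →+* MvPolynomial σ A)).IsPrime := by
  have := MvPolynomial.ker_map (σ := σ) (Ideal.Quotient.mk s)
  rw [Ideal.mk_ker] at this
  rw [← this]
  exact RingHom.ker_isPrime _

lemma Polynomial.Monic.dvd_of_dvd_C_mul {B : Type*} [CommRing B] {G w : B[X]} (hG : G.Monic)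
    {g : B} (hg : IsRegular g) (h : G ∣ Polynomial.C g * w) : G ∣ w := by
  rw [← modByMonic_eq_zero_iff_dvd hG, ← smul_eq_C_mul, smul_modByMonic] at h
  rw [← modByMonic_eq_zero_iff_dvd hG]
  ext n
  have := congrArg (fun f => f.coeff n) h
  simp only [coeff_smul, smul_eq_mul, coeff_zero] at this
  rw [coeff_zero]
  exact hg.left (by simpa using this)

variable {σ k A K 𝒜 ι : Type*} [Field k] [CommRing A] [Field K] [CommRing 𝒜]

lemma notMem_map_C_of_ne_zero (fK : K →+* 𝒜) {g : MvPolynomial σ K} (hg : g ≠ 0)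
    (s : Ideal 𝒜) (hs : s ≠ ⊤) : MvPolynomial.map fK g ∉ s.map MvPolynomial.C := by
  intro h
  obtain ⟨ν, hν⟩ := MvPolynomial.ne_zero_iff.mp hg
  have := MvPolynomial.mem_map_C_iff.mp h ν
  rw [MvPolynomial.coeff_map] at this
  exact hs (Ideal.eq_top_of_isUnit_mem _ this ((isUnit_iff_ne_zero.mpr hν).map fK))

/-- On the pencil of lines with generic direction, the fractional ideal of denominators is
principal, generated by a monic polynomial. -/
lemma exists_monic_forall_dvd_iff [IsLocalRing 𝒜] (f₀ : k →+* K) (fK : K →+* 𝒜) (fkA : k →+* A) (fA : A →+* 𝒜)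
    (hcomp : fA.comp fkA = fK.comp f₀) (v : σ → K) {I : Ideal (MvPolynomial σ k)}
    {g₁ g₂ : MvPolynomial σ K} (hg₁ : g₁ ≠ 0) (hrel : IsRelPrime g₁ g₂)
    (hg₁I : Polynomial.C g₁ ∈ I.map (lineHom f₀ v)) (hg₂I : Polynomial.C g₂ ∈ I.map (lineHom f₀ v))
    {G : MvPolynomial σ A} {G' : (MvPolynomial σ 𝒜)[X]} (hG' : G'.Monic)
    (hGG' : Associated G' (lineHom fA (fK ∘ v) G)) (p q : ι → MvPolynomial σ A)
    (hpq : ∀ i j, G ∣ q i * p j)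
    (hI : ∀ g ∈ I, ∃ m a, IsUnit (fA a) ∧ MvPolynomial.C a * (MvPolynomial.map fkA g ^ m * G) ∈
      Ideal.span (Set.range fun ij : ι × ι => q ij.1 * p ij.2)) :
    ∃ χ : (MvPolynomial σ 𝒜)[X], χ.Monic ∧
      ∀ d, (∀ j, lineHom fA (fK ∘ v) G ∣ d * lineHom fA (fK ∘ v) (p j)) ↔ χ ∣ d := by
  algebraize [fK]
  set φ := lineHom fA (fK ∘ v) with hφ
  let J : Ideal (MvPolynomial σ 𝒜)[X] := (Ideal.span {G'}).colon (Set.range (φ ∘ p))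
  have memJ : ∀ d, d ∈ J ↔ ∀ j, G' ∣ d * φ (p j) := by
    intro d
    simp [J, Submodule.mem_colon, Ideal.mem_span_singleton]
  let J' : Ideal (MvPolynomial σ 𝒜)[X] := Ideal.span (Set.range (φ ∘ p))
  have hJ : J * J' ≤ Ideal.span {G'} := by
    rw [Ideal.mul_le]
    intro r hr s hs
    induction hs using Submodule.span_induction with
    | mem x hx =>
      obtain ⟨j, rfl⟩ := hx
      exact Ideal.mem_span_singleton.mpr ((memJ r).mp hr j)
    | zero => simp
    | add x y _ _ hx hy => rw [mul_add]; exact add_mem hx hy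
    | smul a x _ hx =>
      rw [smul_eq_mul, mul_left_comm]
      exact Ideal.mul_mem_left _ _ hx
  have hqJ : ∀ i, φ (q i) ∈ J := fun i => (memJ _).mpr fun j => by
    rw [← map_mul]
    exact hGG'.dvd.trans (map_dvd φ (hpq i j))
  let 𝔠 : Ideal (MvPolynomial σ 𝒜)[X] := (J * J').colon {G'}
  have hIrad : I.map (φ.comp (MvPolynomial.map fkA)) ≤ 𝔠.radical := by
    rw [Ideal.map_le_iff_le_comap]
    intro g hg
    obtain ⟨m, a, ha, hm⟩ := hI g hg
    refine ⟨m, ?_⟩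
    rw [Submodule.mem_colon_singleton, smul_eq_mul]
    have h1 := Ideal.mem_map_of_mem φ hm
    have h2 : (Ideal.span (Set.range fun ij : ι × ι => q ij.1 * p ij.2)).map φ ≤ J * J' := by
      rw [Ideal.map_span, Ideal.span_le]
      rintro _ ⟨_, ⟨ij, rfl⟩, rfl⟩
      rw [map_mul]
      exact Ideal.mul_mem_mul (hqJ _) (Ideal.subset_span ⟨ij.2, rfl⟩)
    have h3 := h2 h1
    obtain ⟨u, hu⟩ := hGG'.symm.dvd
    rw [map_mul, lineHom_C, Ideal.unit_mul_mem_iff_mem _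
      ((ha.map MvPolynomial.C).map Polynomial.C), map_mul, map_pow] at h3
    rw [hu, ← mul_assoc]
    exact Ideal.mul_mem_right _ _ h3
  let ψ : (MvPolynomial σ K)[X] →+* (MvPolynomial σ 𝒜)[X] :=
    Polynomial.mapRingHom (MvPolynomial.map fK)
  have hψ : ψ.comp (lineHom f₀ v) = φ.comp (MvPolynomial.map fkA) := by
    refine MvPolynomial.ringHom_ext ?_ ?_
    · intro a
      have := RingHom.congr_fun hcomp a
      simp only [RingHom.comp_apply] at this
      simp [ψ, lineHom_C, hφ, this]
    · intro j
      simp [ψ, lineHom_X, hφ]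
  have hmem : ∀ g, Polynomial.C g ∈ I.map (lineHom f₀ v) →
      Polynomial.C (MvPolynomial.map fK g) ∈ 𝔠.radical := by
    intro g hg
    refine hIrad ?_
    rw [← hψ, ← Ideal.map_map]
    have := Ideal.mem_map_of_mem ψ hg
    simpa [ψ] using this
  obtain ⟨m₁, hm₁⟩ := hmem g₁ hg₁I
  obtain ⟨m₂, hm₂⟩ := hmem g₂ hg₂I
  have hreg : IsRegular (MvPolynomial.map fK g₁) :=
    isRegular_algebraMap_of_flat (R := MvPolynomial σ K) (B := MvPolynomial σ 𝒜) hg₁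
  obtain ⟨χ, hχ, hJχ⟩ := exists_monic_span_eq_of_regular_pair hG' hJ hreg
    (dvd_of_pow_mul_eq_pow_mul_of_isRelPrime (R := MvPolynomial σ K) (B := MvPolynomial σ 𝒜) hrel)
    (p := m₁ + m₂)
    (by
      have := 𝔠.mul_mem_right (Polynomial.C (MvPolynomial.map fK g₁) ^ m₂) hm₁
      rw [← pow_add, Submodule.mem_colon_singleton] at this
      exact this)
    (by
      have := 𝔠.mul_mem_left (Polynomial.C (MvPolynomial.map fK g₂) ^ m₁) hm₂
      rw [← pow_add, Submodule.mem_colon_singleton] at this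
      exact this)
    (fun m r h _ => (memJ r).mpr fun j => by
      have := (memJ _).mp h j
      rw [mul_assoc, ← map_pow] at this
      exact hG'.dvd_of_dvd_C_mul (hreg.pow m) this)
    ((IsLocalRing.maximalIdeal 𝒜).map MvPolynomial.C)
    (notMem_map_C_of_ne_zero fK hg₁ _ Ideal.IsPrime.ne_top')
    (fun τ hτ _ => ⟨(τ.comap MvPolynomial.C).map MvPolynomial.C, inferInstance,
      Ideal.map_comap_le, Ideal.map_mono (IsLocalRing.le_maximalIdeal Ideal.IsPrime.ne_top'),
      notMem_map_C_of_ne_zero fK hg₁ _ Ideal.IsPrime.ne_top'⟩)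
  refine ⟨χ, hχ, fun d => ?_⟩
  rw [← Ideal.mem_span_singleton, ← hJχ, memJ]
  exact forall_congr' fun j => hGG'.symm.dvd_iff_dvd_left

end GenericLineGenerator

section FlatDescent

variable {R D ι : Type*} [CommRing R] [CommRing D] {φ : R →+* D}

/-- Flat base change commutes with the formation of the ideals `⨅ j, (G : p j)`. -/
lemma mem_map_colon_of_flat [Finite ι] (hφ : φ.Flat) (G : R) (p : ι → R) {d : D}
    (hd : ∀ j, φ G ∣ d * φ (p j)) : d ∈ ((Ideal.span {G}).colon (Set.range p)).map φ := by
  classical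
  cases nonempty_fintype ι
  algebraize [φ]
  choose e he using hd
  let x : (Option ι → R) →ₗ[R] D := Fintype.linearCombination R fun o => o.elim d e
  let f : (ι → R) →ₗ[R] (Option ι → R) := Fintype.linearCombination R fun j =>
    Pi.single none (p j) - Pi.single (some j) G
  have hxf : x ∘ₗ f = 0 := by
    ext j
    have he' : φ (p j) * d - φ G * e j = 0 := by rw [← he, mul_comm, sub_self]
    simpa [x, f, Fintype.linearCombination_apply_single, Algebra.smul_def,
      RingHom.algebraMap_toAlgebra] using he'
  obtain ⟨n, a, y, hxy, haf⟩ := Module.Flat.exists_factorization_of_comp_eq_zero_of_free hxf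
  let w := a (Pi.single none 1)
  have hdw : d = y w := by
    have := LinearMap.congr_fun hxy (Pi.single none 1)
    simpa [x, Fintype.linearCombination_apply_single] using this
  have hw : ∀ i, w i ∈ (Ideal.span {G}).colon (Set.range p) := by
    intro i
    rw [Submodule.mem_colon]
    rintro _ ⟨j, rfl⟩
    have h1 : a (f (Pi.single j 1)) = 0 := LinearMap.congr_fun haf (Pi.single j 1)
    have h2 : f (Pi.single j 1) = p j • Pi.single none (1 : R) - G • Pi.single (some j) (1 : R) := by
      simp [f, Fintype.linearCombination_apply_single, ← Pi.single_smul]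
    rw [h2, map_sub, map_smul, map_smul, sub_eq_zero] at h1
    have h3 := DFunLike.congr_fun h1 i
    simp only [Finsupp.smul_apply, smul_eq_mul] at h3
    rw [smul_eq_mul, Ideal.mem_span_singleton, mul_comm]
    exact ⟨_, h3⟩
  rw [hdw, ← w.sum_single, Finsupp.sum, map_sum]
  refine Ideal.sum_mem _ fun i _ => ?_
  have : Finsupp.single i (w i) = w i • Finsupp.single i (1 : R) := by simp
  rw [this, map_smul, Algebra.smul_def]
  exact Ideal.mul_mem_right _ _ (Ideal.mem_map_of_mem _ (hw i))

/-- If the ideal `⨅ j, (G : p j)` becomes principal after a flat base change, then it is principal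
near every point in the image. -/
lemma exists_notMem_dvd_of_flat [Finite ι] (hφ : φ.Flat) {x : Ideal R} [x.IsPrime]
    {𝔮 : Ideal D} (h𝔮 : 𝔮 ≠ ⊤) (hx : x ≤ 𝔮.comap φ) {G : R} {p q : ι → R}
    (hpq : ∀ i j, G ∣ q i * p j) {χ : D} (hχ : IsRegular χ)
    (h : ∀ d, (∀ j, φ G ∣ d * φ (p j)) ↔ χ ∣ d) :
    ∃ a c, c ∉ x ∧ (∀ j, G ∣ a * p j) ∧ ∀ j, a ∣ c * q j := by
  classical
  cases nonempty_fintype ι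
  have hχJ : χ ∈ ((Ideal.span {G}).colon (Set.range p)).map φ :=
    mem_map_colon_of_flat hφ G p ((h χ).mpr dvd_rfl)
  have memJ : ∀ r, r ∈ (Ideal.span {G}).colon (Set.range p) ↔ ∀ j, G ∣ r * p j := by
    intro r
    simp [Submodule.mem_colon, Ideal.mem_span_singleton]
  have hJ : ∀ a, (∀ j, G ∣ a * p j) → χ ∣ φ a := fun a ha => (h _).mp fun j => by
    rw [← map_mul]
    exact map_dvd φ (ha j)
  obtain ⟨a, ha, b, hab, hb⟩ : ∃ a, (∀ j, G ∣ a * p j) ∧ ∃ b, φ a = χ * b ∧ b ∉ 𝔮 := by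
    by_contra! hcon
    have hle : ((Ideal.span {G}).colon (Set.range p)).map φ ≤ Ideal.span {χ} * 𝔮 := by
      rw [Ideal.map_le_iff_le_comap]
      intro a ha
      obtain ⟨b, hb⟩ := hJ a ((memJ a).mp ha)
      rw [Ideal.mem_comap, hb]
      exact Ideal.mul_mem_mul (Ideal.mem_span_singleton_self χ) (hcon a ((memJ a).mp ha) b hb)
    obtain ⟨z, hz, hz'⟩ := Ideal.mem_span_singleton_mul.mp (hle hχJ)
    have : z = 1 := hχ.left (by simpa using hz')
    exact h𝔮 ((Ideal.eq_top_iff_one _).mpr (this ▸ hz))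
  have hc : ∀ j, ∃ c, c ∉ x ∧ a ∣ c * q j := by
    intro j
    by_contra! hcon
    obtain ⟨e, he⟩ := hJ (q j) (hpq j)
    have hb' : b ∈ ((Ideal.span {a}).colon (Set.range fun _ : Unit => q j)).map φ := by
      refine mem_map_colon_of_flat hφ a _ fun _ => ⟨e, ?_⟩
      rw [hab, he]
      ring
    refine hb ((Ideal.map_le_iff_le_comap.mpr (fun r hr => hx ?_) : _ ≤ 𝔮) hb')
    by_contra hrx
    refine hcon r hrx ?_
    rw [Submodule.mem_colon] at hr
    exact Ideal.mem_span_singleton.mp (hr _ ⟨(), rfl⟩)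
  choose c hcx hc using hc
  refine ⟨a, ∏ j, c j, ?_, ha, fun j => (hc j).trans
    (mul_dvd_mul_right (Finset.dvd_prod_of_mem c (Finset.mem_univ j)) _)⟩
  rw [Ideal.IsPrime.prod_mem_iff]
  push Not
  exact fun j _ => hcx j

end FlatDescent

section LocalGenerator

open MvPolynomial in
/-- Every point of affine space over `A` lies on a line with generic direction. -/
lemma exists_ideal_ker_le_comap_lineHom {A σ T : Type*} [CommRing A] [CommRing T] [IsDomain T]
    (π : MvPolynomial σ A →+* T) (𝔓 : Ideal (MvPolynomial σ A)) [𝔓.IsPrime]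
    (h𝔓 : 𝔓 = ((RingHom.ker π).comap C).map C) (𝒜 : Type*) [CommRing 𝒜]
    [Algebra (MvPolynomial σ A) 𝒜] [IsLocalization.AtPrime 𝒜 𝔓] (w : σ → 𝒜) :
    ∃ 𝔮 : Ideal (Polynomial (MvPolynomial σ 𝒜)), 𝔮 ≠ ⊤ ∧
      RingHom.ker π ≤ 𝔮.comap (lineHom ((algebraMap (MvPolynomial σ A) 𝒜).comp C) w) := by
  let κ := FractionRing (MvPolynomial σ T)
  let ρ : A →+* T := π.comp C
  let f𝒜 : 𝒜 →+* κ := IsLocalization.lift (M := 𝔓.primeCompl)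
    (g := (algebraMap _ κ).comp (map ρ)) fun y => by
      rw [RingHom.comp_apply, isUnit_iff_ne_zero, Ne, FaithfulSMul.algebraMap_eq_zero_iff]
      intro hy
      have hker : RingHom.ker (map ρ : MvPolynomial σ A →+* _) = 𝔓 := by
        rw [MvPolynomial.ker_map, ← RingHom.comap_ker, h𝔓]
      exact y.2 (hker ▸ hy : (y : MvPolynomial σ A) ∈ 𝔓)
  have hf𝒜 : ∀ r, f𝒜 (algebraMap _ _ r) = algebraMap _ κ (map ρ r) := fun r =>
    IsLocalization.lift_eq _ r
  let ev : Polynomial (MvPolynomial σ 𝒜) →+* κ := Polynomial.eval₂RingHom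
    (eval₂Hom f𝒜 fun j => algebraMap (MvPolynomial σ T) κ (C (π (X j)))) 0
  have hev : ev.comp (lineHom ((algebraMap (MvPolynomial σ A) 𝒜).comp C) w) =
      (algebraMap (MvPolynomial σ T) κ).comp (C.comp π) := by
    refine ringHom_ext ?_ ?_
    · intro a
      simp [lineHom_C, ev, hf𝒜, ρ]
    · intro j
      simp [lineHom_X, ev]
  refine ⟨RingHom.ker ev, RingHom.ker_ne_top ev, fun r hr => ?_⟩
  have := RingHom.congr_fun hev r
  simp only [RingHom.comp_apply] at this
  rw [Ideal.mem_comap, RingHom.mem_ker, this, (RingHom.mem_ker).mp hr, map_zero, map_zero]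

open MvPolynomial in
/-- Let `q i / G` be sections trivializing a line bundle (with inverse transition data `p j`) on the
complement of a closed subset of codimension at least three in affine space over `A`. If
the leading form of `G` does not vanish at `x`, the line bundle is trivial near `x`. -/
theorem exists_notMem_dvd_of_three_le_height {k A σ ι : Type*} [Field k] [CommRing A] [Algebra k A]
    [Finite σ] [Finite ι] (x : Ideal (MvPolynomial σ A)) [x.IsPrime] {I : Ideal (MvPolynomial σ k)}
    (hI : ∀ P : Ideal (MvPolynomial σ k), P.IsPrime → I ≤ P → 3 ≤ P.height)
    {G : MvPolynomial σ A} {e : ℕ} (hGe : G.totalDegree ≤ e)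
    (hG : homogeneousComponent e G ∉ (x.comap C).map C) {p q : ι → MvPolynomial σ A}
    (hpq : ∀ i j, G ∣ q i * p j)
    (hIG : ∀ g ∈ I, ∃ m, ∃ a ∉ x.comap C, C a * (map (algebraMap k A) g ^ m * G) ∈
      Ideal.span (Set.range fun ij : ι × ι => q ij.1 * p ij.2)) :
    ∃ a c, c ∉ x ∧ (∀ j, G ∣ a * p j) ∧ ∀ j, a ∣ c * q j := by
  let s : Ideal A := x.comap C
  let 𝔓 : Ideal (MvPolynomial σ A) := s.map C
  have hs : s.IsPrime := inferInstance
  have h𝔓 : 𝔓.IsPrime := inferInstance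
  let 𝒜 := Localization.AtPrime 𝔓
  let loc : MvPolynomial σ A →+* 𝒜 := algebraMap _ _
  have hloc : ∀ r, r ∉ 𝔓 → IsUnit (loc r) := fun r hr =>
    IsLocalization.map_units 𝒜 (⟨r, hr⟩ : 𝔓.primeCompl)
  let K := FractionRing (MvPolynomial σ k)
  let fK : K →+* 𝒜 := IsLocalization.lift (M := nonZeroDivisors (MvPolynomial σ k))
    (g := loc.comp (map (algebraMap k A))) fun y => hloc _
      (notMem_map_C_of_ne_zero _ (nonZeroDivisors.ne_zero y.2) _ hs.ne_top)
  have hfK : ∀ r, fK (algebraMap _ K r) = loc (map (algebraMap k A) r) := fun r =>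
    IsLocalization.lift_eq _ r
  let fA : A →+* 𝒜 := loc.comp C
  have hfA : fA.Flat := by
    refine RingHom.Flat.comp ?_ ?_
    · exact RingHom.flat_algebraMap_iff.mpr (inferInstance : Module.Flat A (MvPolynomial σ A))
    · exact RingHom.flat_algebraMap_iff.mpr
        (IsLocalization.flat 𝒜 𝔓.primeCompl)
  let f₀ : k →+* K := (algebraMap (MvPolynomial σ k) K).comp C
  let v : σ → K := fun j => algebraMap (MvPolynomial σ k) K (X j)
  have hv : fK ∘ v = fun j => loc (X j) := by
    funext j
    simp [v, hfK]
  obtain ⟨g₁, g₂, hg₁, hrel, hg₁I, hg₂I⟩ := exists_isRelPrime_mem_map_lineHom K hI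
  obtain ⟨G', hG', hGG'⟩ := exists_monic_lineHom fA (fK ∘ v) hGe (by
    have : eval₂Hom fA (fK ∘ v) = loc := ringHom_ext (by simp [fA]) (by simp [hv])
    rw [← coe_eval₂Hom, this]
    exact hloc _ hG)
  obtain ⟨χ, hχ, h⟩ := exists_monic_forall_dvd_iff f₀ fK (algebraMap k A) fA
    (by ext a; simp [fA, f₀, hfK]) v hg₁ hrel hg₁I hg₂I hG' hGG' p q hpq
    fun g hg => by
      obtain ⟨m, a, ha, h⟩ := hIG g hg
      refine ⟨m, a, hloc _ fun ha' => ha (?_ : a ∈ s), h⟩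
      simpa using mem_map_C_iff.mp ha' 0
  obtain ⟨𝔮, h𝔮, hx𝔮⟩ := exists_ideal_ker_le_comap_lineHom (Ideal.Quotient.mk x) 𝔓
    (by rw [Ideal.mk_ker]) 𝒜 (fK ∘ v)
  rw [Ideal.mk_ker] at hx𝔮
  exact exists_notMem_dvd_of_flat (lineHom_flat hfA (fK ∘ v)) h𝔮 hx𝔮 hpq hχ.isRegular h

end LocalGenerator

namespace AlgebraicGeometry.Scheme

/-- Restriction of functions to a smaller open subset. -/
def fres {X : Scheme.{0}} {W W' : X.Opens} (h : W' ≤ W) : Γ(X, W) →+* Γ(X, W') :=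
  (X.presheaf.map (homOfLE h).op).hom

namespace Modules

variable {X : Scheme.{0}}

/-- Restriction of sections of a sheaf of modules to a smaller open subset. -/
def res (N : X.Modules) {W W' : X.Opens} (h : W' ≤ W) : Γ(N, W) →+ Γ(N, W') :=
  (N.presheaf.map (homOfLE h).op).hom

end Modules

variable {X : Scheme.{0}} (N : X.Modules) {W W' W'' : X.Opens}

@[simp]
lemma fres_fres (h : W' ≤ W) (h' : W'' ≤ W') (s : Γ(X, W)) :
    fres h' (fres h s) = fres (h'.trans h) s := by
  simp only [fres, ← CommRingCat.comp_apply, ← Functor.map_comp]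
  rfl

@[simp]
lemma fres_self (h : W ≤ W) (s : Γ(X, W)) : fres h s = s := by
  simp [fres]

namespace Modules

@[simp]
lemma res_res (h : W' ≤ W) (h' : W'' ≤ W') (s : Γ(N, W)) :
    N.res h' (N.res h s) = N.res (h'.trans h) s := by
  have : (homOfLE (h'.trans h)).op = (homOfLE h).op ≫ (homOfLE h').op := rfl
  simp only [res, this, Functor.map_comp]
  rfl

@[simp]
lemma res_self (h : W ≤ W) (s : Γ(N, W)) : N.res h s = s := by
  simp [res]

@[simp]
lemma res_smul (h : W' ≤ W) (r : Γ(X, W)) (s : Γ(N, W)) :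
    N.res h (r • s) = fres h r • N.res h s :=
  N.map_smul (homOfLE h) r s

lemma eq_of_res_eq {ι : Type} {W' : ι → X.Opens} (hle : ∀ i, W' i ≤ W) (hcov : W ≤ iSup W')
    {s t : Γ(N, W)} (h : ∀ i, N.res (hle i) s = N.res (hle i) t) : s = t :=
  TopCat.Sheaf.eq_of_locally_eq' (C := Ab) ⟨N.presheaf, N.isSheaf⟩ W' W (fun i => homOfLE (hle i)) hcov s t h

lemma exists_res_eq {ι : Type} {W' : ι → X.Opens} (hle : ∀ i, W' i ≤ W) (hcov : W ≤ iSup W')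
    (s : ∀ i, Γ(N, W' i))
    (h : ∀ i j, N.res (inf_le_left : W' i ⊓ W' j ≤ W' i) (s i) =
      N.res (inf_le_right : W' i ⊓ W' j ≤ W' j) (s j)) :
    ∃ t : Γ(N, W), ∀ i, N.res (hle i) t = s i :=
  (TopCat.Sheaf.existsUnique_gluing' (C := Ab) ⟨N.presheaf, N.isSheaf⟩ W' W (fun i => homOfLE (hle i)) hcov s h).exists

end Modules

lemma eq_of_fres_eq {ι : Type} {W' : ι → X.Opens} (hle : ∀ i, W' i ≤ W) (hcov : W ≤ iSup W')
    {s t : Γ(X, W)} (h : ∀ i, fres (hle i) s = fres (hle i) t) : s = t :=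
  TopCat.Sheaf.eq_of_locally_eq' (C := CommRingCat) X.sheaf W' W (fun i => homOfLE (hle i)) hcov s t h

lemma exists_fres_eq {ι : Type} {W' : ι → X.Opens} (hle : ∀ i, W' i ≤ W) (hcov : W ≤ iSup W')
    (s : ∀ i, Γ(X, W' i))
    (h : ∀ i j, fres (inf_le_left : W' i ⊓ W' j ≤ W' i) (s i) =
      fres (inf_le_right : W' i ⊓ W' j ≤ W' j) (s j)) :
    ∃ t : Γ(X, W), ∀ i, fres (hle i) t = s i :=
  (TopCat.Sheaf.existsUnique_gluing' (C := CommRingCat) X.sheaf W' W (fun i => homOfLE (hle i)) hcov s h).exists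

/-- A section `e` over `W` freely generating the sheaf of modules over `W`. -/
def Modules.IsGen (N : X.Modules) (W : X.Opens) (e : Γ(N, W)) : Prop :=
  ∀ ⦃W' : X.Opens⦄ (h : W' ≤ W), Function.Bijective fun r : Γ(X, W') => r • N.res h e

namespace Modules

variable {N}

lemma IsGen.res {e : Γ(N, W)} (he : N.IsGen W e) (h : W' ≤ W) : N.IsGen W' (N.res h e) := by
  intro W'' h'
  simpa using he (h'.trans h)

lemma IsGen.of_cover {e : Γ(N, W)} {ι : Type} {V : ι → X.Opens} (hle : ∀ i, V i ≤ W)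
    (hcov : W ≤ iSup V) (h : ∀ i, N.IsGen (V i) (N.res (hle i) e)) : N.IsGen W e := by
  intro W' hW'
  have hle' (i) : W' ⊓ V i ≤ W' := inf_le_left
  have hcov' : W' ≤ ⨆ i, W' ⊓ V i := by
    rw [← inf_iSup_eq]
    exact le_inf le_rfl (hW'.trans hcov)
  refine ⟨fun r r' hr => ?_, fun m => ?_⟩
  · refine eq_of_fres_eq hle' hcov' fun i => (h i (inf_le_right : W' ⊓ V i ≤ V i)).1 ?_
    have := congrArg (N.res (hle' i)) hr
    simpa using this
  · choose r hr using fun i => (h i (inf_le_right : W' ⊓ V i ≤ V i)).2 (N.res (hle' i) m)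
    obtain ⟨t, ht⟩ := exists_fres_eq hle' hcov' r fun i j => by
      refine (h i (inf_le_left.trans inf_le_right : (W' ⊓ V i) ⊓ (W' ⊓ V j) ≤ V i)).1 ?_
      have h1 := congrArg (N.res (inf_le_left : (W' ⊓ V i) ⊓ (W' ⊓ V j) ≤ _)) (hr i)
      have h2 := congrArg (N.res (inf_le_right : (W' ⊓ V i) ⊓ (W' ⊓ V j) ≤ _)) (hr j)
      simp at h1 h2 ⊢
      rw [h1, h2]
    refine ⟨t, N.eq_of_res_eq hle' hcov' fun i => ?_⟩
    have := hr i
    simp at this ⊢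
    rw [ht, this]

end Modules
end AlgebraicGeometry.Scheme

namespace AlgebraicGeometry.Scheme.Modules
variable {X : Scheme.{0}} {M : X.Modules}

lemma restrictModules_eq (W : X.Opens) : restrictModules W = restrictFunctor W.ι := by
  unfold restrictModules restrictFunctor
  congr 1
  ext V x
  have : (W.ι.appIso V.unop).inv = 𝟙 _ := by simp; rfl
  exact congr($(this.symm) x)

lemma bijective_app_of_isIso {M N : X.Modules} (φ : M ⟶ N) [IsIso φ] (V : X.Opens) :
    Function.Bijective (φ.app V) :=
  ConcreteCategory.bijective_of_isIso (φ.app V)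

lemma isIso_of_bijective_app {M N : X.Modules} (φ : M ⟶ N)
    (h : ∀ V, Function.Bijective (φ.app V)) : IsIso φ :=
  Hom.isIso_iff_isIso_app.mpr fun V => (ConcreteCategory.isIso_iff_bijective (φ.app V)).mpr (h V)

lemma app_res {M N : X.Modules} (φ : M ⟶ N) {V V' : X.Opens} (h : V' ≤ V) (s : Γ(M, V)) :
    N.res h (φ.app V s) = φ.app V' (M.res h s) :=
  (congr($(φ.mapPresheaf.naturality (homOfLE h).op) s)).symm

lemma IsLineBundle.exists_isGen (h : M.IsLineBundle) (x : X) :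
    ∃ W : X.Opens, x ∈ W ∧ ∃ e, M.IsGen W e := by
  obtain ⟨W, hx, ⟨ψ⟩⟩ := h x
  let ψ' : Modules.Hom (SheafOfModules.unit _) ((Scheme.restrictModules W).obj M) := ψ.inv
  have : IsIso (C := (W : Scheme).Modules) ψ' :=
    ⟨ψ.hom, ψ.inv_hom_id, ψ.hom_inv_id⟩
  let u : ∀ V : (W : Scheme.{0}).Opens, Γ(X, W.ι ''ᵁ V) → Γ(M, W.ι ''ᵁ V) :=
    fun V r => ψ'.app V r
  have hbij (V) : Function.Bijective (u V) := bijective_app_of_isIso (X := W) ψ' V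
  have hsmul (V) (r s) : u V (r * s) = r • u V s := ψ'.app_smul (U := V) r s
  have hres {V V'} (h : V' ≤ V) (s) : M.res (W.ι.image_mono h) (u V s) =
      u V' (fres (W.ι.image_mono h) s) := app_res (X := W) ψ' h s
  refine ⟨W.ι ''ᵁ ⊤, by simpa, u ⊤ 1, fun W' hW' => ?_⟩
  obtain ⟨V, rfl⟩ : ∃ V, W' = W.ι ''ᵁ V := by
    refine ⟨W.ι ⁻¹ᵁ W', ?_⟩
    have : W' ≤ W := by simpa using hW'
    simpa [Scheme.Hom.image_preimage_eq_opensRange_inf] using this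
  have key (r : Γ(X, W.ι ''ᵁ V)) : r • M.res hW' (u ⊤ 1) = u V r := by
    have := hres (le_top : V ≤ ⊤) 1
    rw [this, ← hsmul, map_one, mul_one]
  simpa only [key] using hbij V

lemma isLineBundle_of_exists_isGen (h : ∀ x : X, ∃ W : X.Opens, x ∈ W ∧ ∃ e, M.IsGen W e) :
    M.IsLineBundle := by
  intro x
  obtain ⟨W, hx, e, he⟩ := h x
  refine ⟨W, hx, ?_⟩
  have hW (V : (W : Scheme.{0}).Opens) : W.ι ''ᵁ V ≤ W := by
    simpa using W.ι.image_le_opensRange V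
  let M' := (Scheme.restrictModules W).obj M
  let sec : M'.val.sections := ⟨fun V => M.res (hW V.unop) e, fun {V V'} i => M.res_res (hW V.unop)
    (W.ι.image_mono (leOfHom i.unop)) e⟩
  let ψ : SheafOfModules.unit _ ⟶ (M' : SheafOfModules _) := (SheafOfModules.unitHomEquiv _).symm sec
  let ψ' : Modules.Hom (SheafOfModules.unit _) M' := ψ
  have : IsIso (C := (W : Scheme).Modules) ψ' := isIso_of_bijective_app (X := W) ψ' fun V =>
    he (hW V)
  exact ⟨(asIso (C := (W : Scheme).Modules) ψ').symm⟩
end AlgebraicGeometry.Scheme.Modules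

namespace AlgebraicGeometry.Scheme.Modules
variable {X : Scheme.{0}} {N : X.Modules} {U : X.Opens}

/-- Sections of `N` extend uniquely across the complement of `U`. -/
def IsHartogs (N : X.Modules) (U : X.Opens) : Prop :=
  ∀ W : X.Opens, Function.Bijective (N.res (inf_le_left : W ⊓ U ≤ W))

lemma isHartogs_of_cover {ι : Type} {V : ι → X.Opens} (hV : ⨆ i, V i = ⊤)
    (h : ∀ i, ∀ W ≤ V i, Function.Bijective (N.res (inf_le_left : W ⊓ U ≤ W))) :
    N.IsHartogs U := by
  intro W
  have hle (i) : W ⊓ V i ≤ W := inf_le_left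
  have hcov : W ≤ ⨆ i, W ⊓ V i := by rw [← inf_iSup_eq, hV, inf_top_eq]
  refine ⟨fun s t hst => N.eq_of_res_eq hle hcov fun i => (h i (W ⊓ V i) inf_le_right).1 ?_,
    fun m => ?_⟩
  · have := congrArg (N.res (inf_le_inf_right U (hle i))) hst
    simpa using this
  · choose s hs using fun i => (h i (W ⊓ V i) inf_le_right).2
      (N.res (inf_le_inf_right U (hle i)) m)
    obtain ⟨t, ht⟩ := N.exists_res_eq hle hcov s fun i j => by
      refine (h i ((W ⊓ V i) ⊓ (W ⊓ V j)) (inf_le_left.trans inf_le_right)).1 ?_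
      have h1 := congrArg (N.res (inf_le_inf_right U inf_le_left :
        (W ⊓ V i) ⊓ (W ⊓ V j) ⊓ U ≤ _)) (hs i)
      have h2 := congrArg (N.res (inf_le_inf_right U inf_le_right :
        (W ⊓ V i) ⊓ (W ⊓ V j) ⊓ U ≤ _)) (hs j)
      simp only [res_res] at h1 h2 ⊢
      rw [h1, h2]
    refine ⟨t, N.eq_of_res_eq (fun i => inf_le_inf_right U (hle i)) ?_ fun i => ?_⟩
    · rw [← iSup_inf_eq]
      exact inf_le_inf_right U hcov
    · rw [← hs i, ← ht i]
      simp

/-- Functions extend uniquely across the complement of `U`. -/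
def _root_.AlgebraicGeometry.Scheme.IsHartogs (X : Scheme.{0}) (U : X.Opens) : Prop :=
  ∀ W : X.Opens, Function.Bijective (fres (inf_le_left : W ⊓ U ≤ W))

lemma _root_.AlgebraicGeometry.Scheme.isHartogs_of_cover {ι : Type} {V : ι → X.Opens}
    (hV : ⨆ i, V i = ⊤)
    (h : ∀ i, ∀ W ≤ V i, Function.Bijective (fres (inf_le_left : W ⊓ U ≤ W))) :
    X.IsHartogs U :=
  Modules.isHartogs_of_cover (N := (SheafOfModules.unit X.ringCatSheaf :)) hV h

lemma IsGen.bijective_res (hX : X.IsHartogs U) {V : X.Opens} {e : Γ(N, V)} (he : N.IsGen V e)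
    {W : X.Opens} (hW : W ≤ V) : Function.Bijective (N.res (inf_le_left : W ⊓ U ≤ W)) := by
  have h1 := he hW
  have h2 := he (inf_le_left.trans hW : W ⊓ U ≤ V)
  refine (Function.Bijective.of_comp_iff _ h1).mp ?_
  convert h2.comp (hX W) using 1
  ext r
  simp

lemma IsLineBundle.isHartogs (hN : N.IsLineBundle) (hX : X.IsHartogs U) : N.IsHartogs U := by
  choose V hV e he using hN.exists_isGen
  refine isHartogs_of_cover (V := V) (eq_top_iff.mpr fun x _ => ?_) fun x W hW =>
    (he x).bijective_res hX hW
  exact Opens.mem_iSup.mpr ⟨x, hV x⟩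

lemma bijective_res_of_le {W W' : X.Opens} (h : W' ≤ W) (h' : W ≤ W') :
    Function.Bijective (N.res h) := by
  obtain rfl := le_antisymm h h'
  convert Function.bijective_id
  ext
  simp

lemma isHartogs_pushforward (M : (U : Scheme.{0}).Modules) :
    ((pushforward U.ι).obj M).IsHartogs U := fun W =>
  bijective_res_of_le (N := M) (W := U.ι ⁻¹ᵁ W) (W' := U.ι ⁻¹ᵁ (W ⊓ U)) _ fun x hx => ⟨hx, x.2⟩

lemma IsHartogs.isIso_unit (h : N.IsHartogs U) :
    IsIso ((restrictAdjunction U.ι).unit.app N) := by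
  refine isIso_of_bijective_app _ fun W => ?_
  rw [restrictAdjunction_unit_app_app]
  have hW : U.ι ''ᵁ U.ι ⁻¹ᵁ W ≤ W ⊓ U := by
    rw [Scheme.Hom.image_preimage_eq_opensRange_inf, inf_comm]; simp
  have h2 : W ⊓ U ≤ U.ι ''ᵁ U.ι ⁻¹ᵁ W := by
    rw [Scheme.Hom.image_preimage_eq_opensRange_inf, inf_comm]; simp
  have := (bijective_res_of_le (N := N) hW h2).comp (h W)
  have key : ⇑(N.presheaf.map (homOfLE (U.ι.image_preimage_le W)).op) =
      N.res hW ∘ N.res (inf_le_left : W ⊓ U ≤ W) :=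
    funext fun s => (N.res_res _ _ s).symm
  exact key ▸ this

lemma bijective_restrict_map (L : X.Modules) (h : N.IsHartogs U) :
    Function.Bijective fun f : L ⟶ N => (restrictFunctor U.ι).map f := by
  have := h.isIso_unit
  let adj := restrictAdjunction U.ι
  have h1 : Function.Bijective fun f : L ⟶ N => f ≫ adj.unit.app N :=
    ⟨fun f g hfg => (cancel_mono _).mp hfg, fun g => ⟨g ≫ inv (adj.unit.app N), by simp⟩⟩
  refine (Function.Bijective.of_comp_iff' (adj.homEquiv L _).bijective _).mp ?_
  have key : (adj.homEquiv L _ ∘ fun f : L ⟶ N => (restrictFunctor U.ι).map f) =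
      fun f => f ≫ adj.unit.app N := by
    ext1 f
    simp [Adjunction.homEquiv_unit]
  exact key ▸ h1

lemma bijective_restrict_mapIso {L₁ L₂ : X.Modules} (h₁ : L₁.IsHartogs U) (h₂ : L₂.IsHartogs U) :
    Function.Bijective fun e : L₁ ≅ L₂ => (restrictFunctor U.ι).mapIso e := by
  refine ⟨fun e e' h => Iso.ext ((bijective_restrict_map L₁ h₂).1 congr(($h).hom)), fun e => ?_⟩
  obtain ⟨f, hf⟩ := (bijective_restrict_map L₁ h₂).2 e.hom
  obtain ⟨g, hg⟩ := (bijective_restrict_map L₂ h₁).2 e.inv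
  simp only at hf hg
  refine ⟨⟨f, g, (bijective_restrict_map L₁ h₁).1 ?_, (bijective_restrict_map L₂ h₂).1 ?_⟩, ?_⟩
  · simp [hf, hg]
  · simp [hf, hg]
  · ext1
    exact hf

lemma exists_isGen_pushforward {M : (U : Scheme.{0}).Modules} (hM : M.IsLineBundle) {x : X}
    (hx : x ∈ U) : ∃ W : X.Opens, x ∈ W ∧ ∃ e, ((pushforward U.ι).obj M).IsGen W e := by
  obtain ⟨V, hV, e, he⟩ := hM.exists_isGen ⟨x, hx⟩
  have hVV : U.ι ⁻¹ᵁ U.ι ''ᵁ V ≤ V := by simp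
  refine ⟨U.ι ''ᵁ V, ⟨_, hV, rfl⟩, M.res hVV e, fun W' hW' => ?_⟩
  have h1 := he ((U.ι.preimage_mono hW').trans hVV)
  have hU : W' ≤ U := hW'.trans (by simpa using U.ι.image_le_opensRange V)
  have h2 : Function.Bijective (U.ι.app W') := by
    have := U.ι.isIso_app W' (by simpa using hU)
    exact ConcreteCategory.bijective_of_isIso (U.ι.app W')
  have key : (fun r : Γ(X, W') => r • ((pushforward U.ι).obj M).res hW' (M.res hVV e)) =
      (fun r => r • M.res ((U.ι.preimage_mono hW').trans hVV) e) ∘ U.ι.app W' :=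
    funext fun r => congrArg (U.ι.app W' r • ·) (M.res_res hVV
      (U.ι.preimage_mono hW') e)
  exact key ▸ h1.comp h2

end AlgebraicGeometry.Scheme.Modules

namespace AlgebraicGeometry.Scheme
variable {X : Scheme.{0}} {W : X.Opens}

lemma isUnit_fres {f : Γ(X, W)} {V : X.Opens} (hV : V ≤ X.basicOpen f) :
    IsUnit (fres (hV.trans (X.basicOpen_le f)) f) := by
  have h := (RingedSpace.isUnit_res_basicOpen X.toRingedSpace f).map (fres (X := X) hV)
  change IsUnit (fres hV (fres (X.basicOpen_le f) f)) at h
  simpa using h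

lemma exists_pow_mul_eq_fres (hW : IsAffineOpen W) (f : Γ(X, W)) (s : Γ(X, X.basicOpen f)) :
    ∃ n, ∃ r : Γ(X, W), fres (X.basicOpen_le f) f ^ n * s = fres (X.basicOpen_le f) r := by
  have := hW.isLocalization_basicOpen f
  obtain ⟨n, r, hr⟩ := IsLocalization.Away.surj f s
  refine ⟨n, r, ?_⟩
  rw [mul_comm]
  exact hr

lemma exists_pow_mul_eq_zero (hW : IsAffineOpen W) (f : Γ(X, W)) {r : Γ(X, W)}
    (hr : fres (X.basicOpen_le f) r = 0) : ∃ n, f ^ n * r = 0 := by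
  have := hW.isLocalization_basicOpen f
  have h0 : algebraMap Γ(X, W) Γ(X, X.basicOpen f) r =
    algebraMap Γ(X, W) Γ(X, X.basicOpen f) 0 := by rw [map_zero]; exact hr
  obtain ⟨n, hn⟩ := IsLocalization.Away.exists_of_eq f h0
  exact ⟨n, by simpa using hn⟩

namespace Modules

variable {N : X.Modules}

/-- The action of functions on `W` on sections over a smaller open subset. -/
def act (N : X.Modules) {W V : X.Opens} (h : V ≤ W) (r : Γ(X, W)) : Γ(N, V) →+ Γ(N, V) :=
  DistribSMul.toAddMonoidHom _ (fres h r)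

lemma act_mul {V : X.Opens} (h : V ≤ W) (r s : Γ(X, W)) (m : Γ(N, V)) :
    N.act h (r * s) m = N.act h r (N.act h s m) := by
  simp [act, mul_smul]

lemma act_comm {V : X.Opens} (h : V ≤ W) (r s : Γ(X, W)) (m : Γ(N, V)) :
    N.act h r (N.act h s m) = N.act h s (N.act h r m) := by
  rw [← act_mul, mul_comm, act_mul]

lemma res_act {V V' : X.Opens} (h : V ≤ W) (h' : V' ≤ V) (r : Γ(X, W)) (m : Γ(N, V)) :
    N.res h' (N.act h r m) = N.act (h'.trans h) r (N.res h' m) := by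
  simp [act]

lemma bijective_act_pow {f : Γ(X, W)} {V : X.Opens} (hV : V ≤ X.basicOpen f) (n : ℕ) :
    Function.Bijective (N.act (hV.trans (X.basicOpen_le f)) (f ^ n)) := by
  obtain ⟨u, hu⟩ := isUnit_fres hV
  have : ⇑(N.act (hV.trans (X.basicOpen_le f)) (f ^ n)) = fun m => (u ^ n) • m := by
    ext m; simp [act, ← hu]; rfl
  rw [this]
  exact MulAction.bijective (u ^ n)

open Filter in
lemma IsGen.eventually_act_pow (hW : IsAffineOpen W) {V : X.Opens} {e : Γ(N, V)}
    (he : N.IsGen V e) (f : Γ(X, W)) (hV : X.basicOpen f ≤ V) (m : Γ(N, X.basicOpen f)) :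
    ∀ᶠ n in atTop, ∃ r : Γ(X, W), N.act (X.basicOpen_le f) (f ^ n) m =
      N.act (X.basicOpen_le f) r (N.res hV e) := by
  obtain ⟨s, hs⟩ := (he hV).2 m
  obtain ⟨n, r, hr⟩ := exists_pow_mul_eq_fres hW f s
  refine eventually_atTop.mpr ⟨n, fun n' hn' => ⟨f ^ (n' - n) * r, ?_⟩⟩
  obtain ⟨d, rfl⟩ := Nat.exists_eq_add_of_le hn'
  simp only [act, DistribSMul.toAddMonoidHom_apply, map_mul, ← hr, ← hs, smul_smul, map_pow]
  congr 1
  rw [Nat.add_sub_cancel_left]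
  ring

lemma IsGen.exists_pow_mul_eq_zero (hW : IsAffineOpen W) {V : X.Opens} {e : Γ(N, V)}
    (he : N.IsGen V e) (f : Γ(X, W)) (hV : X.basicOpen f ≤ V) {r : Γ(X, W)}
    (hr : N.act (X.basicOpen_le f) r (N.res hV e) = 0) : ∃ n, f ^ n * r = 0 := by
  refine Scheme.exists_pow_mul_eq_zero hW f ((he hV).1 ?_)
  simpa [act] using hr

end Modules
end AlgebraicGeometry.Scheme

lemma exists_pow_mul_eq_zero_of_pow_mul_eq_zero {R : Type*} [CommRing R] {G f : R}
    (h : ∀ r, G * r = 0 → ∃ n, f ^ n * r = 0) (t : ℕ) {r : R} (hr : G ^ t * r = 0) :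
    ∃ n, f ^ n * r = 0 := by
  induction t generalizing r with
  | zero => exact ⟨0, by simpa using hr⟩
  | succ t ih =>
    obtain ⟨n, hn⟩ := ih (r := G * r) (by rw [← hr]; ring)
    obtain ⟨n', hn'⟩ := h (f ^ n * r) (by rw [← hn]; ring)
    exact ⟨n' + n, by rw [← hn']; ring⟩

namespace AlgebraicGeometry.Scheme
variable {X : Scheme.{0}} {W : X.Opens}

lemma basicOpen_mul_le_left (f g : Γ(X, W)) : X.basicOpen (f * g) ≤ X.basicOpen f := by
  rw [X.basicOpen_mul]; exact inf_le_left

lemma basicOpen_mul_le_right (f g : Γ(X, W)) : X.basicOpen (f * g) ≤ X.basicOpen g := by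
  rw [X.basicOpen_mul]; exact inf_le_right

namespace Modules

variable {N : X.Modules}

lemma IsGen.eq_zero_of_res_eq_zero (hW : IsAffineOpen W) {V : X.Opens} {e : Γ(N, V)}
    (he : N.IsGen V e) {f G : Γ(X, W)} (hf : ∀ r, G * r = 0 → ∃ n, f ^ n * r = 0)
    (hV : X.basicOpen f ≤ V) {m : Γ(N, X.basicOpen f)}
    (hm : N.res (basicOpen_mul_le_left f G) m = 0) : m = 0 := by
  obtain ⟨n, r, hr⟩ := (he.eventually_act_pow hW f hV m).exists
  have h0 : N.act (X.basicOpen_le (f * G)) r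
      (N.res ((basicOpen_mul_le_left f G).trans hV) e) = 0 := by
    have := congrArg (N.res (basicOpen_mul_le_left f G)) hr
    rw [res_act, res_act, hm, map_zero, res_res] at this
    exact this.symm
  obtain ⟨t, ht⟩ := he.exists_pow_mul_eq_zero hW _ _ h0
  obtain ⟨t', ht'⟩ := exists_pow_mul_eq_zero_of_pow_mul_eq_zero hf t (r := f ^ t * r)
    (by rw [← ht]; ring)
  refine (bijective_act_pow (N := N) (le_refl (X.basicOpen f)) (t' + t + n)).1 ?_
  rw [map_zero, pow_add, act_mul, hr, ← act_mul, pow_add, mul_assoc, ht']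
  simp [act]

open Filter in
theorem IsGen.exists_transition (hW : IsAffineOpen W) {ι : Type} [Finite ι] {f : ι → Γ(X, W)}
    {G : Γ(X, W)} (hf : ∀ j r, G * r = 0 → ∃ n, f j ^ n * r = 0)
    {e : ∀ j, Γ(N, X.basicOpen (f j))} (he : ∀ j, N.IsGen _ (e j))
    {ε : Γ(N, X.basicOpen G)} (hε : N.IsGen _ ε) :
    ∃ n P Q : ℕ, ∃ p q : ι → Γ(X, W), (∀ i j, G ^ (2 * n) ∣ q i * p j) ∧
      (∀ j, q j * p j = f j ^ Q * G ^ (2 * n)) ∧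
      ∀ j, N.act (X.basicOpen_le (f j * G)) (f j ^ P * G ^ n)
        (N.res (basicOpen_mul_le_right (f j) G) ε) =
        N.act (X.basicOpen_le (f j * G)) (p j) (N.res (basicOpen_mul_le_left (f j) G) (e j)) := by
  have h1 := eventually_all.mpr fun j => hε.eventually_act_pow hW (f j * G)
    (basicOpen_mul_le_right _ _) (N.res (basicOpen_mul_le_left _ _) (e j))
  have h2 := eventually_all.mpr fun j => (he j).eventually_act_pow hW (f j * G)
    (basicOpen_mul_le_left _ _) (N.res (basicOpen_mul_le_right _ _) ε)
  have h3 := eventually_all.mpr fun ij : ι × ι => (he ij.2).eventually_act_pow hW (f ij.1 * f ij.2)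
    (basicOpen_mul_le_right _ _) (N.res (basicOpen_mul_le_left _ _) (e ij.1))
  obtain ⟨n, ⟨hn1, hn2⟩, hn3⟩ := ((h1.and h2).and h3).exists
  choose a ha using hn1
  choose a' ha' using hn2
  choose b hb using hn3
  have key1 (ij : ι × ι) : ∀ᶠ P in atTop, (f ij.1 * f ij.2) ^ P * (a ij.1 * a' ij.2) =
      (f ij.1 * f ij.2) ^ P * (G ^ (2 * n) * b ij) := by
    obtain ⟨i, j⟩ := ij
    have hE0 := X.basicOpen_le (f i * f j * G)
    have hEi : X.basicOpen (f i * f j * G) ≤ X.basicOpen (f i * G) := by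
      simp only [X.basicOpen_mul]; exact le_inf (inf_le_left.trans inf_le_left) inf_le_right
    have hEj : X.basicOpen (f i * f j * G) ≤ X.basicOpen (f j * G) := by
      simp only [X.basicOpen_mul]; exact le_inf (inf_le_left.trans inf_le_right) inf_le_right
    have hEij := basicOpen_mul_le_left (f i * f j) G
    have hEG := basicOpen_mul_le_right (f i * f j) G
    have hi := congrArg (N.res hEi) (ha i)
    have hj := congrArg (N.res hEj) (ha' j)
    have hij := congrArg (N.res hEij) (hb (i, j))
    simp only [res_act, res_res] at hi hj hij
    have h0 : N.act hE0 (a i * a' j - G ^ (2 * n) * b (i, j))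
        (N.res (hEj.trans (basicOpen_mul_le_left _ _)) (e j)) = 0 := by
      have h0 : N.act hE0 (a i * a' j) (N.res (hEj.trans (basicOpen_mul_le_left _ _)) (e j)) =
          N.act hE0 (G ^ (2 * n) * b (i, j))
            (N.res (hEj.trans (basicOpen_mul_le_left _ _)) (e j)) := by
        rw [act_mul, ← hj, act_comm, ← hi, act_mul _ (G ^ (2 * n)), ← hij, ← act_mul,
          ← act_mul]
        congr 1
        ring_nf
      simp only [act, DistribSMul.toAddMonoidHom_apply, map_sub, sub_smul] at h0 ⊢
      rw [h0, sub_self]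
    obtain ⟨t, ht⟩ := (he j).exists_pow_mul_eq_zero hW _ _ h0
    obtain ⟨t', ht'⟩ := exists_pow_mul_eq_zero_of_pow_mul_eq_zero (hf j) t
      (r := (f i * f j) ^ t * (a i * a' j - G ^ (2 * n) * b (i, j))) (by rw [← ht]; ring)
    refine eventually_atTop.mpr ⟨t' + t, fun P hP => ?_⟩
    obtain ⟨d, rfl⟩ := Nat.exists_eq_add_of_le hP
    have : (f i * f j) ^ (t' + t + d) * (a i * a' j - G ^ (2 * n) * b (i, j)) = 0 := by
      rw [show (f i * f j) ^ (t' + t + d) * (a i * a' j - G ^ (2 * n) * b (i, j)) =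
        (f i * f j) ^ d * f i ^ t' *
        (f j ^ t' * ((f i * f j) ^ t * (a i * a' j - G ^ (2 * n) * b (i, j)))) by ring, ht', mul_zero]
    rwa [mul_sub, sub_eq_zero] at this
  have key2 (j : ι) : ∀ᶠ P in atTop, f j ^ P * (a j * a' j) = f j ^ P * (f j * G) ^ (2 * n) := by
    have hE0 := X.basicOpen_le (f j * G)
    have h0 : N.act hE0 (a j * a' j - (f j * G) ^ (2 * n))
        (N.res (basicOpen_mul_le_left _ _) (e j)) = 0 := by
      have h0 : N.act hE0 (a j * a' j) (N.res (basicOpen_mul_le_left _ _) (e j)) =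
          N.act hE0 ((f j * G) ^ (2 * n)) (N.res (basicOpen_mul_le_left _ _) (e j)) := by
        rw [act_mul, ← ha' j, act_comm, ← ha j, ← act_mul]
        congr 1
        ring_nf
      simp only [act, DistribSMul.toAddMonoidHom_apply, map_sub, sub_smul] at h0 ⊢
      rw [h0, sub_self]
    obtain ⟨t, ht⟩ := (he j).exists_pow_mul_eq_zero hW _ _ h0
    obtain ⟨t', ht'⟩ := exists_pow_mul_eq_zero_of_pow_mul_eq_zero (hf j) t
      (r := f j ^ t * (a j * a' j - (f j * G) ^ (2 * n))) (by rw [← ht]; ring)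
    refine eventually_atTop.mpr ⟨t' + t, fun P hP => ?_⟩
    obtain ⟨d, rfl⟩ := Nat.exists_eq_add_of_le hP
    have : f j ^ (t' + t + d) * (a j * a' j - (f j * G) ^ (2 * n)) = 0 := by
      rw [show f j ^ (t' + t + d) * (a j * a' j - (f j * G) ^ (2 * n)) =
        f j ^ d * (f j ^ t' * (f j ^ t * (a j * a' j - (f j * G) ^ (2 * n)))) by ring, ht', mul_zero]
    rwa [mul_sub, sub_eq_zero] at this
  obtain ⟨P, hP1, hP2⟩ := ((eventually_all.mpr key1).and (eventually_all.mpr key2)).exists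
  refine ⟨n, P + n, 2 * P + 2 * n, fun j => f j ^ P * a' j, fun i => f i ^ P * a i,
    fun i j => ?_, fun j => ?_, fun j => ?_⟩
  · exact ⟨(f i * f j) ^ P * b (i, j), by linear_combination hP1 (i, j)⟩
  · linear_combination f j ^ P * hP2 j
  · rw [act_mul _ (f j ^ P) (a' j), ← ha' j, ← act_mul]
    congr 1
    ring_nf

end Modules
end AlgebraicGeometry.Scheme

namespace AlgebraicGeometry.Scheme.Modules
variable {X : Scheme.{0}} {W : X.Opens} {N : X.Modules}

lemma IsGen.of_smul_eq_smul {V : X.Opens} {e m : Γ(N, V)} (he : N.IsGen V e) {u v : Γ(X, V)}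
    (hu : IsUnit u) (hv : IsUnit v) (h : v • m = u • e) : N.IsGen V m := by
  obtain ⟨v, rfl⟩ := hv
  obtain ⟨u, rfl⟩ := hu
  obtain rfl : m = (v⁻¹ * u) • e := by rw [mul_smul, eq_inv_smul_iff]; exact h
  intro W' hW'
  let w : Γ(X, W')ˣ := Units.map (fres hW' : _ →* _) (v⁻¹ * u)
  have : (fun r : Γ(X, W') => r • N.res hW' ((v⁻¹ * u) • e)) =
      (fun r => r • N.res hW' e) ∘ fun r => r * (w : Γ(X, W')) := by
    ext r
    change r • N.res hW' (((v⁻¹ * u : Γ(X, V)ˣ) : Γ(X, V)) • e) = _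
    rw [res_smul, smul_smul]
    rfl
  rw [this]
  exact (he hW').comp (Units.mulRight_bijective w)

lemma IsHartogs.isGen {U V : X.Opens} (hN : N.IsHartogs U) (hX : X.IsHartogs U) {e : Γ(N, V)}
    (h : N.IsGen (V ⊓ U) (N.res inf_le_left e)) : N.IsGen V e := by
  intro W' hW'
  refine (Function.Bijective.of_comp_iff' (hN W') _).mp ?_
  have : (N.res (inf_le_left : W' ⊓ U ≤ W') ∘ fun r : Γ(X, W') => r • N.res hW' e) =
      (fun r => r • N.res (inf_le_inf_right U hW') (N.res inf_le_left e)) ∘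
        fres (inf_le_left : W' ⊓ U ≤ W') := by
    ext r; simp
  rw [this]
  exact (h (inf_le_inf_right U hW')).comp (hX W')

theorem IsGen.exists_of_transition (hW : IsAffineOpen W) {ι : Type} {f : ι → Γ(X, W)}
    {G : Γ(X, W)} (hf : ∀ j r, G * r = 0 → ∃ n, f j ^ n * r = 0)
    {e : ∀ j, Γ(N, X.basicOpen (f j))} (he : ∀ j, N.IsGen _ (e j))
    {ε : Γ(N, X.basicOpen G)} {U W₁ : X.Opens} (hN : N.IsHartogs U) (hX : X.IsHartogs U)
    (hW₁ : W₁ ⊓ U = ⨆ j, X.basicOpen (f j)) {n P Q : ℕ} {p q : ι → Γ(X, W)}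
    (hqp : ∀ j, q j * p j = f j ^ Q * G ^ (2 * n))
    (hp : ∀ j, N.act (X.basicOpen_le (f j * G)) (f j ^ P * G ^ n)
        (N.res (basicOpen_mul_le_right (f j) G) ε) =
        N.act (X.basicOpen_le (f j * G)) (p j) (N.res (basicOpen_mul_le_left (f j) G) (e j)))
    {a c : Γ(X, W)} (h1 : ∀ j, G ^ (2 * n) ∣ a * p j) (h2 : ∀ j, a ∣ c * q j) :
    ∃ m, N.IsGen (W₁ ⊓ X.basicOpen c) m := by
  choose b hb using h1
  choose d hd using h2
  choose m hm using fun j => (bijective_act_pow (N := N) (le_refl (X.basicOpen (f j))) P).2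
    (N.act (X.basicOpen_le (f j)) (b j) (e j))
  have hmε (j) : N.act (X.basicOpen_le (f j * G)) (G ^ n)
      (N.res (basicOpen_mul_le_left (f j) G) (m j)) =
      N.act (X.basicOpen_le (f j * G)) a (N.res (basicOpen_mul_le_right (f j) G) ε) := by
    refine (bijective_act_pow (N := N) (basicOpen_mul_le_left (f j) G) P).1 <|
      (bijective_act_pow (N := N) (basicOpen_mul_le_right (f j) G) n).1 ?_
    have hm' := congrArg (N.res (basicOpen_mul_le_left (f j) G)) (hm j)
    simp only [res_act] at hm'
    have e1 : N.act (X.basicOpen_le (f j * G)) (G ^ n) (N.act (X.basicOpen_le (f j * G)) (f j ^ P)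
        (N.act (X.basicOpen_le (f j * G)) (G ^ n) (N.res (basicOpen_mul_le_left (f j) G) (m j)))) =
        N.act (X.basicOpen_le (f j * G)) (G ^ (2 * n) * b j)
          (N.res (basicOpen_mul_le_left (f j) G) (e j)) := by
      rw [act_comm _ (f j ^ P), hm', ← act_mul, ← act_mul]
      congr 1
      ring_nf
    rw [e1, ← hb, act_mul, ← hp, ← act_mul, ← act_mul, ← act_mul]
    congr 1
    ring_nf
  have hcompat (i j) : N.res (inf_le_left : X.basicOpen (f i) ⊓ X.basicOpen (f j) ≤ _) (m i) =
      N.res inf_le_right (m j) := by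
    have hij : N.res (basicOpen_mul_le_left (f i) (f j)) (m i) -
        N.res (basicOpen_mul_le_right (f i) (f j)) (m j) = 0 := by
      refine (he i).eq_zero_of_res_eq_zero hW (G := G) (fun r hr => ?_)
        (basicOpen_mul_le_left _ _) ?_
      · obtain ⟨t, ht⟩ := hf i r hr
        exact ⟨t, by rw [mul_pow, mul_right_comm, ht, zero_mul]⟩
      · have hEi : X.basicOpen (f i * f j * G) ≤ X.basicOpen (f i * G) := by
          simp only [X.basicOpen_mul]; exact le_inf (inf_le_left.trans inf_le_left) inf_le_right
        have hEj : X.basicOpen (f i * f j * G) ≤ X.basicOpen (f j * G) := by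
          simp only [X.basicOpen_mul]; exact le_inf (inf_le_left.trans inf_le_right) inf_le_right
        refine (bijective_act_pow (N := N) (basicOpen_mul_le_right (f i * f j) G) n).1 ?_
        have hi := congrArg (N.res hEi) (hmε i)
        have hj := congrArg (N.res hEj) (hmε j)
        simp only [res_act, res_res] at hi hj
        simp only [map_sub, map_zero, res_res]
        rw [hi, hj, sub_self]
    have hle : X.basicOpen (f i) ⊓ X.basicOpen (f j) ≤ X.basicOpen (f i * f j) :=
      (X.basicOpen_mul _ _).ge
    have := congrArg (N.res hle) (sub_eq_zero.mp hij)
    simpa only [res_res] using this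
  have hle (j) : X.basicOpen (f j) ≤ W₁ ⊓ U := hW₁ ▸ le_iSup (fun j => X.basicOpen (f j)) j
  obtain ⟨t, ht⟩ := N.exists_res_eq hle hW₁.le m hcompat
  obtain ⟨s, rfl⟩ := (hN W₁).2 t
  refine ⟨N.res inf_le_left s, hN.isGen hX ?_⟩
  have hle' (j) : X.basicOpen c ⊓ X.basicOpen (f j) ≤ W₁ ⊓ X.basicOpen c ⊓ U :=
    le_inf (le_inf (inf_le_right.trans ((hle j).trans inf_le_left)) inf_le_left)
      (inf_le_right.trans ((hle j).trans inf_le_right))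
  refine IsGen.of_cover hle' ?_ fun j => ?_
  · rw [← inf_iSup_eq, ← hW₁]
    exact le_inf (inf_le_left.trans inf_le_right) (inf_le_inf_right U inf_le_left)
  · have hc : X.basicOpen c ⊓ X.basicOpen (f j) ≤ X.basicOpen c := inf_le_left
    have hfj : X.basicOpen c ⊓ X.basicOpen (f j) ≤ X.basicOpen (f j) := inf_le_right
    have hs : N.res (hle' j) (N.res inf_le_left (N.res inf_le_left s)) = N.res hfj (m j) := by
      rw [← ht j]
      simp
    rw [hs]
    have hcu := isUnit_fres hc
    have hfu := isUnit_fres hfj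
    set V := X.basicOpen c ⊓ X.basicOpen (f j)
    set F : Γ(X, W) →+* Γ(X, V) := fres (hfj.trans (X.basicOpen_le (f j)))
    have hbu : IsUnit (F (b j)) := by
      obtain ⟨t, ht⟩ := exists_pow_mul_eq_zero_of_pow_mul_eq_zero (hf j) (2 * n)
        (r := b j * d j - c * f j ^ Q) (by
          linear_combination (-d j) * hb j + c * hqp j - p j * hd j)
      have ht' := congrArg F ht
      rw [map_mul, map_pow, map_zero, (hfu.pow t).mul_right_eq_zero, map_sub, sub_eq_zero] at ht'
      refine isUnit_of_mul_isUnit_left (y := F (d j)) ?_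
      rw [← map_mul, ht', map_mul, map_pow]
      exact hcu.mul (hfu.pow Q)
    refine ((he j).res hfj).of_smul_eq_smul hbu (hfu.pow P) ?_
    have := congrArg (N.res hfj) (hm j)
    simp only [res_act] at this
    simpa [act] using this

end AlgebraicGeometry.Scheme.Modules

namespace MvPolynomial
open nonZeroDivisors

lemma mem_nonZeroDivisors_of_coeff_mem {σ R : Type*} [CommRing R] [Finite σ]
    {p : MvPolynomial σ R} (ν : σ →₀ ℕ) (h : coeff ν p ∈ R⁰) : p ∈ (MvPolynomial σ R)⁰ := by
  induction σ using Finite.induction_empty_option generalizing R with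
  | of_equiv e ih =>
    have := ih (p := rename e.symm p) (ν.mapDomain e.symm)
      (by rwa [coeff_rename_mapDomain _ e.symm.injective])
    rw [mem_nonZeroDivisors_iff_right] at this ⊢
    intro r hr
    refine rename_injective e.symm e.symm.injective ?_
    rw [map_zero]
    exact this _ (by rw [← map_mul, hr, map_zero])
  | h_empty =>
    have := mem_nonZeroDivisors_iff_right.mp h
    rw [mem_nonZeroDivisors_iff_right]
    intro r hr
    obtain rfl : ν = 0 := Subsingleton.elim _ _
    rw [eq_C_of_isEmpty r, eq_C_of_isEmpty p, ← C_mul, C_eq_zero] at hr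
    rw [eq_C_of_isEmpty r, this _ hr, C_0]
  | @h_option σ _ ih =>
    rw [← optionEquivLeft_coeff_some_coeff_none] at h
    have := Polynomial.mem_nonzeroDivisors_of_coeff_mem _ (ih _ h)
    rw [mem_nonZeroDivisors_iff_right] at this ⊢
    intro r hr
    refine (optionEquivLeft R σ).injective ?_
    rw [map_zero]
    exact this _ (by rw [← map_mul, hr, map_zero])

attribute [local instance] algebraMvPolynomial

lemma exists_C_coeff_pow_mul_eq_zero {σ R : Type*} [CommRing R] [Finite σ]
    {p r : MvPolynomial σ R} (ν : σ →₀ ℕ) (h : p * r = 0) : ∃ n, C (coeff ν p) ^ n * r = 0 := by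
  let a := coeff ν p
  have hp := mem_nonZeroDivisors_of_coeff_mem
    (p := map (algebraMap R (Localization.Away a)) p) ν (by
      rw [coeff_map]
      exact (IsLocalization.Away.algebraMap_isUnit a).mem_nonZeroDivisors)
  have h0 : algebraMap _ (MvPolynomial σ (Localization.Away a)) r = 0 := by
    rw [algebraMap_def]
    refine (mem_nonZeroDivisors_iff_right.mp hp) _ ?_
    rw [mul_comm, ← map_mul, h, map_zero]
  obtain ⟨⟨_, m, ⟨n, rfl⟩, rfl⟩, hm⟩ := (IsLocalization.map_eq_zero_iff
    ((Submonoid.powers a).map (C (σ := σ))) _ _).mp h0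
  exact ⟨n, by simpa using hm⟩

end MvPolynomial

namespace MvPolynomial
variable {σ R : Type*} [CommRing R]

lemma homogeneousComponent_add_mul {f g : MvPolynomial σ R} {m n : ℕ} (hf : f.totalDegree ≤ m)
    (hg : g.totalDegree ≤ n) : homogeneousComponent (m + n) (f * g) =
      homogeneousComponent m f * homogeneousComponent n g := by
  classical
  have hcoeff {f : MvPolynomial σ R} {m : ℕ} (hf : f.totalDegree ≤ m) {d : σ →₀ ℕ}
      (hd : m < d.degree) : coeff d f = 0 := by
    by_contra h
    exact absurd ((le_totalDegree (mem_support_iff.mpr h)).trans hf) (not_le.mpr hd)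
  ext d
  simp only [coeff_homogeneousComponent, coeff_mul]
  split_ifs with hd
  · refine Finset.sum_congr rfl fun ab hab => ?_
    have hab' : ab.1.degree + ab.2.degree = m + n := by
      rw [← hd, ← Finset.HasAntidiagonal.mem_antidiagonal.mp hab, map_add]
    rcases lt_trichotomy ab.1.degree m with h | h | h
    · rw [hcoeff hg (d := ab.2) (by lia)]
      simp
    · rw [if_pos h, if_pos (by lia)]
    · rw [hcoeff hf h]
      simp
  · refine (Finset.sum_eq_zero fun ab hab => ?_).symm
    have hab' := congrArg Finsupp.degree (Finset.HasAntidiagonal.mem_antidiagonal.mp hab)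
    rw [map_add] at hab'
    split_ifs <;> first | simp | exact absurd (by lia) hd

lemma homogeneousComponent_pow {f : MvPolynomial σ R} {m : ℕ} (hf : f.totalDegree ≤ m) (n : ℕ) :
    homogeneousComponent (n * m) (f ^ n) = homogeneousComponent m f ^ n := by
  induction n with
  | zero => simp [homogeneousComponent_zero]
  | succ n ih =>
    rw [pow_succ, pow_succ, Nat.succ_mul, homogeneousComponent_add_mul _ hf, ih]
    exact (totalDegree_pow _ _).trans (Nat.mul_le_mul_left _ hf)

end MvPolynomial

namespace AlgebraicGeometry.Scheme
variable {X : Scheme.{0}} {W : X.Opens}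

lemma mem_radical_span_pow_of_basicOpen_le (hW : IsAffineOpen W) {ι : Type*} {f : ι → Γ(X, W)}
    {h : Γ(X, W)} (hf : X.basicOpen h ≤ ⨆ j, X.basicOpen (f j)) (Q : ℕ) :
    h ∈ (Ideal.span (Set.range fun j => f j ^ Q)).radical := by
  rw [Ideal.radical_eq_sInf, Ideal.mem_sInf]
  rintro p ⟨hp, hp'⟩
  by_contra hh
  let y : Spec Γ(X, W) := ⟨p, hp'⟩
  have hy (g : Γ(X, W)) : hW.fromSpec y ∈ X.basicOpen g ↔ g ∉ p := by
    rw [← Scheme.Hom.mem_preimage, hW.fromSpec_preimage_basicOpen]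
    rfl
  obtain ⟨j, hj⟩ := Opens.mem_iSup.mp (hf ((hy h).mpr hh))
  exact (hy _).mp hj (hp'.mem_of_pow_mem _ (hp (Ideal.subset_span ⟨j, rfl⟩)))

namespace Modules
variable {N : X.Modules}

lemma exists_finite_cover_isGen (hW : IsAffineOpen W) {V : X.Opens} (hVW : V ≤ W)
    (hV : IsCompact (V : Set X)) (hN : ∀ y ∈ V, ∃ V', y ∈ V' ∧ ∃ e, N.IsGen V' e) :
    ∃ (n : ℕ) (f : Fin n → Γ(X, W)), V = ⨆ j, X.basicOpen (f j) ∧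
      ∀ j, ∃ e, N.IsGen (X.basicOpen (f j)) e := by
  have key (y : V) : ∃ f : Γ(X, W), y.1 ∈ X.basicOpen f ∧ X.basicOpen f ≤ V ∧
      ∃ e, N.IsGen (X.basicOpen f) e := by
    obtain ⟨V', hy, e, he⟩ := hN y y.2
    obtain ⟨f, hf, hyf⟩ := hW.exists_basicOpen_le (V := V' ⊓ V) ⟨y.1, hy, y.2⟩ (hVW y.2)
    exact ⟨f, hyf, hf.trans inf_le_right, _, he.res (hf.trans inf_le_left)⟩
  choose f hyf hfV hf using key
  obtain ⟨t, ht⟩ := hV.elim_finite_subcover (fun y => (X.basicOpen (f y) : Set X))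
    (fun y => (X.basicOpen (f y)).isOpen) fun y hy => Set.mem_iUnion.mpr ⟨⟨y, hy⟩, hyf ⟨y, hy⟩⟩
  refine ⟨t.card, fun j => f (t.equivFin.symm j), le_antisymm (fun y hy => ?_)
    (iSup_le fun j => hfV _), fun j => hf _⟩
  obtain ⟨z, hz, hyz⟩ := Set.mem_iUnion₂.mp (ht hy)
  exact Opens.mem_iSup.mpr ⟨t.equivFin ⟨z, hz⟩, by simpa using hyz⟩

theorem exists_isGen_of_chart (hW : IsAffineOpen W) {U : X.Opens} {k A σ : Type} [Field k]
    [CommRing A] [Algebra k A] [Finite σ] (φ : MvPolynomial σ A ≃+* Γ(X, W))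
    {I : Ideal (MvPolynomial σ k)} (hI : ∀ P : Ideal _, P.IsPrime → I ≤ P → 3 ≤ P.height)
    (hU : W ⊓ U = ⨆ g : I, X.basicOpen (φ (MvPolynomial.map (algebraMap k A) g)))
    (hN : N.IsHartogs U) (hX : X.IsHartogs U)
    (hgen : ∀ y ∈ U, ∃ V, y ∈ V ∧ ∃ e, N.IsGen V e) {x : X} (P : Ideal (MvPolynomial σ A))
    [P.IsPrime] (hP : ∀ f, x ∈ X.basicOpen (φ f) ↔ f ∉ P) {G : MvPolynomial σ A} {e : ℕ}
    (hGe : G.totalDegree ≤ e)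
    (hG : MvPolynomial.homogeneousComponent e G ∉ (P.comap MvPolynomial.C).map MvPolynomial.C)
    {ε : Γ(N, X.basicOpen (φ G))} (hε : N.IsGen _ ε) :
    ∃ V, x ∈ V ∧ ∃ m, N.IsGen V m := by
  obtain ⟨a, haP, hGa⟩ : ∃ a ∉ P.comap MvPolynomial.C, ∀ r, G * r = 0 →
      ∃ n, MvPolynomial.C a ^ n * r = 0 := by
    rw [MvPolynomial.mem_map_C_iff] at hG
    push Not at hG
    obtain ⟨ν, hν⟩ := hG
    rw [MvPolynomial.coeff_homogeneousComponent] at hν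
    split_ifs at hν with h
    · exact ⟨_, hν, fun r => MvPolynomial.exists_C_coeff_pow_mul_eq_zero ν⟩
    · exact absurd (zero_mem _) hν
  have hcompact : IsCompact ((W ⊓ U : X.Opens) : Set X) := by
    obtain ⟨t, rfl⟩ := (inferInstance : IsNoetherianRing (MvPolynomial σ k)).noetherian I
    have : W ⊓ U = ⨆ g : t, X.basicOpen (φ (MvPolynomial.map (algebraMap k A) g)) := by
      rw [hU]
      refine le_antisymm (iSup_le fun g y hy => ?_)
        (iSup_le fun g => le_iSup_of_le ⟨g, Ideal.subset_span g.2⟩ le_rfl)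
      by_contra hy'
      simp only [Opens.mem_iSup, not_exists] at hy'
      let F : MvPolynomial σ k →+* X.presheaf.stalk y :=
        (X.presheaf.germ W y (X.basicOpen_le _ hy)).hom.comp
          (φ.toRingHom.comp (MvPolynomial.map (algebraMap k A)))
      have hF (g : MvPolynomial σ k) : y ∈ X.basicOpen (φ (MvPolynomial.map (algebraMap k A) g)) ↔
          IsUnit (F g) := X.mem_basicOpen _ _ _
      have hle : Ideal.span (t : Set (MvPolynomial σ k)) ≤
          (IsLocalRing.maximalIdeal (X.presheaf.stalk y)).comap F :=
        Ideal.span_le.mpr fun g hg => by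
          have := hy' ⟨g, hg⟩
          rwa [hF] at this
      exact hle g.2 ((hF _).mp hy)
    rw [this, Opens.coe_iSup]
    exact isCompact_iUnion fun g => (hW.basicOpen _).isCompact
  obtain ⟨s, f₀, hf₀, he₀⟩ := exists_finite_cover_isGen hW inf_le_left hcompact
    fun y hy => hgen y hy.2
  choose e₀ he₀ using he₀
  have hφ : Function.Surjective φ := φ.surjective
  obtain ⟨f₀, rfl⟩ := hφ.comp_left f₀
  let f (j : Fin s) : Γ(X, W) := φ (MvPolynomial.C a * f₀ j)
  have hff₀ (j) : X.basicOpen (f j) ≤ X.basicOpen (φ (f₀ j)) := by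
    simp only [f, map_mul]; exact basicOpen_mul_le_right _ _
  have hf (j) (r : Γ(X, W)) (hr : φ G * r = 0) : ∃ n, f j ^ n * r = 0 := by
    obtain ⟨r, rfl⟩ := hφ r
    rw [← map_mul, EmbeddingLike.map_eq_zero_iff] at hr
    obtain ⟨n, hn⟩ := hGa r hr
    exact ⟨n, by simp only [f]; rw [← map_pow, ← map_mul, mul_pow, mul_right_comm, hn, zero_mul,
      map_zero]⟩
  have he (j) := (he₀ j).res (hff₀ j)
  obtain ⟨n, R, Q, p, q, hqp, hqp', hp⟩ := IsGen.exists_transition hW hf he hε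
  obtain ⟨p, rfl⟩ := hφ.comp_left p
  obtain ⟨q, rfl⟩ := hφ.comp_left q
  have hW₁ : X.basicOpen (φ (MvPolynomial.C a)) ⊓ U = ⨆ j, X.basicOpen (f j) := by
    simp only [f, map_mul, X.basicOpen_mul]
    rw [← inf_iSup_eq]
    change _ = _ ⊓ ⨆ j, X.basicOpen ((φ ∘ f₀) j)
    rw [← hf₀, ← inf_assoc, inf_eq_left.mpr (X.basicOpen_le _)]
  refine (fun key => ?_) (exists_notMem_dvd_of_three_le_height P hI (G := G ^ (2 * n))
    (e := 2 * n * e) (p := p) (q := q)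
    ((MvPolynomial.totalDegree_pow _ _).trans (Nat.mul_le_mul_left _ hGe)) ?_ (fun i j => ?_)
    fun g hg => ?_)
  · obtain ⟨b, c, hcP, hb, hc⟩ := key
    have hP1 : x ∈ X.basicOpen (φ (MvPolynomial.C a)) := (hP _).mpr haP
    obtain ⟨m, hm⟩ := IsGen.exists_of_transition hW hf he hN hX hW₁ hqp' hp (a := φ b) (c := φ c)
      (fun j => by simpa [← map_pow, ← map_mul] using map_dvd φ (hb j))
      (fun j => by simpa [← map_mul] using map_dvd φ (hc j))
    exact ⟨X.basicOpen (φ (MvPolynomial.C a)) ⊓ X.basicOpen (φ c), ⟨hP1, (hP _).mpr hcP⟩, m, hm⟩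
  · rw [MvPolynomial.homogeneousComponent_pow hGe]
    exact fun h => hG (Ideal.IsPrime.mem_of_pow_mem inferInstance _ h)
  · have := hqp i j
    simp only [Function.comp_apply, ← map_pow, ← map_mul] at this
    exact (map_dvd_iff φ).mp this
  · have hle : X.basicOpen (φ (MvPolynomial.C a * MvPolynomial.map (algebraMap k A) g)) ≤
        ⨆ j, X.basicOpen (f j) := by
      rw [← hW₁, map_mul, X.basicOpen_mul]
      refine inf_le_inf_left _ (le_trans ?_ (inf_le_right : W ⊓ U ≤ U))
      rw [hU]
      exact le_iSup_of_le ⟨g, hg⟩ le_rfl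
    obtain ⟨m, hm⟩ := mem_radical_span_pow_of_basicOpen_le hW hle Q
    have hm' : (MvPolynomial.C a * MvPolynomial.map (algebraMap k A) g) ^ m ∈
        Ideal.span (Set.range fun j => (MvPolynomial.C a * f₀ j) ^ Q) := by
      have := Ideal.mem_map_of_mem φ.symm.toRingHom hm
      rw [Ideal.map_span, ← Set.range_comp] at this
      simpa only [f, Function.comp_def, ← map_pow, RingEquiv.toRingHom_eq_coe, RingHom.coe_coe,
        RingEquiv.symm_apply_apply] using this
    refine ⟨m, a ^ m, fun h => haP (Ideal.IsPrime.mem_of_pow_mem inferInstance _ h), ?_⟩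
    rw [map_pow, ← mul_assoc, ← mul_pow]
    have hG' := Ideal.mul_mem_mul hm' (Ideal.mem_span_singleton_self (G ^ (2 * n)))
    rw [Ideal.span_mul_span'] at hG'
    refine Ideal.span_mono ?_ hG'
    rintro _ ⟨_, ⟨j, rfl⟩, _, rfl, rfl⟩
    refine ⟨(j, j), φ.injective ?_⟩
    simpa [f] using hqp' j

end Modules
end AlgebraicGeometry.Scheme

namespace AlgebraicGeometry.Scheme
variable {X : Scheme.{0}} {W : X.Opens}

lemma eq_zero_of_fres_eq_zero (hW : IsAffineOpen W) {α : Γ(X, W)} (hα : IsRegular α) {r : Γ(X, W)}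
    (hr : fres (X.basicOpen_le α) r = 0) : r = 0 := by
  obtain ⟨n, hn⟩ := exists_pow_mul_eq_zero hW α hr
  exact (hα.pow n).1 (by simpa using hn)

lemma bijective_fres_basicOpen_sup (hW : IsAffineOpen W) {α β : Γ(X, W)} (hα : IsRegular α)
    (hβ : IsRegular β) (h : ∀ m c₁ c₂, β ^ m * c₁ = α ^ m * c₂ → α ^ m ∣ c₁) {O : X.Opens}
    (hO : O = X.basicOpen α ⊔ X.basicOpen β) (hOW : O ≤ W) : Function.Bijective (fres hOW) := by
  have hαO : X.basicOpen α ≤ O := hO ▸ le_sup_left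
  have hβO : X.basicOpen β ≤ O := hO ▸ le_sup_right
  refine ⟨(injective_iff_map_eq_zero _).mpr fun s hs => eq_zero_of_fres_eq_zero hW hα ?_,
    fun t => ?_⟩
  · simpa using congrArg (fres hαO) hs
  obtain ⟨m₁, c₁, h₁⟩ := exists_pow_mul_eq_fres hW α (fres hαO t)
  obtain ⟨m₂, c₂, h₂⟩ := exists_pow_mul_eq_fres hW β (fres hβO t)
  have hαβ := X.basicOpen_le (α * β)
  have hl := basicOpen_mul_le_left α β
  have hr := basicOpen_mul_le_right α β
  have e₁ := congrArg (fres hl) h₁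
  have e₂ := congrArg (fres hr) h₂
  simp only [map_mul, map_pow, fres_fres] at e₁ e₂
  obtain ⟨r, hr'⟩ := h (m₁ + m₂) (α ^ m₂ * c₁) (β ^ m₁ * c₂) (by
    rw [← sub_eq_zero]
    refine eq_zero_of_fres_eq_zero hW (hα.mul hβ) ?_
    simp only [map_sub, map_mul, map_pow, ← e₁, ← e₂]
    ring)
  have hr₁ : α ^ m₁ * r = c₁ := (hα.pow m₂).1 (by
    change α ^ m₂ * (α ^ m₁ * r) = α ^ m₂ * c₁
    rw [hr']; ring)
  have ht₁ : fres (X.basicOpen_le α) r = fres hαO t := by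
    refine ((isUnit_fres le_rfl).pow m₁).mul_left_cancel ((Eq.trans ?_ h₁.symm : _))
    rw [← hr₁, map_mul, map_pow]
  have hr₂ : β ^ m₂ * r = c₂ := by
    rw [← sub_eq_zero]
    refine eq_zero_of_fres_eq_zero hW (hα.mul hβ) ?_
    have := congrArg (fres hl) ht₁
    simp only [fres_fres] at this
    simp only [map_sub, map_mul, map_pow, ← e₂, this, sub_self]
  have ht₂ : fres (X.basicOpen_le β) r = fres hβO t := by
    refine ((isUnit_fres le_rfl).pow m₂).mul_left_cancel ((Eq.trans ?_ h₂.symm : _))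
    rw [← hr₂, map_mul, map_pow]
  refine ⟨r, eq_of_fres_eq (W' := fun b : Bool => cond b (X.basicOpen α) (X.basicOpen β))
    (fun b => ?_) ?_ fun b => ?_⟩
  · cases b <;> assumption
  · rw [iSup_bool_eq]; exact hO.le
  · cases b <;> simpa

lemma bijective_fres_of_basis (hW : IsAffineOpen W) {O : X.Opens}
    (h : ∀ f : Γ(X, W), Function.Bijective
      (fres (inf_le_left : X.basicOpen f ⊓ O ≤ X.basicOpen f))) {W' : X.Opens} (hW' : W' ≤ W) :
    Function.Bijective (fres (inf_le_left : W' ⊓ O ≤ W')) := by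
  choose f hf hyf using fun y : W' => hW.exists_basicOpen_le y (hW' y.2)
  have hcov : W' ≤ ⨆ y, X.basicOpen (f y) := fun y hy => Opens.mem_iSup.mpr ⟨⟨y, hy⟩, hyf ⟨y, hy⟩⟩
  refine ⟨fun s t hst => eq_of_fres_eq hf hcov fun i => (h (f i)).1 ?_, fun m => ?_⟩
  · have := congrArg (fres (inf_le_inf_right O (hf i))) hst
    simpa using this
  · choose s hs using fun i => (h (f i)).2 (fres (inf_le_inf_right O (hf i)) m)
    obtain ⟨t, ht⟩ := exists_fres_eq hf hcov s fun i j => by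
      have hle : X.basicOpen (f i) ⊓ X.basicOpen (f j) ≤ X.basicOpen (f i * f j) :=
        (X.basicOpen_mul _ _).ge
      have hl := basicOpen_mul_le_left (f i) (f j)
      have hr := basicOpen_mul_le_right (f i) (f j)
      have : fres hl (s i) = fres hr (s j) := by
        refine (h (f i * f j)).1 ?_
        have h1 := congrArg (fres (inf_le_inf_right O hl)) (hs i)
        have h2 := congrArg (fres (inf_le_inf_right O hr)) (hs j)
        simp only [fres_fres] at h1 h2 ⊢
        rw [h1, h2]
      simpa using congrArg (fres hle) this
    refine ⟨t, eq_of_fres_eq (fun i => inf_le_inf_right O (hf i)) ?_ fun i => ?_⟩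
    · rw [← iSup_inf_eq]
      exact inf_le_inf_right O hcov
    · rw [← hs i, ← ht i]
      simp

attribute [local instance] MvPolynomial.algebraMvPolynomial

theorem bijective_fres_of_chart (hW : IsAffineOpen W) {U : X.Opens} {k A σ : Type} [Field k]
    [CommRing A] [Algebra k A] [Finite σ] (φ : MvPolynomial σ A ≃+* Γ(X, W))
    {I : Ideal (MvPolynomial σ k)} (hI : ∀ P : Ideal _, P.IsPrime → I ≤ P → 2 ≤ P.height)
    (hU : W ⊓ U = ⨆ g : I, X.basicOpen (φ (MvPolynomial.map (algebraMap k A) g)))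
    {W' : X.Opens} (hW' : W' ≤ W) : Function.Bijective (fres (inf_le_left : W' ⊓ U ≤ W')) := by
  obtain ⟨g₁, hg₁, g₂, hg₂, h₁, h₂, hrel⟩ :
      ∃ g₁ ∈ I, ∃ g₂ ∈ I, g₁ ≠ 0 ∧ g₂ ≠ 0 ∧ IsRelPrime g₁ g₂ := by
    obtain ⟨g₁, hg₁, g₂, hg₂, h₁, hrel⟩ := exists_isRelPrime_of_two_le_height hI
    rcases eq_or_ne g₂ 0 with rfl | h₂
    · exact ⟨g₁, hg₁, g₁, hg₁, h₁, h₁, (hrel dvd_rfl (dvd_zero _)).isRelPrime_left⟩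
    · exact ⟨g₁, hg₁, g₂, hg₂, h₁, h₂, hrel⟩
  let F : MvPolynomial σ k →+* Γ(X, W) := φ.toRingHom.comp (MvPolynomial.map (algebraMap k A))
  let O := X.basicOpen (F g₁) ⊔ X.basicOpen (F g₂)
  have hOU : O ≤ U := by
    refine le_trans ?_ (inf_le_right : W ⊓ U ≤ U)
    rw [hU]
    exact sup_le (le_iSup_of_le ⟨g₁, hg₁⟩ le_rfl) (le_iSup_of_le ⟨g₂, hg₂⟩ le_rfl)
  have hO (f : Γ(X, W)) : Function.Bijective
      (fres (inf_le_left : X.basicOpen f ⊓ O ≤ X.basicOpen f)) := by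
    have hloc := hW.isLocalization_basicOpen f
    have hFf : RingHom.Flat ((fres (X.basicOpen_le f)).comp F) := by
      refine RingHom.Flat.comp (RingHom.Flat.comp ?_ (.of_bijective φ.bijective)) ?_
      · exact (inferInstance : Module.Flat (MvPolynomial σ k) (MvPolynomial σ A))
      · exact (IsLocalization.flat _ (Submonoid.powers f) :
          Module.Flat Γ(X, W) Γ(X, X.basicOpen f))
    algebraize [(fres (X.basicOpen_le f)).comp F]
    refine bijective_fres_basicOpen_sup (hW.basicOpen f) (isRegular_algebraMap_of_flat h₁)
      (isRegular_algebraMap_of_flat h₂) (dvd_of_pow_mul_eq_pow_mul_of_isRelPrime hrel) ?_ _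
    rw [inf_sup_left]
    congr 1 <;> exact (X.basicOpen_res _ (homOfLE (X.basicOpen_le f)).op).symm
  have hb {W' : X.Opens} (hW' : W' ≤ W) := bijective_fres_of_basis hW hO hW'
  have hle : W' ⊓ O ≤ W' ⊓ U := inf_le_inf_left _ hOU
  refine (Function.Bijective.of_comp_iff' (f := fres hle) ?_ _).mp ?_
  · have h1 := hb (inf_le_left.trans hW' : W' ⊓ U ≤ W)
    have h2 : W' ⊓ U ⊓ O = W' ⊓ O := by rw [inf_assoc, inf_eq_right.mpr hOU]
    have key (O' : X.Opens) (hO' : O' = W' ⊓ O) (hle' : O' ≤ W' ⊓ U) 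
        (h : Function.Bijective (fres hle')) : Function.Bijective (fres hle) := by
      subst hO'; exact h
    exact key _ h2 _ h1
  · have key : fres hle ∘ fres (inf_le_left : W' ⊓ U ≤ W') = fres inf_le_left :=
      funext fun s => fres_fres _ _ s
    rw [key]
    exact hb hW'

end AlgebraicGeometry.Scheme

namespace MvPolynomial

lemma map_monomial_eq_prod {σ A R : Type*} [Fintype σ] [CommRing A] [CommRing R]
    (α : MvPolynomial σ A →+* R) (ν : σ →₀ ℕ) (c : A) :
    α (monomial ν c) = α (C c) * ∏ j, α (X j) ^ ν j := by
  rw [monomial_eq, map_mul, Finsupp.prod_fintype _ _ (by simp), map_prod]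
  simp only [map_pow]

/-- A polynomial in the affine coordinates of the `l`-th standard chart of projective space
is, up to a power of the `l`-th coordinate, a polynomial in the coordinates of the `i`-th
chart. -/
lemma exists_change_of_chart {σ A : Type*} [Finite σ] [CommRing A] (s : Ideal A) {i l : σ}
    (hil : i ≠ l) (h : MvPolynomial {j // j ≠ l} A) {ν₀ : {j // j ≠ l} →₀ ℕ}
    (hν₀ : ν₀ ⟨i, hil⟩ = 0) (hh : coeff ν₀ h ∉ s) :
    ∃ d, ∃ G : MvPolynomial {j // j ≠ i} A, X ⟨l, hil.symm⟩ ∣ G ∧ G.totalDegree ≤ d ∧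
      homogeneousComponent d G ∉ s.map C ∧
      ∀ {R : Type} [CommRing R] (α : MvPolynomial {j // j ≠ i} A →+* R)
        (β : MvPolynomial {j // j ≠ l} A →+* R), (∀ a, α (C a) = β (C a)) →
        α (X ⟨l, hil.symm⟩) * β (X ⟨i, hil⟩) = 1 →
        (∀ j (hi : j ≠ i) (hl : j ≠ l), α (X ⟨l, hil.symm⟩) * β (X ⟨j, hl⟩) = α (X ⟨j, hi⟩)) →
        α G = α (X ⟨l, hil.symm⟩) ^ d * β h := by
  classical
  have := Fintype.ofFinite σ
  let d := h.totalDegree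
  let N (ν : {j // j ≠ l} →₀ ℕ) (j : σ) : ℕ := if hj : j = l then d + 1 - ν.degree else ν ⟨j, hj⟩
  let m (ν : {j // j ≠ l} →₀ ℕ) : {j // j ≠ i} →₀ ℕ := Finsupp.equivFunOnFinite.symm fun j => N ν j
  have hNl (ν) : N ν l = d + 1 - ν.degree := dif_pos rfl
  have hN (ν) (j) (hj : j ≠ l) : N ν j = ν ⟨j, hj⟩ := dif_neg hj
  have hd {ν} (hν : ν ∈ h.support) : ν.degree ≤ d := le_totalDegree hν
  have hsum {ν} (hν : ν ∈ h.support) : (m ν).degree + ν ⟨i, hil⟩ = d + 1 := by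
    have h1 := Fintype.sum_eq_add_sum_subtype_ne (N ν) i
    have h2 := Fintype.sum_eq_add_sum_subtype_ne (N ν) l
    have h3 : (m ν).degree = ∑ j : {j // j ≠ i}, N ν j := by
      rw [Finsupp.degree_eq_sum]; rfl
    have h4 : ν.degree = ∑ j : {j // j ≠ l}, N ν j := by
      rw [Finsupp.degree_eq_sum]
      exact Finset.sum_congr rfl fun j _ => (hN ν j j.2).symm
    have := hd hν
    rw [hN ν i hil] at h1
    rw [hNl, ← h4] at h2
    lia
  have hm {ν ν'} (hν : ν ∈ h.support) (hν' : ν' ∈ h.support) (e : m ν = m ν') : ν = ν' := by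
    ext ⟨j, hj⟩
    by_cases hji : j = i
    · subst hji
      have := hsum hν
      have := hsum hν'
      rw [e] at *
      lia
    · have := DFunLike.congr_fun e ⟨j, hji⟩
      change N ν j = N ν' j at this
      rwa [hN _ _ hj, hN _ _ hj] at this
  have hν₀' : ν₀ ∈ h.support := mem_support_iff.mpr fun h0 => hh (h0 ▸ zero_mem s)
  let G : MvPolynomial {j // j ≠ i} A := ∑ ν ∈ h.support, monomial (m ν) (coeff ν h)
  refine ⟨d + 1, G, ?_, ?_, fun hG => hh ?_, ?_⟩
  · refine Finset.dvd_sum fun ν hν => X_dvd_monomial.mpr (Or.inr ?_)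
    change N ν l ≠ 0
    have := hd hν
    rw [hNl]; lia
  · refine totalDegree_finsetSum_le fun ν hν => (totalDegree_monomial_le _ _).trans ?_
    have := hsum hν
    change (m ν).degree ≤ _
    lia
  · have := mem_map_C_iff.mp hG (m ν₀)
    rw [coeff_homogeneousComponent, if_pos (by have := hsum hν₀'; lia), coeff_sum,
      Finset.sum_eq_single ν₀ (fun ν hν hne => ?_) (fun hn => absurd hν₀' hn), coeff_monomial,
      if_pos rfl] at this
    · exact this
    · rw [coeff_monomial, if_neg fun e => hne (hm hν hν₀' e)]
  · intro R _ α β hC hi hj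
    conv_rhs => rw [h.as_sum, map_sum, Finset.mul_sum]
    rw [map_sum]
    refine Finset.sum_congr rfl fun ν hν => ?_
    rw [map_monomial_eq_prod, map_monomial_eq_prod, hC, mul_left_comm]
    congr 1
    let z (j : σ) : R := if hj : j = l then α (X ⟨l, hil.symm⟩) else
      α (X ⟨l, hil.symm⟩) * β (X ⟨j, hj⟩)
    have hzl : z l = α (X ⟨l, hil.symm⟩) := dif_pos rfl
    have hz (j) (hj : j ≠ l) : z j = α (X ⟨l, hil.symm⟩) * β (X ⟨j, hj⟩) := dif_neg hj
    have h1 := Fintype.prod_eq_mul_prod_subtype_ne (fun j => z j ^ N ν j) i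
    have h2 := Fintype.prod_eq_mul_prod_subtype_ne (fun j => z j ^ N ν j) l
    have h3 : ∏ j : {j // j ≠ i}, z j ^ N ν j = ∏ j, α (X j) ^ m ν j := by
      refine Finset.prod_congr rfl fun j _ => ?_
      change _ = _ ^ N ν j
      congr 1
      by_cases hjl : j.1 = l
      · obtain ⟨j, hj'⟩ := j
        subst hjl
        exact hzl
      · rw [hz _ hjl, hj _ j.2 hjl]
    have h4 : ∏ j : {j // j ≠ l}, z j ^ N ν j =
        α (X ⟨l, hil.symm⟩) ^ ν.degree * ∏ j, β (X j) ^ ν j := by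
      rw [Finsupp.degree_eq_sum, ← Finset.prod_pow_eq_pow_sum, ← Finset.prod_mul_distrib]
      refine Finset.prod_congr rfl fun j _ => ?_
      rw [hz _ j.2, hN _ _ j.2, mul_pow]
    rw [h1, h3, hz i hil, hi, one_pow, one_mul, h4, hzl, hNl, ← mul_assoc, ← pow_add] at h2
    rw [h2, Nat.sub_add_cancel ((hd hν).trans (Nat.le_succ d))]

end MvPolynomial

namespace MvPolynomial

/-- Reduction of the coefficients modulo an ideal together with the substitution of zero for
one of the variables. -/
def mkEvalZero {τ A : Type*} [CommRing A] (s : Ideal A) (i : τ) :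
    MvPolynomial τ A →+* MvPolynomial τ (A ⧸ s) :=
  open Classical in
  eval₂Hom (C.comp (Ideal.Quotient.mk s)) fun j => if j = i then 0 else X j

lemma exists_coeff_notMem_of_mkEvalZero_ne_zero {τ A : Type*} [CommRing A] {s : Ideal A} {i : τ}
    {h : MvPolynomial τ A} (hh : mkEvalZero s i h ≠ 0) :
    ∃ ν : τ →₀ ℕ, ν i = 0 ∧ coeff ν h ∉ s := by
  contrapose! hh
  rw [h.as_sum, map_sum]
  refine Finset.sum_eq_zero fun ν _ => ?_
  rw [mkEvalZero, coe_eval₂Hom, eval₂_monomial]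
  by_cases hν : ν i = 0
  · simp [Ideal.Quotient.eq_zero_iff_mem.mpr (hh ν hν)]
  · rw [Finsupp.prod, Finset.prod_eq_zero (i := i), mul_zero]
    · simpa using hν
    · simp [hν]

lemma X_dvd_of_mkEvalZero_map_eq_zero {τ k A : Type*} [Field k] [CommRing A] [Algebra k A]
    {s : Ideal A} [s.IsPrime] {i : τ} {g : MvPolynomial τ k}
    (hg : mkEvalZero s i (map (algebraMap k A) g) = 0) : X i ∣ g := by
  classical
  let ζ : MvPolynomial τ k →+* MvPolynomial τ k := eval₂Hom C fun j => if j = i then 0 else X j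
  have h1 : (mkEvalZero s i).comp (map (algebraMap k A)) = (map (algebraMap k (A ⧸ s))).comp ζ := by
    ext j : 2
    · simp [mkEvalZero, ζ]
    · by_cases hj : j = i <;> simp [mkEvalZero, ζ, hj]
  have h2 : (Ideal.Quotient.mk (Ideal.span {X i})).comp ζ = Ideal.Quotient.mk (Ideal.span {X i}) := by
    ext j : 2
    · simp [ζ]
    · by_cases hj : j = i
      · subst hj
        simp [ζ]
      · simp [ζ, hj]
  have h3 : ζ g = 0 := by
    refine map_injective _ (algebraMap k (A ⧸ s)).injective ?_
    rw [map_zero, ← hg]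
    exact (RingHom.congr_fun h1 g).symm
  rw [← Ideal.mem_span_singleton, ← Ideal.Quotient.eq_zero_iff_mem, ← h2, RingHom.comp_apply, h3,
    map_zero]

end MvPolynomial

namespace AlgebraicGeometry.Scheme.Modules

variable {X : Scheme.{0}} {N : X.Modules}

/-- A sheaf of modules which is locally free of rank one on a large open subset of projective space
is free of rank one on a neighbourhood of the generic point of the hyperplane at infinity. -/
lemma exists_isGen_basicOpen_of_charts {U Wi Wl : X.Opens} (hWl : IsAffineOpen Wl)
    {k A σ : Type} [Field k] [CommRing A] [Algebra k A] [Finite σ] {i l : σ} (hil : i ≠ l)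
    (φi : MvPolynomial {j // j ≠ i} A ≃+* Γ(X, Wi)) (φl : MvPolynomial {j // j ≠ l} A ≃+* Γ(X, Wl))
    (hWil : Wi ⊓ Wl = X.basicOpen (φi (MvPolynomial.X ⟨l, hil.symm⟩)))
    (hC : ∀ a, fres (inf_le_left : Wi ⊓ Wl ≤ Wi) (φi (MvPolynomial.C a)) =
      fres inf_le_right (φl (MvPolynomial.C a)))
    (hXi : fres (inf_le_left : Wi ⊓ Wl ≤ Wi) (φi (MvPolynomial.X ⟨l, hil.symm⟩)) *
      fres inf_le_right (φl (MvPolynomial.X ⟨i, hil⟩)) = 1)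
    (hXj : ∀ j (hi : j ≠ i) (hl : j ≠ l),
      fres (inf_le_left : Wi ⊓ Wl ≤ Wi) (φi (MvPolynomial.X ⟨l, hil.symm⟩)) *
        fres inf_le_right (φl (MvPolynomial.X ⟨j, hl⟩)) =
      fres inf_le_left (φi (MvPolynomial.X ⟨j, hi⟩)))
    {I : Ideal (MvPolynomial {j // j ≠ l} k)}
    (hI : ∀ P : Ideal _, P.IsPrime → I ≤ P → 2 ≤ P.height)
    (hU : Wl ⊓ U = ⨆ g : I, X.basicOpen (φl (MvPolynomial.map (algebraMap k A) g)))
    (hgen : ∀ y ∈ U, ∃ V, y ∈ V ∧ ∃ e, N.IsGen V e) (s : Ideal A) [s.IsPrime] :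
    ∃ d, ∃ G : MvPolynomial {j // j ≠ i} A, G.totalDegree ≤ d ∧
      MvPolynomial.homogeneousComponent d G ∉ s.map MvPolynomial.C ∧
      ∃ ε, N.IsGen (X.basicOpen (φi G)) ε := by
  let i' : {j // j ≠ l} := ⟨i, hil⟩
  let q : Ideal Γ(X, Wl) :=
    RingHom.ker ((MvPolynomial.mkEvalZero s i').comp φl.symm.toRingHom)
  have hq : q.IsPrime := RingHom.ker_isPrime _
  let y : Spec Γ(X, Wl) := ⟨q, hq⟩
  have hy (h) : hWl.fromSpec y ∈ X.basicOpen (φl h) ↔ MvPolynomial.mkEvalZero s i' h ≠ 0 := by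
    have : hWl.fromSpec y ∈ X.basicOpen (φl h) ↔ φl h ∉ q := by
      rw [← Scheme.Hom.mem_preimage, hWl.fromSpec_preimage_basicOpen]; rfl
    rw [this, RingHom.mem_ker]
    simp
  have hyl : hWl.fromSpec y ∈ Wl := by
    have := (hy 1).mpr (by simp)
    exact X.basicOpen_le _ this
  have hyU : hWl.fromSpec y ∈ U := by
    by_contra hyU
    have hle : I ≤ Ideal.span {MvPolynomial.X i'} := fun g hg => by
      rw [Ideal.mem_span_singleton]
      refine MvPolynomial.X_dvd_of_mkEvalZero_map_eq_zero (A := A) (s := s) ?_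
      by_contra hne
      have : hWl.fromSpec y ∈ Wl ⊓ U := by
        rw [hU]
        exact Opens.mem_iSup.mpr ⟨⟨g, hg⟩, (hy _).mpr hne⟩
      exact hyU this.2
    have hp : (Ideal.span {(MvPolynomial.X i' : MvPolynomial {j // j ≠ l} k)}).IsPrime :=
      (Ideal.span_singleton_prime (MvPolynomial.X_ne_zero i')).mpr MvPolynomial.X_prime
    have := (hI _ hp hle).trans (Ideal.height_span_singleton_le_one fun h => hp.ne_top (Ideal.span_singleton_eq_top.mpr h))
    norm_num at this
  obtain ⟨O, hyO, e, he⟩ := hgen _ hyU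
  obtain ⟨f, hf, hyf⟩ := hWl.exists_basicOpen_le ⟨_, hyO⟩ hyl
  obtain ⟨h, rfl⟩ := φl.surjective f
  obtain ⟨ν, hν, hνh⟩ := MvPolynomial.exists_coeff_notMem_of_mkEvalZero_ne_zero ((hy h).mp hyf)
  obtain ⟨d, G, hXG, hGd, hG, hα⟩ := MvPolynomial.exists_change_of_chart s hil h hν hνh
  have hle : X.basicOpen (φi G) ≤ Wi ⊓ Wl := by
    obtain ⟨G', rfl⟩ := hXG
    rw [hWil, map_mul]
    exact basicOpen_mul_le_left _ _
  have hle' : X.basicOpen (φi G) ≤ O := by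
    refine le_trans ?_ hf
    have h1 := X.basicOpen_res (φi G) (homOfLE (inf_le_left : Wi ⊓ Wl ≤ Wi)).op
    have h2 := X.basicOpen_res (φl h) (homOfLE (inf_le_right : Wi ⊓ Wl ≤ Wl)).op
    rw [inf_eq_right.mpr hle] at h1
    rw [← h1]
    have h3 := hα ((fres (inf_le_left : Wi ⊓ Wl ≤ Wi)).comp φi.toRingHom)
      ((fres (inf_le_right : Wi ⊓ Wl ≤ Wl)).comp φl.toRingHom) hC hXi hXj
    change X.basicOpen (fres (inf_le_left : Wi ⊓ Wl ≤ Wi) (φi G)) ≤ _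
    have h4 : fres (inf_le_left : Wi ⊓ Wl ≤ Wi) (φi G) = _ := h3
    rw [h4]
    refine (basicOpen_mul_le_right _ _).trans (h2.trans_le inf_le_right)
  exact ⟨d, G, hGd, hG, _, he.res hle'⟩

end AlgebraicGeometry.Scheme.Modules

namespace MvPolynomial

lemma IsHomogeneous.eval₂_mul {σ k R : Type*} [CommRing k] [CommRing R] {a : MvPolynomial σ k}
    {n : ℕ} (ha : a.IsHomogeneous n) (f : k →+* R) (u : R) (v : σ → R) :
    a.eval₂ f (fun j => u * v j) = u ^ n * a.eval₂ f v := by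
  rw [eval₂_eq, eval₂_eq, Finset.mul_sum]
  refine Finset.sum_congr rfl fun ν hν => ?_
  have : ν.degree = n := by
    rw [Finsupp.degree_eq_weight_one]
    exact ha (mem_support_iff.mp hν)
  simp only [mul_pow]
  rw [Finset.prod_mul_distrib, Finset.prod_pow_eq_pow_sum]
  change _ * (u ^ ν.degree * _) = _
  rw [this]
  ring

variable {k σ : Type*} [Field k]

open HomogeneousLocalization

lemma X_mem_homogeneousSubmodule (i : σ) : (X i : MvPolynomial σ k) ∈ homogeneousSubmodule σ k 1 :=
  isHomogeneous_X k i

/-- The fraction `X j / X i`. -/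
def fracX (i j : σ) : Away (homogeneousSubmodule σ k) (X i) :=
  Away.mk _ (X_mem_homogeneousSubmodule i) 1 (X j) (X_mem_homogeneousSubmodule j)

/-- The coordinates on the standard chart `X i ≠ 0` of projective space. -/
def toAway (i : σ) :
    MvPolynomial {j // j ≠ i} k →+* Away (homogeneousSubmodule σ k) (X i) :=
  eval₂Hom ((fromZeroRingHom _ _).comp (algebraMap k (homogeneousSubmodule σ k 0)))
    fun j => fracX i j

lemma val_fracX (i j : σ) : (fracX i j : Away (homogeneousSubmodule σ k) (X i)).val =
    IsLocalization.Away.invSelf (X i : MvPolynomial σ k) * algebraMap _ _ (X j : MvPolynomial σ k) := by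
  rw [fracX, Away.val_mk, Localization.mk_eq_mk', IsLocalization.Away.invSelf,
    mul_comm, IsLocalization.mul_mk'_eq_mk'_of_mul]
  simp

lemma toAway_bijective (i : σ) : Function.Bijective (toAway (k := k) i) := by
  classical
  let L := Localization.Away (X i : MvPolynomial σ k)
  let δ : MvPolynomial σ k →+* MvPolynomial {j // j ≠ i} k :=
    eval₂Hom C fun j => if h : j = i then 1 else X ⟨j, h⟩
  have hδi : δ (X i) = 1 := by simp [δ]
  have hδj (j : {j // j ≠ i}) : δ (X j) = X j := by simp [δ, j.2]
  have hδ : IsUnit (δ (X i)) := hδi ▸ isUnit_one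
  let ρ : L →+* MvPolynomial {j // j ≠ i} k := IsLocalization.Away.lift (X i) hδ
  let val : Away (homogeneousSubmodule σ k) (X i) →+* L := algebraMap _ _
  have hρinv : ρ (IsLocalization.Away.invSelf (X i : MvPolynomial σ k)) = 1 := by
    have h := congrArg ρ (IsLocalization.Away.mul_invSelf (S := L) (X i : MvPolynomial σ k))
    rw [map_mul, map_one, IsLocalization.Away.lift_eq, hδi, one_mul] at h
    exact h
  have hvalC (c : k) : val (toAway i (C c)) = algebraMap _ _ (C c : MvPolynomial σ k) := by
    simp only [toAway, coe_eval₂Hom, eval₂_C]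
    rfl
  have hvalX (j : {j // j ≠ i}) : val (toAway i (X j)) =
      IsLocalization.Away.invSelf (X i : MvPolynomial σ k) * algebraMap _ _ (X j : MvPolynomial σ k) := by
    simp only [toAway, coe_eval₂Hom, eval₂_X]
    exact val_fracX i j
  have hleft : (ρ.comp val).comp (toAway i) = RingHom.id _ := by
    refine ringHom_ext (fun c => ?_) fun j => ?_
    · change ρ (val (toAway i (C c))) = C c
      rw [hvalC, IsLocalization.Away.lift_eq]
      simp [δ]
    · change ρ (val (toAway i (X j))) = X j
      rw [hvalX, map_mul, hρinv, one_mul, IsLocalization.Away.lift_eq, hδj]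
  refine ⟨Function.LeftInverse.injective (g := ρ.comp val) (RingHom.congr_fun hleft), fun x => ?_⟩
  obtain ⟨n, a, ha, rfl⟩ := Away.mk_surjective _ (X_mem_homogeneousSubmodule i) x
  refine ⟨δ a, (ext_iff_val _ _).mpr ?_⟩
  have h1 : (val.comp (toAway i)).comp δ = eval₂Hom ((algebraMap (MvPolynomial σ k) L).comp C)
      fun j => IsLocalization.Away.invSelf (X i : MvPolynomial σ k) * algebraMap _ _ (X j : MvPolynomial σ k) := by
    ext j : 2
    · change val (toAway i (δ (C j))) = _
      have : δ (C j) = C j := by simp [δ]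
      rw [this, hvalC]
      simp
    · change val (toAway i (δ (X j))) = _
      by_cases hj : j = i
      · subst hj
        rw [hδi, map_one, map_one, eval₂Hom_X', mul_comm, IsLocalization.Away.mul_invSelf]
      · rw [hδj ⟨j, hj⟩, hvalX, eval₂Hom_X']
  have h2 : val (toAway i (δ a)) = _ := RingHom.congr_fun h1 a
  change val (toAway i (δ a)) = _
  have ha' : a.IsHomogeneous n := by simpa using ha
  have h3 : eval₂Hom ((algebraMap (MvPolynomial σ k) L).comp C)
      (fun j => algebraMap _ _ (X j : MvPolynomial σ k)) = algebraMap (MvPolynomial σ k) L := by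
    ext j : 2 <;> simp
  rw [h2, coe_eval₂Hom, ha'.eval₂_mul]
  change _ * eval₂Hom _ _ a = _
  rw [h3, Away.val_mk, Localization.mk_eq_mk', IsLocalization.Away.invSelf, ← IsLocalization.mk'_pow]
  rw [mul_comm, IsLocalization.mul_mk'_eq_mk'_of_mul]
  congr 1
  simp

end MvPolynomial

namespace AlgebraicGeometry.Scheme

lemma eq_appLE_of_ι_comp_eq {X : Scheme.{0}} {D : X.Opens} {R : CommRingCat.{0}} {f : X ⟶ Spec R}
    {F : R ⟶ Γ(X, D)} (h : D.ι ≫ f = D.toSpecΓ ≫ Spec.map F) :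
    F = (ΓSpecIso R).inv ≫ f.appLE ⊤ D le_top := by
  have h2 := congrArg Scheme.Hom.appTop h
  rw [Hom.comp_appTop, Hom.comp_appTop, Opens.toSpecΓ_appTop, ΓSpecIso_naturality_assoc,
    ← Iso.inv_comp_eq] at h2
  rw [← cancel_mono D.topIso.inv, ← h2, Category.assoc]
  congr 1
  simp only [Hom.appLE, Category.assoc]
  congr 1
  rw [Opens.ι_appTop, Opens.topIso_inv]
  exact X.presheaf.map_comp _ _

end AlgebraicGeometry.Scheme

namespace MvPolynomial
open HomogeneousLocalization AlgebraicGeometry.Scheme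

variable {k σ : Type} [Field k]

variable (k) in
/-- The standard affine open `X i ≠ 0` of projective space. -/
abbrev projOpen (i : σ) : (Proj (homogeneousSubmodule σ k)).Opens :=
  Proj.basicOpen (homogeneousSubmodule σ k) (X i)

variable (k) in
/-- The function `X j / X i` on the chart `X i ≠ 0` of projective space. -/
def projCoord (i j : σ) : Γ(Proj (homogeneousSubmodule σ k), projOpen k i) :=
  Proj.awayToSection _ _ (fracX i j)

lemma projCoord_self (i : σ) : projCoord k i i = 1 := by
  have : (fracX i i : Away (homogeneousSubmodule σ k) (X i)) = 1 := by
    rw [ext_iff_val, val_fracX, mul_comm,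
      IsLocalization.Away.mul_invSelf (S := Localization.Away _) (X i : MvPolynomial σ k)]
    exact (val_one ..).symm
  rw [projCoord, this]
  exact map_one (Proj.awayToSection _ _).hom

lemma projCoord_mul (i l j : σ) :
    fres (inf_le_left : projOpen k i ⊓ projOpen k l ≤ _) (projCoord k i l) *
      fres inf_le_right (projCoord k l j) = fres inf_le_left (projCoord k i j) := by
  have hle : projOpen k i ⊓ projOpen k l ≤
      Proj.basicOpen (homogeneousSubmodule σ k) (X i * X l) := (Proj.basicOpen_mul _ _ _).ge
  have h₁ (z) : Proj.awayToSection _ _ (awayMap (homogeneousSubmodule σ k)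
      (X_mem_homogeneousSubmodule l) (f := X i) rfl z) = fres _ (Proj.awayToSection _ _ z) :=
    congr($(Proj.awayMap_awayToSection (homogeneousSubmodule σ k)
    (X_mem_homogeneousSubmodule l) (f := X i) rfl) z)
  have h₂ (z) : Proj.awayToSection _ _ (awayMap (homogeneousSubmodule σ k)
      (X_mem_homogeneousSubmodule i) (f := X l) (mul_comm (X i) (X l)) z) =
        fres _ (Proj.awayToSection _ _ z) :=
    congr($(Proj.awayMap_awayToSection (homogeneousSubmodule σ k)
    (X_mem_homogeneousSubmodule i) (f := X l) (mul_comm (X i) (X l))) z)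
  have key : awayMap (homogeneousSubmodule σ k) (X_mem_homogeneousSubmodule l) (f := X i) rfl
      (fracX i l) * awayMap (homogeneousSubmodule σ k) (X_mem_homogeneousSubmodule i) (f := X l)
        (mul_comm (X i) (X l)) (fracX l j) =
      awayMap (homogeneousSubmodule σ k) (X_mem_homogeneousSubmodule l) (f := X i) rfl
      (fracX i j) := by
    simp only [fracX, awayMap_mk]
    ext
    simp only [val_mul, Away.val_mk, Localization.mk_mul]
    rw [Localization.mk_eq_mk_iff, Localization.r_iff_exists]
    refine ⟨1, ?_⟩
    simp
    ring
  have := congrArg (fun z => fres hle (Proj.awayToSection _ _ z)) key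
  simp only [map_mul, h₁, h₂, fres_fres] at this
  exact this

lemma basicOpen_projCoord (i l : σ) :
    (Proj (homogeneousSubmodule σ k)).basicOpen (projCoord k i l) = projOpen k i ⊓ projOpen k l := by
  have h := Proj.awayι_preimage_basicOpen (homogeneousSubmodule σ k) (X_mem_homogeneousSubmodule i)
    one_pos (X_mem_homogeneousSubmodule (k := k) l) one_pos
  have hel : Away.isLocalizationElem (X_mem_homogeneousSubmodule (k := k) i)
      (X_mem_homogeneousSubmodule l) = fracX i l := by
    simp only [fracX, Away.isLocalizationElem, pow_one]
  rw [hel] at h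
  have hι : (projOpen k i).ι = Proj.basicOpenToSpec (homogeneousSubmodule σ k) (X i) ≫
      Proj.awayι (homogeneousSubmodule σ k) (X i) (X_mem_homogeneousSubmodule i) one_pos := by
    rw [← Proj.basicOpenIsoSpec_inv_ι, ← Proj.basicOpenIsoSpec_hom _ _
      (X_mem_homogeneousSubmodule i) one_pos, Iso.hom_inv_id_assoc]
  have h1 : (projOpen k i).ι ⁻¹ᵁ projOpen k l =
      (projOpen k i).ι ⁻¹ᵁ (Proj (homogeneousSubmodule σ k)).basicOpen (projCoord k i l) := by
    refine Eq.trans ?_ (Scheme.Opens.toSpecΓ_preimage_basicOpen (projOpen k i) (projCoord k i l))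
    conv_lhs => rw [hι, Scheme.Hom.comp_preimage, h]
    rfl
  have h2 := congrArg ((projOpen k i).ι ''ᵁ ·) h1
  simp only [Scheme.Hom.image_preimage_eq_opensRange_inf, Scheme.Opens.opensRange_ι] at h2
  rw [h2]
  exact (inf_eq_right.mpr <| Scheme.basicOpen_le _ _).symm

/-- The structure morphism of projective space. -/
def projToSpec (k σ : Type) [Field k] : Proj (homogeneousSubmodule σ k) ⟶ Spec (.of k) :=
  Proj.toSpecZero _ ≫ Spec.map (CommRingCat.ofHom (algebraMap k (homogeneousSubmodule σ k 0)))

variable (k) in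
/-- The coordinate ring of a standard chart of projective space. -/
def projChart (i : σ) :
    MvPolynomial {j // j ≠ i} k ≃+* Γ(Proj (homogeneousSubmodule σ k), projOpen k i) :=
  (RingEquiv.ofBijective (toAway i) (toAway_bijective i)).trans
    (Proj.basicOpenIsoAway _ _ (X_mem_homogeneousSubmodule i) one_pos).commRingCatIsoToRingEquiv

lemma projChart_X (i : σ) (j : {j // j ≠ i}) : projChart k i (X j) = projCoord k i j := by
  change Proj.awayToSection _ _ (toAway i (X j)) = _
  simp [toAway, projCoord]

lemma projChart_C (i : σ) (c : k) : projChart k i (C c) =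
    (projToSpec k σ).appLE ⊤ (projOpen k i) le_top ((Scheme.ΓSpecIso (.of k)).inv c) := by
  let F : CommRingCat.of k ⟶ Γ(Proj (homogeneousSubmodule σ k), projOpen k i) :=
    CommRingCat.ofHom ((fromZeroRingHom _ _).comp (algebraMap k (homogeneousSubmodule σ k 0))) ≫
      Proj.awayToSection _ _
  have hι : (projOpen k i).ι = Proj.basicOpenToSpec (homogeneousSubmodule σ k) (X i) ≫
      Proj.awayι (homogeneousSubmodule σ k) (X i) (X_mem_homogeneousSubmodule i) one_pos := by
    rw [← Proj.basicOpenIsoSpec_inv_ι, ← Proj.basicOpenIsoSpec_hom _ _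
      (X_mem_homogeneousSubmodule i) one_pos, Iso.hom_inv_id_assoc]
  have h1 : (projOpen k i).ι ≫ projToSpec k σ = (projOpen k i).toSpecΓ ≫ Spec.map F := by
    rw [hι, projToSpec, Category.assoc, Proj.awayι_toSpecZero_assoc, Proj.basicOpenToSpec, Category.assoc,
      ← Spec.map_comp, ← Spec.map_comp]
    rfl
  trans F c
  · change Proj.awayToSection _ _ (toAway i (C c)) = _
    simp [toAway, F]
  exact congr($(eq_appLE_of_ι_comp_eq h1) c)

end MvPolynomial

namespace AlgebraicGeometry.Scheme

attribute [local instance] MvPolynomial.algebraMvPolynomial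

/-- The base change of a coordinate chart with polynomial coordinate ring. -/
lemma exists_chart_pullback {Y S : Scheme.{0}} [IsAffine S] {k τ : Type} [Field k]
    (p : Y ⟶ Spec (.of k)) (g : S ⟶ Spec (.of k)) [Algebra k Γ(S, ⊤)]
    (hA : ∀ c, algebraMap k Γ(S, ⊤) c = g.appTop ((ΓSpecIso (.of k)).inv c)) {D : Y.Opens}
    (hD : IsAffineOpen D) (T : MvPolynomial τ k ≃+* Γ(Y, D))
    (hT : ∀ c, T (MvPolynomial.C c) = p.appLE ⊤ D le_top ((ΓSpecIso (.of k)).inv c)) :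
    IsAffineOpen (pullback.fst p g ⁻¹ᵁ D) ∧
    ∃ φ : MvPolynomial τ Γ(S, ⊤) ≃+* Γ(pullback p g, pullback.fst p g ⁻¹ᵁ D),
      (∀ f, φ (MvPolynomial.map (algebraMap k Γ(S, ⊤)) f) = (pullback.fst p g).app D (T f)) ∧
      ∀ a, φ (MvPolynomial.C a) = (pullback.snd p g).appLE ⊤ _ le_top a := by
  have hk : IsAffineOpen (⊤ : (Spec (CommRingCat.of k)).Opens) := isAffineOpen_top _
  have hS : IsAffineOpen (⊤ : S.Opens) := isAffineOpen_top _
  refine ⟨?_, ?_⟩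
  · have : IsAffineHom g := inferInstance
    have : IsAffineHom (pullback.fst p g) :=
      isAffineHom_isStableUnderBaseChange.of_isPullback (IsPullback.of_hasPullback p g).flip this
    exact hD.preimage _
  have H := isIso_pushoutSection_of_isAffineOpen (IsPullback.of_hasPullback p g)
    (le_top : ⊤ ≤ g ⁻¹ᵁ ⊤) (le_top : D ≤ p ⁻¹ᵁ ⊤) (UY := pullback.fst p g ⁻¹ᵁ D) (by simp) hk hS hD
  replace H := (isIso_pushoutSection_iff _ _ _ _).mp H
  have H' := (CommRingCat.isPushout_of_isPushout k Γ(S, ⊤) (MvPolynomial τ k)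
    (MvPolynomial τ Γ(S, ⊤))).flip
  have H'' : IsPushout (p.appLE ⊤ D le_top) (g.appLE ⊤ ⊤ le_top)
      (CommRingCat.ofHom (T.symm : Γ(Y, D) →+* _) ≫
        CommRingCat.ofHom (algebraMap (MvPolynomial τ k) (MvPolynomial τ Γ(S, ⊤))))
      (CommRingCat.ofHom (algebraMap Γ(S, ⊤) (MvPolynomial τ Γ(S, ⊤)))) := by
    refine H'.of_iso (ΓSpecIso (.of k)).symm T.toCommRingCatIso (.refl _) (.refl _) ?_ ?_ ?_ ?_
    · exact CommRingCat.hom_ext (RingHom.ext fun c => hT c)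
    · refine CommRingCat.hom_ext (RingHom.ext fun c => ?_)
      refine (hA c).trans ?_
      simp [Scheme.Hom.appLE]
      rfl
    · refine CommRingCat.hom_ext (RingHom.ext fun f => ?_)
      change algebraMap _ _ f = algebraMap _ _ (T.symm (T f))
      rw [T.symm_apply_apply]
    · rfl
  refine ⟨(H''.isoIsPushout _ _ H).commRingCatIsoToRingEquiv, fun f => ?_, fun a => ?_⟩
  · have := congr($(H''.inl_isoIsPushout_hom _ _ H) (T f))
    rw [Scheme.Hom.app_eq_appLE, ← this]
    change _ = (H''.isoIsPushout _ _ H).commRingCatIsoToRingEquiv (algebraMap _ _ (T.symm (T f)))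
    rw [T.symm_apply_apply]
    rfl
  · exact congr($(H''.inr_isoIsPushout_hom _ _ H) a)

end AlgebraicGeometry.Scheme

/-- The Krull dimension of a space is bounded by the dimensions of the members of an open cover. -/
lemma topologicalKrullDim_le_of_iSup_eq_top {T : Type*} [TopologicalSpace T] {ι : Type*}
    {D : ι → Opens T} (hD : ⨆ i, D i = ⊤) {n : WithBot ℕ∞}
    (h : ∀ i, topologicalKrullDim (D i) ≤ n) : topologicalKrullDim T ≤ n := by
  refine iSup_le fun p => ?_
  obtain ⟨x, hx⟩ := p.head.isIrreducible.nonempty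
  obtain ⟨i, hi⟩ := Opens.mem_iSup.mp (hD ▸ Opens.mem_top x : x ∈ ⨆ i, D i)
  have hmem (j) : x ∈ (p j : Set T) := (p.monotone (Fin.zero_le j)) hx
  have hlt (j : Fin p.length) : p j.castSucc < p j.succ := p.step j
  let F (j) : IrreducibleCloseds (D i) :=
    ⟨(Subtype.val : D i → T) ⁻¹' (p j : Set T), ⟨⟨(⟨x, hi⟩ : D i), hmem j⟩,
      (p j).isIrreducible.isPreirreducible.preimage (D i).isOpen.isOpenEmbedding_subtypeVal⟩,
      (p j).isClosed.preimage continuous_subtype_val⟩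
  have hF (j : Fin p.length) : F j.castSucc < F j.succ := by
    refine lt_of_le_not_ge (fun y hy => (hlt j).le hy) fun hle => (hlt j).not_ge ?_
    have := subset_closure_inter_of_isPreirreducible_of_isOpen
      (p j.succ).isIrreducible.isPreirreducible (D i).isOpen ⟨x, hmem _, hi⟩
    exact this.trans (closure_minimal
      (fun y hy => hle (show (⟨y, hy.2⟩ : D i) ∈ _ from hy.1)) (p j.castSucc).isClosed)
  let q : LTSeries (IrreducibleCloseds (D i)) := ⟨p.length, F, hF⟩
  exact (Order.LTSeries.length_le_krullDim q).trans (h i)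

namespace MvPolynomial

lemma height_of_isMaximal {k τ : Type} [Field k] [Finite τ] (m : Ideal (MvPolynomial τ k))
    [hm : m.IsMaximal] : m.height = Nat.card τ := by
  induction τ using Finite.induction_empty_option with
  | of_equiv e ih =>
    rename_i α β
    have hm' : (m.comap (renameEquiv k e).toRingEquiv).IsMaximal :=
      Ideal.comap_isMaximal_of_equiv _
    rw [← RingEquiv.height_comap (renameEquiv k e).toRingEquiv, ih, Nat.card_congr e]
  | h_empty =>
    have : m = ⊥ := by
      have hF : IsField (MvPolynomial PEmpty k) :=
        (isEmptyRingEquiv k PEmpty).toMulEquiv.isField (Field.toIsField k)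
      let _ := hF.toField
      exact (eq_bot_or_eq_top m).resolve_right hm.ne_top
    rw [this]
    simp
  | h_option ih =>
    rename_i α _
    let e := (optionEquivLeft k α).toRingEquiv
    have hm' : (m.comap e.symm).IsMaximal := Ideal.comap_isMaximal_of_equiv _
    have := Polynomial.isMaximal_comap_C_of_isJacobsonRing (m.comap e.symm)
    have : (m.comap e.symm).LiesOver ((m.comap e.symm).comap Polynomial.C) := ⟨rfl⟩
    rw [← RingEquiv.height_comap e.symm,
      Polynomial.height_eq_height_add_one ((m.comap e.symm).comap Polynomial.C), ih]
    simp

/-- A prime of height `h` in an `n`-dimensional polynomial ring has a quotient of dimension at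
least `n - h`. -/
lemma le_ringKrullDim_quotient_add_height {k τ : Type} [Field k] [Finite τ]
    (P : Ideal (MvPolynomial τ k)) [P.IsPrime] :
    (Nat.card τ : WithBot ℕ∞) ≤ ringKrullDim (MvPolynomial τ k ⧸ P) + P.height := by
  obtain ⟨s, hs, hcard⟩ := P.exists_finset_card_eq_height_of_isNoetherianRing
  have hfin := Ideal.finite_minimalPrimes_of_isNoetherianRing _
    (Ideal.span (s : Set (MvPolynomial τ k)))
  obtain ⟨f, hf, hfP⟩ : ∃ f, (∀ Q ∈ (Ideal.span (s : Set (MvPolynomial τ k))).minimalPrimes,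
      Q ≠ P → f ∈ Q) ∧ f ∉ P := by
    have key (Q : Ideal (MvPolynomial τ k)) : ∃ f, (Q ∈ (Ideal.span
        (s : Set (MvPolynomial τ k))).minimalPrimes → Q ≠ P → f ∈ Q) ∧ f ∉ P := by
      by_cases h : Q ≤ P
      · exact ⟨1, fun hQ hne => (hne (h.antisymm (hs.2 hQ.1 h))).elim,
          fun h => Ideal.IsPrime.ne_top' ((Ideal.eq_top_iff_one _).mpr h)⟩
      · obtain ⟨f, hfQ, hfP⟩ := Set.not_subset.mp h
        exact ⟨f, fun _ _ => hfQ, hfP⟩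
    choose f hf hfP using key
    refine ⟨∏ Q ∈ hfin.toFinset, f Q, fun Q hQ hne => ?_, fun h => ?_⟩
    · exact Ideal.mem_of_dvd _ (Finset.dvd_prod_of_mem f (hfin.mem_toFinset.mpr hQ)) (hf Q hQ hne)
    · obtain ⟨Q, -, hQ⟩ := (Ideal.IsPrime.prod_mem_iff).mp h
      exact hfP Q hQ
  obtain ⟨m, hm, hPm, hfm⟩ : ∃ m : Ideal (MvPolynomial τ k), m.IsMaximal ∧ P ≤ m ∧ f ∉ m := by
    have hP : P.jacobson = P := IsJacobsonRing.out inferInstance (Ideal.IsPrime.isRadical ‹_›)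
    rw [← hP, Ideal.jacobson, Ideal.mem_sInf] at hfP
    push Not at hfP
    obtain ⟨m, ⟨h1, h2⟩, h3⟩ := hfP
    exact ⟨m, h2, h1, h3⟩
  have hsm : (s : Set (MvPolynomial τ k)) ⊆ m := fun x hx => hPm (hs.1.2 (Ideal.subset_span hx))
  have h1 := Ideal.height_le_height_add_encard_of_subset _ hsm
  rw [height_of_isMaximal, Set.encard_coe_eq_coe_finsetCard, hcard] at h1
  have h2 : ((m.map (Ideal.Quotient.mk (Ideal.span s))).height : WithBot ℕ∞) ≤
      ringKrullDim (MvPolynomial τ k ⧸ P) := by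
    have hmm : (m.map (Ideal.Quotient.mk (Ideal.span (s : Set (MvPolynomial τ k))))).IsPrime :=
      Ideal.isPrime_map_quotientMk_of_isPrime (Ideal.span_le.mpr hsm)
    have hcm : (m.map (Ideal.Quotient.mk (Ideal.span (s : Set (MvPolynomial τ k))))).comap
        (Ideal.Quotient.mk _) = m := by
      rw [Ideal.comap_map_of_surjective' _ Ideal.Quotient.mk_surjective, Ideal.mk_ker,
        sup_eq_left, Ideal.span_le]
      exact hsm
    rw [ringKrullDim_quotient, PrimeSpectrum.height_eq_orderHeight ⟨_, hmm⟩]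
    have hinj : StrictMono (PrimeSpectrum.comap
        (Ideal.Quotient.mk (Ideal.span (s : Set (MvPolynomial τ k))))) :=
      Monotone.strictMono_of_injective (fun _ _ h => Ideal.comap_mono h)
        (PrimeSpectrum.comap_injective_of_surjective _ Ideal.Quotient.mk_surjective)
    have hle (q : LTSeries (PrimeSpectrum (MvPolynomial τ k ⧸ Ideal.span
        (s : Set (MvPolynomial τ k))))) (hq : q.last = ⟨_, hmm⟩) (j) :
        P ≤ (PrimeSpectrum.comap (Ideal.Quotient.mk _) (q j)).asIdeal := by
      have h3 : Ideal.span (s : Set (MvPolynomial τ k)) ≤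
          (PrimeSpectrum.comap (Ideal.Quotient.mk _) (q j)).asIdeal := by
        conv_lhs => rw [← Ideal.mk_ker (I := Ideal.span (s : Set (MvPolynomial τ k)))]
        exact Ideal.comap_mono bot_le
      obtain ⟨Q, hQ, hQle⟩ := Ideal.exists_minimalPrimes_le h3
      by_cases hQP : Q = P
      · exact hQP ▸ hQle
      · refine (hfm ?_).elim
        rw [← hcm]
        have h4 : (q j).asIdeal ≤ m.map (Ideal.Quotient.mk _) := by
          have : q j ≤ q.last := q.monotone (Fin.le_last j)
          rw [hq] at this
          exact this
        exact Ideal.comap_mono h4 (hQle (hf Q hQ hQP))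
    have hlen (q : LTSeries (PrimeSpectrum (MvPolynomial τ k ⧸ Ideal.span
        (s : Set (MvPolynomial τ k))))) (hq : q.last = ⟨_, hmm⟩) : (q.length : WithBot ℕ∞) ≤
          Order.krullDim (PrimeSpectrum.zeroLocus (P : Set (MvPolynomial τ k))) := by
      let F (j) : PrimeSpectrum.zeroLocus (P : Set (MvPolynomial τ k)) := ⟨_, hle q hq j⟩
      have hF (j : Fin q.length) : F j.castSucc < F j.succ := hinj (q.step j)
      exact Order.LTSeries.length_le_krullDim ⟨q.length, F, hF⟩
    have hne : Nonempty (PrimeSpectrum.zeroLocus (P : Set (MvPolynomial τ k))) :=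
      ⟨⟨P, ‹_›⟩, le_refl P⟩
    obtain ⟨d, hd⟩ := WithBot.ne_bot_iff_exists.mp (Order.krullDim_ne_bot_iff.mpr hne)
    rw [← hd] at hlen ⊢
    exact WithBot.coe_le_coe.mpr (Order.height_le fun q hq => WithBot.coe_le_coe.mp (hlen q hq))
  calc (Nat.card τ : WithBot ℕ∞) = ((Nat.card τ : ℕ∞) : WithBot ℕ∞) := rfl
    _ ≤ _ := WithBot.coe_le_coe.mpr h1
    _ ≤ _ := by
      rw [WithBot.coe_add]
      gcongr
end MvPolynomial

namespace AlgebraicGeometry.Scheme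

variable {Y : Scheme.{0}} {D : Y.Opens} {R : Type} [CommRing R]

/-- In a coordinate ring of an open subset `D`, the ideal of functions vanishing on the complement
of `U`. -/
def complIdeal (T : R ≃+* Γ(Y, D)) (U : Y.Opens) : Ideal R where
  carrier := {f | Y.basicOpen (T f) ≤ U}
  zero_mem' := by simp
  add_mem' {f g} hf hg x hx := by
    have hxD := Y.basicOpen_le _ hx
    rw [Y.mem_basicOpen _ x hxD, map_add, map_add] at hx
    obtain h | h := IsLocalRing.isUnit_or_isUnit_of_isUnit_add hx
    · exact hf ((Y.mem_basicOpen _ x hxD).mpr h)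
    · exact hg ((Y.mem_basicOpen _ x hxD).mpr h)
  smul_mem' f g hg := by
    simp only [Set.mem_ofPred_eq, smul_eq_mul, map_mul, Y.basicOpen_mul] at hg ⊢
    exact inf_le_right.trans hg

lemma mem_complIdeal {T : R ≃+* Γ(Y, D)} {U : Y.Opens} {f : R} :
    f ∈ complIdeal T U ↔ Y.basicOpen (T f) ≤ U := .rfl

lemma inf_eq_iSup_complIdeal (hD : IsAffineOpen D) (T : R ≃+* Γ(Y, D)) (U : Y.Opens) :
    D ⊓ U = ⨆ f : complIdeal T U, Y.basicOpen (T f) := by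
  refine le_antisymm (fun x hx => ?_) (iSup_le fun f => le_inf (Y.basicOpen_le _) f.2)
  obtain ⟨f, hfU, hxf⟩ := hD.exists_basicOpen_le ⟨x, hx.2⟩ hx.1
  exact Opens.mem_iSup.mpr ⟨⟨T.symm f, by rwa [mem_complIdeal, T.apply_symm_apply]⟩, by simpa using hxf⟩

lemma ringKrullDim_quotient_le_of_complIdeal_le (hD : IsAffineOpen D) (T : R ≃+* Γ(Y, D))
    (U : Y.Opens) {P : Ideal R} (hP : complIdeal T U ≤ P) :
    ringKrullDim (R ⧸ P) ≤ topologicalKrullDim ((U : Set Y)ᶜ : Set Y) := by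
  rw [← PrimeSpectrum.topologicalKrullDim_eq_ringKrullDim]
  let F : Γ(Y, D) →+* R ⧸ P := (Ideal.Quotient.mk P).comp T.symm
  have hF : Function.Surjective F := Ideal.Quotient.mk_surjective.comp T.symm.surjective
  have h1 : Topology.IsInducing (fun q => hD.fromSpec (PrimeSpectrum.comap F q)) :=
    hD.fromSpec.isOpenEmbedding.isInducing.comp
      (PrimeSpectrum.isClosedEmbedding_comap_of_surjective _ F hF).isInducing
  have h2 (q) : hD.fromSpec (PrimeSpectrum.comap F q) ∈ ((U : Set Y)ᶜ : Set Y) := by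
    intro hU
    have hm : hD.fromSpec (PrimeSpectrum.comap F q) ∈ D ⊓ U :=
      ⟨hD.range_fromSpec.subset (Set.mem_range_self _), hU⟩
    rw [inf_eq_iSup_complIdeal hD T] at hm
    obtain ⟨f, hf⟩ := Opens.mem_iSup.mp hm
    have hf' : PrimeSpectrum.comap F q ∈ hD.fromSpec ⁻¹ᵁ Y.basicOpen (T f) := hf
    rw [hD.fromSpec_preimage_basicOpen] at hf'
    refine hf' ?_
    change Ideal.Quotient.mk P (T.symm (T f)) ∈ q.asIdeal
    rw [T.symm_apply_apply, Ideal.Quotient.eq_zero_iff_mem.mpr (hP f.2)]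
    exact zero_mem _
  exact (h1.codRestrict h2).topologicalKrullDim_le

end AlgebraicGeometry.Scheme

namespace MvPolynomial
open AlgebraicGeometry.Scheme
variable {k σ : Type} [Field k]

lemma isAffineOpen_projOpen (i : σ) : IsAffineOpen (projOpen k i) :=
  Proj.isAffineOpen_basicOpen _ _ (X_mem_homogeneousSubmodule i) one_pos

lemma iSup_projOpen : ⨆ i : σ, projOpen k i = ⊤ := by
  refine Proj.iSup_basicOpen_eq_top' _ _ (fun i => ⟨1, X_mem_homogeneousSubmodule i⟩)
    (Algebra.eq_top_iff.mpr fun f => ?_)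
  induction f using MvPolynomial.induction_on with
  | C c => exact Subalgebra.algebraMap_mem _ (⟨C c, isHomogeneous_C _ c⟩ : homogeneousSubmodule σ k 0)
  | add f g hf hg => exact add_mem hf hg
  | mul_X f i hf => exact mul_mem hf (Algebra.subset_adjoin ⟨i, rfl⟩)

lemma topologicalKrullDim_proj_le [Finite σ] (i : σ) :
    topologicalKrullDim (Proj (homogeneousSubmodule σ k)) ≤ (Nat.card {j // j ≠ i} : WithBot ℕ∞) := by
  refine topologicalKrullDim_le_of_iSup_eq_top iSup_projOpen fun l => ?_
  refine (IsHomeomorph.topologicalKrullDim_eq _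
    (Scheme.homeoOfIso (isAffineOpen_projOpen l).isoSpec).isHomeomorph).trans_le ?_
  refine (PrimeSpectrum.topologicalKrullDim_eq_ringKrullDim _).trans_le ?_
  rw [← ringKrullDim_eq_of_ringEquiv (projChart k l), MvPolynomial.ringKrullDim_of_isNoetherianRing]
  have hcard (j : σ) : Nat.card {a // a ≠ j} = Nat.card σ - 1 := by
    classical
    have := Fintype.ofFinite σ
    simp
  rw [hcard, hcard]
  simp

lemma three_le_height_of_complIdeal_le [Finite σ] {U : (Proj (homogeneousSubmodule σ k)).Opens}
    (hU : topologicalKrullDim ((U : Set (Proj (homogeneousSubmodule σ k)))ᶜ :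
      Set (Proj (homogeneousSubmodule σ k))) + 3 ≤
        topologicalKrullDim (Proj (homogeneousSubmodule σ k)))
    (i : σ) {P : Ideal (MvPolynomial {j // j ≠ i} k)} [P.IsPrime]
    (hP : complIdeal (projChart k i) U ≤ P) : 3 ≤ P.height := by
  have h1 := ringKrullDim_quotient_le_of_complIdeal_le (isAffineOpen_projOpen i) _ U hP
  have h2 := le_ringKrullDim_quotient_add_height P
  have h3 := hU.trans (topologicalKrullDim_proj_le i)
  have h4 : ringKrullDim (MvPolynomial {j // j ≠ i} k ⧸ P) ≠ ⊥ :=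
    Order.krullDim_ne_bot_iff.mpr inferInstance
  generalize topologicalKrullDim ((U : Set (Proj (homogeneousSubmodule σ k)))ᶜ :
      Set (Proj (homogeneousSubmodule σ k))) = z at *
  obtain ⟨d, rfl⟩ := WithBot.ne_bot_iff_exists.mp (ne_bot_of_le_ne_bot h4 h1)
  have h5 : ((d + 3 : ℕ∞) : WithBot ℕ∞) ≤ ((d + P.height : ℕ∞) : WithBot ℕ∞) :=
    h3.trans (h2.trans (by push_cast; gcongr))
  have h6 : d ≠ ⊤ := by
    rintro rfl
    have : ((⊤ : ℕ∞) : WithBot ℕ∞) ≤ ((Nat.card {j // j ≠ i} : ℕ∞) : WithBot ℕ∞) := h3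
    exact absurd (WithBot.coe_le_coe.mp this) (by simp)
  exact (ENat.add_le_add_iff_left h6).mp (WithBot.coe_le_coe.mp h5)
end MvPolynomial

namespace AlgebraicGeometry.Scheme

lemma fres_app {X Y : Scheme.{0}} (f : X ⟶ Y) {D D' : Y.Opens} (h : D' ≤ D) (s : Γ(Y, D)) :
    fres (f.preimage_mono h) (f.app D s) = f.app D' (fres h s) :=
  congr($(f.naturality (homOfLE h).op) s).symm

lemma fres_appLE {X Y : Scheme.{0}} (f : X ⟶ Y) {D : Y.Opens} {W W' : X.Opens} (h : W ≤ f ⁻¹ᵁ D)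
    (h' : W' ≤ W) (s : Γ(Y, D)) : fres h' (f.appLE D W h s) = f.appLE D W' (h'.trans h) s :=
  congr($(f.appLE_map h (homOfLE h').op) s)

end AlgebraicGeometry.Scheme

namespace MvPolynomial
open AlgebraicGeometry.Scheme
variable {k σ : Type} [Field k] {S : Scheme.{0}} (g : S ⟶ Spec (.of k))

/-- The preimage of a standard chart of projective space over `S`. -/
abbrev relOpen (i : σ) : (pullback (projToSpec k σ) g).Opens :=
  pullback.fst (projToSpec k σ) g ⁻¹ᵁ projOpen k i

lemma iSup_relOpen : ⨆ i : σ, relOpen g i = ⊤ := by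
  rw [← Scheme.Hom.preimage_iSup, iSup_projOpen]
  rfl

lemma fres_app_projCoord_mul (i l j : σ) :
    fres (inf_le_left : relOpen g i ⊓ relOpen g l ≤ _)
        ((pullback.fst (projToSpec k σ) g).app _ (projCoord k i l)) *
      fres inf_le_right ((pullback.fst (projToSpec k σ) g).app _ (projCoord k l j)) =
      fres inf_le_left ((pullback.fst (projToSpec k σ) g).app _ (projCoord k i j)) := by
  have h1 := fres_app (pullback.fst (projToSpec k σ) g)
    (inf_le_left : projOpen k i ⊓ projOpen k l ≤ _)
  have h2 := fres_app (pullback.fst (projToSpec k σ) g)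
    (inf_le_right : projOpen k i ⊓ projOpen k l ≤ _) (projCoord k l j)
  have := congrArg ((pullback.fst (projToSpec k σ) g).app _) (projCoord_mul (k := k) i l j)
  rw [map_mul, ← h1, ← h2, ← h1] at this
  exact this

variable {g} [IsAffine S] [Algebra k Γ(S, ⊤)]

lemma isAffineOpen_relOpen
    (hA : ∀ c, algebraMap k Γ(S, ⊤) c = g.appTop ((ΓSpecIso (.of k)).inv c)) (i : σ) :
    IsAffineOpen (relOpen g i) :=
  (exists_chart_pullback (projToSpec k σ) g hA (isAffineOpen_projOpen i) (projChart k i)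
    (projChart_C i)).1

variable (hA : ∀ c, algebraMap k Γ(S, ⊤) c = g.appTop ((ΓSpecIso (.of k)).inv c))

/-- The coordinate ring of a standard chart of projective space over an affine scheme. -/
def relChart (i : σ) : MvPolynomial {j // j ≠ i} Γ(S, ⊤) ≃+*
    Γ(pullback (projToSpec k σ) g, relOpen g i) :=
  (exists_chart_pullback (projToSpec k σ) g hA (isAffineOpen_projOpen i) (projChart k i)
    (projChart_C i)).2.choose

lemma relChart_map (i : σ) (f : MvPolynomial {j // j ≠ i} k) :
    relChart hA i (map (algebraMap k Γ(S, ⊤)) f) =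
      (pullback.fst (projToSpec k σ) g).app _ (projChart k i f) :=
  (exists_chart_pullback (projToSpec k σ) g hA (isAffineOpen_projOpen i) (projChart k i)
    (projChart_C i)).2.choose_spec.1 f

lemma relChart_C (i : σ) (a : Γ(S, ⊤)) :
    relChart hA i (C a) = (pullback.snd (projToSpec k σ) g).appLE ⊤ _ le_top a :=
  (exists_chart_pullback (projToSpec k σ) g hA (isAffineOpen_projOpen i) (projChart k i)
    (projChart_C i)).2.choose_spec.2 a

lemma relChart_X (i : σ) (j : {j // j ≠ i}) :
    relChart hA i (X j) = (pullback.fst (projToSpec k σ) g).app _ (projCoord k i j) := by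
  rw [← map_X (algebraMap k Γ(S, ⊤)), relChart_map, projChart_X]

lemma fres_relChart_C (i l : σ) (a : Γ(S, ⊤)) :
    fres (inf_le_left : relOpen g i ⊓ relOpen g l ≤ _) (relChart hA i (C a)) =
      fres inf_le_right (relChart hA l (C a)) := by
  rw [relChart_C, relChart_C]
  exact (fres_appLE _ _ _ _).trans (fres_appLE _ _ _ _).symm

lemma relOpen_inf (i l : σ) (hl : l ≠ i) :
    relOpen g i ⊓ relOpen g l = Scheme.basicOpen _ (relChart hA i (X ⟨l, hl⟩)) := by
  rw [relChart_X, ← Scheme.preimage_basicOpen, basicOpen_projCoord]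
  rfl

lemma relOpen_inf_preimage (U : (Proj (homogeneousSubmodule σ k)).Opens) (i : σ) :
    relOpen g i ⊓ pullback.fst (projToSpec k σ) g ⁻¹ᵁ U =
      ⨆ f : complIdeal (projChart k i) U,
        Scheme.basicOpen _ (relChart hA i (map (algebraMap k Γ(S, ⊤)) f)) := by
  simp_rw [relChart_map, ← Scheme.preimage_basicOpen]
  rw [← Scheme.Hom.preimage_iSup, ← inf_eq_iSup_complIdeal (isAffineOpen_projOpen i)]
  rfl

end MvPolynomial

namespace MvPolynomial
open AlgebraicGeometry.Scheme
variable {k σ : Type} [Field k] [Finite σ] {S : Scheme.{0}} {g : S ⟶ Spec (.of k)}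
  [IsAffine S] [Algebra k Γ(S, ⊤)]
  {U : (Proj (homogeneousSubmodule σ k)).Opens}

lemma isHartogs_pullback
    (hA : ∀ c, algebraMap k Γ(S, ⊤) c = g.appTop ((ΓSpecIso (.of k)).inv c))
    (hU : topologicalKrullDim ((U : Set (Proj (homogeneousSubmodule σ k)))ᶜ :
        Set (Proj (homogeneousSubmodule σ k))) + 3 ≤
          topologicalKrullDim (Proj (homogeneousSubmodule σ k))) :
    (pullback (projToSpec k σ) g).IsHartogs (pullback.fst (projToSpec k σ) g ⁻¹ᵁ U) :=
  isHartogs_of_cover (iSup_relOpen g) fun i _ hW =>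
    bijective_fres_of_chart (isAffineOpen_relOpen hA i) (relChart hA i)
      (fun _ _ hP => (by norm_num : (2 : ℕ∞) ≤ 3).trans (three_le_height_of_complIdeal_le hU i hP))
      (relOpen_inf_preimage hA U i) hW

lemma exists_isGen_of_isHartogs
    (hA : ∀ c, algebraMap k Γ(S, ⊤) c = g.appTop ((ΓSpecIso (.of k)).inv c))
    (hU : topologicalKrullDim ((U : Set (Proj (homogeneousSubmodule σ k)))ᶜ :
        Set (Proj (homogeneousSubmodule σ k))) + 3 ≤
          topologicalKrullDim (Proj (homogeneousSubmodule σ k)))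
    {N : (pullback (projToSpec k σ) g).Modules}
    (hN : N.IsHartogs (pullback.fst (projToSpec k σ) g ⁻¹ᵁ U))
    (hgen : ∀ y ∈ pullback.fst (projToSpec k σ) g ⁻¹ᵁ U, ∃ V, y ∈ V ∧ ∃ e, N.IsGen V e)
    (x : (pullback (projToSpec k σ) g : Scheme)) : ∃ V, x ∈ V ∧ ∃ e, N.IsGen V e := by
  by_cases hxU : x ∈ pullback.fst (projToSpec k σ) g ⁻¹ᵁ U
  · exact hgen x hxU
  have hx : x ∈ ⨆ i : σ, relOpen g i := (iSup_relOpen g).symm ▸ Opens.mem_top x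
  obtain ⟨i, hxi⟩ := Opens.mem_iSup.mp hx
  have hI (j : σ) (P : Ideal (MvPolynomial {l // l ≠ j} k)) (_ : P.IsPrime) :=
    three_le_height_of_complIdeal_le hU j (P := P)
  have hI' (j : σ) (P : Ideal (MvPolynomial {l // l ≠ j} k)) (hP : P.IsPrime) (h) : 2 ≤ P.height :=
    (by norm_num : (2 : ℕ∞) ≤ 3).trans (hI j P hP h)
  let P : Ideal (MvPolynomial {j // j ≠ i} Γ(S, ⊤)) :=
    (IsLocalRing.maximalIdeal ((pullback (projToSpec k σ) g).presheaf.stalk x)).comap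
      (((pullback (projToSpec k σ) g).presheaf.germ _ x hxi).hom.comp (relChart hA i).toRingHom)
  have hP (f) : x ∈ (pullback (projToSpec k σ) g).basicOpen (relChart hA i f) ↔ f ∉ P := by
    rw [Scheme.mem_basicOpen _ _ _ hxi, Ideal.mem_comap, IsLocalRing.mem_maximalIdeal,
      mem_nonunits_iff, not_not]
    rfl
  obtain ⟨l, hl⟩ : ∃ l, l ≠ i := by
    by_contra! hne
    have : IsEmpty {j // j ≠ i} := ⟨fun j => j.2 (hne j)⟩
    obtain h | h := eq_or_ne (complIdeal (projChart k i) U) ⊤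
    · rw [Ideal.eq_top_iff_one, mem_complIdeal, map_one, Scheme.basicOpen_of_isUnit _ isUnit_one] at h
      exact hxU (h hxi)
    · obtain ⟨m, hm, hle⟩ := Ideal.exists_le_maximal _ h
      have := hI i m hm.isPrime hle
      rw [height_of_isMaximal] at this
      simp at this
  obtain ⟨d, G, hGd, hG, ε, hε⟩ := Modules.exists_isGen_basicOpen_of_charts
    (isAffineOpen_relOpen hA l) hl.symm (relChart hA i) (relChart hA l) (relOpen_inf hA i l hl)
    (fres_relChart_C hA i l)
    (by rw [relChart_X, relChart_X, fres_app_projCoord_mul, projCoord_self, map_one, map_one])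
    (fun j hi hl => by rw [relChart_X, relChart_X, relChart_X, fres_app_projCoord_mul])
    (hI' l) (relOpen_inf_preimage hA U l) hgen (P.comap C)
  exact Modules.exists_isGen_of_chart (isAffineOpen_relOpen hA i) (relChart hA i) (hI i)
    (relOpen_inf_preimage hA U i) hN (isHartogs_pullback hA hU) hgen P hP hGd hG hε

end MvPolynomial

open AlgebraicGeometry.Scheme in
/-- Restriction of line bundles on projective space over an affine scheme to the preimage of an
open subset of projective space with complement of codimension at least three is an equivalence
of groupoids. -/
theorem lineBundle_restriction_proj {k σ : Type} [Field k] [Finite σ]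
    {U : (Proj (MvPolynomial.homogeneousSubmodule σ k)).Opens}
    (hU : topologicalKrullDim ((U : Set (Proj (MvPolynomial.homogeneousSubmodule σ k)))ᶜ :
      Set (Proj (MvPolynomial.homogeneousSubmodule σ k))) + 3 ≤
        topologicalKrullDim (Proj (MvPolynomial.homogeneousSubmodule σ k)))
    {S : Scheme.{0}} [IsAffine S] (g : S ⟶ Spec (.of k)) :
    (∀ M : ((pullback.fst (MvPolynomial.projToSpec k σ) g ⁻¹ᵁ U : Scheme.Opens _) :
        Scheme).Modules, M.IsLineBundle →
      ∃ L : (pullback (MvPolynomial.projToSpec k σ) g).Modules, L.IsLineBundle ∧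
        Nonempty ((Scheme.restrictModules _).obj L ≅ M)) ∧
    (∀ L₁ L₂ : (pullback (MvPolynomial.projToSpec k σ) g).Modules,
      L₁.IsLineBundle → L₂.IsLineBundle →
      Nonempty ((restrictModules (pullback.fst (MvPolynomial.projToSpec k σ) g ⁻¹ᵁ U)).obj L₁ ≅
          (restrictModules (pullback.fst (MvPolynomial.projToSpec k σ) g ⁻¹ᵁ U)).obj L₂) →
        Nonempty (L₁ ≅ L₂)) ∧
    (∀ L₁ L₂ : (pullback (MvPolynomial.projToSpec k σ) g).Modules,
      L₁.IsLineBundle → L₂.IsLineBundle →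
      Function.Bijective (fun e : L₁ ≅ L₂ =>
        (restrictModules (pullback.fst (MvPolynomial.projToSpec k σ) g ⁻¹ᵁ U)).mapIso e)) := by
  let _ : Algebra k Γ(S, ⊤) := ((ΓSpecIso (.of k)).inv ≫ g.appTop).hom.toAlgebra
  have hA (c : k) : algebraMap k Γ(S, ⊤) c = g.appTop ((ΓSpecIso (.of k)).inv c) := rfl
  have hX := MvPolynomial.isHartogs_pullback hA hU
  rw [Modules.restrictModules_eq]
  have h3 (L₁ L₂ : (pullback (MvPolynomial.projToSpec k σ) g).Modules)
      (h₁ : L₁.IsLineBundle) (h₂ : L₂.IsLineBundle) :=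
    Modules.bijective_restrict_mapIso (h₁.isHartogs hX) (h₂.isHartogs hX)
  refine ⟨fun M hM => ?_, fun L₁ L₂ h₁ h₂ ⟨e⟩ => ⟨((h3 L₁ L₂ h₁ h₂).2 e).choose⟩, h3⟩
  refine ⟨(Modules.pushforward (Scheme.Opens.ι _)).obj M,
    Modules.isLineBundle_of_exists_isGen (MvPolynomial.exists_isGen_of_isHartogs hA hU
      (Modules.isHartogs_pushforward M) fun y hy => Modules.exists_isGen_pushforward hM hy),
    ⟨(Modules.restrictFunctorAdjCounitIso (Scheme.Opens.ι _)).app M⟩⟩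

/-- If the complement of `U ⊆ ℙ(V)` has codimension at least three then, for any affine
`k`-scheme `S`, restriction of line bundles along the open immersion
`U × S ↪ ℙ(V) × S` is an equivalence of groupoids:
(1) every line bundle on `U × S` is isomorphic to the restriction of a line bundle on
`ℙ(V) × S` (essential surjectivity; in particular an extension exists);
(2) any two line bundles on `ℙ(V) × S` with isomorphic restrictions are isomorphic
(uniqueness of the extension up to isomorphism); and
(3) for line bundles `L₁`, `L₂` on `ℙ(V) × S`, restriction is a bijection from
isomorphisms `L₁ ≅ L₂` to isomorphisms of the restrictions (every isomorphism over
`U × S` extends uniquely). -/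
theorem lineBundle_restriction_equivalence_of_codim_three
    (U : (ProjSpace k V).Opens)
    (hcodim : topologicalKrullDim (((U : Set (ProjSpace k V)))ᶜ : Set (ProjSpace k V)) + 3 ≤
      topologicalKrullDim (ProjSpace k V))
    (S : Scheme) [IsAffine S] (g : S ⟶ Spec (CommRingCat.of k)) :
    (∀ M : ((pullback.fst (ProjSpace.toSpec k V) g ⁻¹ᵁ U : (pullback (ProjSpace.toSpec k V) g).Opens) :
        Scheme).Modules, M.IsLineBundle →
      ∃ L : (pullback (ProjSpace.toSpec k V) g).Modules, L.IsLineBundle ∧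
        Nonempty ((Scheme.restrictModules _).obj L ≅ M)) ∧
    (∀ L₁ L₂ : (pullback (ProjSpace.toSpec k V) g).Modules, L₁.IsLineBundle → L₂.IsLineBundle →
      Nonempty ((Scheme.restrictModules (pullback.fst (ProjSpace.toSpec k V) g ⁻¹ᵁ U)).obj L₁ ≅
          (Scheme.restrictModules (pullback.fst (ProjSpace.toSpec k V) g ⁻¹ᵁ U)).obj L₂) →
        Nonempty (L₁ ≅ L₂)) ∧
    (∀ L₁ L₂ : (pullback (ProjSpace.toSpec k V) g).Modules, L₁.IsLineBundle → L₂.IsLineBundle →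
      Function.Bijective
        (fun e : L₁ ≅ L₂ =>
          (Scheme.restrictModules (pullback.fst (ProjSpace.toSpec k V) g ⁻¹ᵁ U)).mapIso e)) := by
  exact lineBundle_restriction_proj hcodim g

end
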